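/- Let h be a Brouwer homeomorphism and let (x,y) be a singular pair of h: x and y are not in the same orbit and for all neighborhoods V_x of x and V_y of y there exist arbitrarily large positive integers n with h^n(V_x) ∩ V_y ≠ ∅. Then d_h(x,y) = 2 and y lies on the boundary of the h-ball B₁(x) (the union of all translation domains containing x). -/

import Mathlib

open Set Filter Topology

/-- The plane. -/
abbrev Plane : Type := ℝ × ℝ

/-- A homeomorphism of the plane preserves orientation iff it is isotopic to the identity. -/
def IsotopicToId (h : Plane ≃ₜ Plane) : Prop :=
  ∃ H : ℝ → Plane ≃ₜ Plane,
    Continuous (fun p : ℝ × Plane => H p.1 p.2) ∧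
    H 0 = Homeomorph.refl Plane ∧ H 1 = h

/-- A Brouwer homeomorphism: an orientation-preserving (i.e. isotopic to the identity),
fixed-point-free homeomorphism of the plane. -/
structure BrouwerHomeo where
  toHomeomorph : Plane ≃ₜ Plane
  orientationPreserving : IsotopicToId toHomeomorph
  fixedPointFree : ∀ x : Plane, toHomeomorph x ≠ x

/-- The integer iterate `h^n`. -/
def BrouwerHomeo.iter (h : BrouwerHomeo) (n : ℤ) : Plane → Plane :=
  ⇑(h.toHomeomorph.toEquiv ^ n)

/-- A set is free if it is disjoint from its image under `h`. -/
def IsFree (h : BrouwerHomeo) (E : Set Plane) : Prop :=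
  Disjoint (h.toHomeomorph '' E) E

/-- A closed topological disk: a subset of the plane homeomorphic to the closed unit disk. -/
def IsClosedDisk (D : Set Plane) : Prop :=
  Nonempty (D ≃ₜ (Metric.closedBall (0 : Plane) 1 : Set Plane))
/-- A translation domain for `h`: an open, connected, simply connected, invariant subset
of the plane on which `h` is conjugate to the translation `(x, y) ↦ (x + 1, y)`. -/
def IsTranslationDomain (h : BrouwerHomeo) (O : Set Plane) : Prop :=
  IsOpen O ∧ IsConnected O ∧ SimplyConnectedSpace O ∧
  h.toHomeomorph '' O = O ∧
  ∃ Φ : O ≃ₜ Plane, ∀ (x : Plane) (hx : x ∈ O) (hx' : h.toHomeomorph x ∈ O),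
    Φ ⟨h.toHomeomorph x, hx'⟩ = ((Φ ⟨x, hx⟩).1 + 1, (Φ ⟨x, hx⟩).2)

/-- `x` and `y` are contained in the connected union of `k` translation domains. -/
def ConnectsBy (h : BrouwerHomeo) (x y : Plane) (k : ℕ) : Prop :=
  ∃ O : Fin k → Set Plane, (∀ i, IsTranslationDomain h (O i)) ∧
    IsConnected (⋃ i, O i) ∧ x ∈ ⋃ i, O i ∧ y ∈ ⋃ i, O i

open Classical in
/-- The translation distance of `h`: the minimal number of translation domains whose
union is connected and contains both points. -/
noncomputable def transDist (h : BrouwerHomeo) (x y : Plane) : ℕ :=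
  if x = y then 0 else sInf {k : ℕ | ConnectsBy h x y k}

/-- `x` and `y` lie in the same orbit of `h`. -/
def SameOrbit (h : BrouwerHomeo) (x y : Plane) : Prop :=
  ∃ n : ℤ, h.iter n x = y

/-- `(x, y)` is a singular pair: `x`, `y` are not in the same orbit, and arbitrarily large
positive iterates of every neighborhood of `x` meet every neighborhood of `y`. -/
def SingularPair (h : BrouwerHomeo) (x y : Plane) : Prop :=
  ¬ SameOrbit h x y ∧
  ∀ Vx ∈ nhds x, ∀ Vy ∈ nhds y, ∀ N : ℕ,
    ∃ n : ℕ, N ≤ n ∧ (h.iter n '' Vx ∩ Vy).Nonempty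

/-- The `h`-ball of radius one around `x`: the union of all translation domains
containing `x`. -/
def ballOne (h : BrouwerHomeo) (x : Plane) : Set Plane :=
  ⋃₀ {O : Set Plane | IsTranslationDomain h O ∧ x ∈ O}

/-- Homotopy lifting for the exponential map. -/
theorem exists_log_homotopy {X : Type*} [TopologicalSpace X] (F : unitInterval × X → ℂ)
    (hF : Continuous F) (hne : ∀ p, F p ≠ 0) (g : X → ℂ) (hg : Continuous g)
    (h0 : ∀ x, Complex.exp (g x) = F (0, x)) :
    ∃ G : unitInterval × X → ℂ, Continuous G ∧ (∀ p, Complex.exp (G p) = F p) ∧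
      ∀ x, G (0, x) = g x := by
  let H : C(unitInterval × X, {z : ℂ // z ≠ 0}) := ⟨fun p => ⟨F p, hne p⟩, by fun_prop⟩
  have hstart : ∀ a : X, H (0, a) = ⟨Complex.exp ((⟨g, hg⟩ : C(X, ℂ)) a), Complex.exp_ne_zero _⟩ := by
    intro a
    apply Subtype.ext
    simp [H, h0]
  refine ⟨Complex.isCoveringMap_exp.liftHomotopy H ⟨g, hg⟩ hstart, by fun_prop, ?_, ?_⟩
  · intro p
    have := congrFun (Complex.isCoveringMap_exp.liftHomotopy_lifts H ⟨g, hg⟩ hstart) p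
    exact congrArg Subtype.val this
  · intro x
    exact Complex.isCoveringMap_exp.liftHomotopy_zero H ⟨g, hg⟩ hstart x

/-- If the initial stage of a homotopy of nonvanishing functions has a logarithm, so does the
final stage. -/
theorem exists_log_of_homotopy {X : Type*} [TopologicalSpace X] (F : unitInterval × X → ℂ)
    (hF : Continuous F) (hne : ∀ p, F p ≠ 0) (h0 : ∃ g : X → ℂ, Continuous g ∧
      ∀ x, Complex.exp (g x) = F (0, x)) :
    ∃ g : X → ℂ, Continuous g ∧ ∀ x, Complex.exp (g x) = F (1, x) := by
  obtain ⟨g, hg, h⟩ := h0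
  obtain ⟨G, hG, h1, -⟩ := exists_log_homotopy F hF hne g hg h
  exact ⟨fun x => G (1, x), by fun_prop, fun x => h1 _⟩

/-- A continuous nonvanishing function on a star-shaped set has a continuous logarithm. -/
theorem exists_log_of_starConvex {E : Type*} [NormedAddCommGroup E] [NormedSpace ℝ E] {S : Set E}
    {c : E} (hS : StarConvex ℝ c S) (hc : c ∈ S) {f : E → ℂ} (hf : ContinuousOn f S)
    (hne : ∀ x ∈ S, f x ≠ 0) :
    ∃ g : E → ℂ, ContinuousOn g S ∧ ∀ x ∈ S, Complex.exp (g x) = f x := by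
  have hmem : ∀ p : unitInterval × S, c + (p.1 : ℝ) • ((p.2 : E) - c) ∈ S := fun p =>
    hS.add_smul_sub_mem p.2.2 p.1.2.1 p.1.2.2
  obtain ⟨g, hg, h⟩ := exists_log_of_homotopy (X := S)
    (fun p => f (c + (p.1 : ℝ) • ((p.2 : E) - c)))
    (hf.comp_continuous (by fun_prop) hmem) (fun p => hne _ (hmem p))
    ⟨fun _ => Complex.log (f c), continuous_const, fun x => by
      simp [Complex.exp_log (hne c hc)]⟩
  classical
  refine ⟨fun x => if hx : x ∈ S then g ⟨x, hx⟩ else 0, ?_, ?_⟩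
  · rw [continuousOn_iff_continuous_domRestrict]
    convert hg using 1
    ext x
    simp
  · intro x hx
    simp [hx, h]

theorem log_const_on {X : Type*} [TopologicalSpace X] {S : Set X} (hS : IsPreconnected S)
    {g : X → ℂ} (hg : ContinuousOn g S) {c : ℂ} (h : ∀ x ∈ S, Complex.exp (g x) = c)
    {x y : X} (hx : x ∈ S) (hy : y ∈ S) : g x = g y := by
  refine Complex.isCoveringMap_exp.isSeparatedMap.constOn_of_comp
    Complex.isCoveringMap_exp.isLocalHomeomorph.isLocallyInjective hS hg ?_ hx hy
  intro a ha a' ha'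
  apply Subtype.ext
  simp [h a ha, h a' ha']

theorem log_const {X : Type*} [TopologicalSpace X] [PreconnectedSpace X]
    {g : X → ℂ} (hg : Continuous g) {c : ℂ} (h : ∀ x, Complex.exp (g x) = c)
    (x y : X) : g x = g y :=
  log_const_on isPreconnected_univ hg.continuousOn (fun x _ => h x) (mem_univ x) (mem_univ y)

theorem one_lt_rank_complex : 1 < Module.rank ℝ ℂ := by
  rw [Complex.rank_real_complex]; norm_num

theorem preconnectedSpace_sphere_complex (r : ℝ) :
    PreconnectedSpace (Metric.sphere (0 : ℂ) r) :=
  isPreconnected_iff_preconnectedSpace.1 (isPreconnected_sphere one_lt_rank_complex _ _)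

/-- An odd nonvanishing function on a circle has no continuous logarithm. -/
theorem not_exists_log_of_odd {r : ℝ} (hr : 0 ≤ r) {f : ℂ → ℂ} (hodd : ∀ z, f (-z) = - f z)
    (h : ∃ g : Metric.sphere (0 : ℂ) r → ℂ, Continuous g ∧ ∀ z, Complex.exp (g z) = f z) :
    False := by
  obtain ⟨g, hg, h⟩ := h
  have := preconnectedSpace_sphere_complex r
  have hz : (r : ℂ) ∈ Metric.sphere (0 : ℂ) r := by simp [abs_of_nonneg hr]
  have hne : ∀ z : Metric.sphere (0 : ℂ) r, f z ≠ 0 := fun z => by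
    rw [← h]; exact Complex.exp_ne_zero _
  have hD : ∀ z : Metric.sphere (0 : ℂ) r, Complex.exp (g z - g (-z)) = -1 := by
    intro z
    rw [Complex.exp_sub, h, h]
    have := hne z
    simp [hodd, this]
  have hc := log_const (g := fun z : Metric.sphere (0 : ℂ) r => g z - g (-z)) (by fun_prop) hD
    ⟨r, hz⟩ (-⟨r, hz⟩)
  have h1 := hD ⟨r, hz⟩
  simp only [neg_neg] at hc
  have h2 : g ⟨r, hz⟩ - g (-⟨r, hz⟩) = 0 := by linear_combination hc / 2
  rw [h2, Complex.exp_zero] at h1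
  norm_num at h1

theorem image_closedBall_mem_nhds {f : ℂ → ℂ} {c : ℂ} {r : ℝ} (hr : 0 < r)
    (hf : ContinuousOn f (Metric.closedBall c r)) (hi : InjOn f (Metric.closedBall c r)) :
    f '' Metric.closedBall c r ∈ 𝓝 (f c) := by
  by_contra hcon
  have hK : IsCompact (f '' Metric.sphere c r) :=
    (isCompact_sphere c r).image_of_continuousOn (hf.mono Metric.sphere_subset_closedBall)
  have hfc : f c ∉ f '' Metric.sphere c r := by
    rintro ⟨z, hz, hzc⟩
    have := hi (Metric.sphere_subset_closedBall hz) (Metric.mem_closedBall_self hr.le) hzc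
    rw [this] at hz
    simp at hz
    exact hr.ne hz
  obtain ⟨δ, hδ, hball⟩ := Metric.isOpen_iff.1 hK.isClosed.isOpen_compl _ hfc
  obtain ⟨w, hw, hwn⟩ : ∃ w ∈ Metric.ball (f c) δ, w ∉ f '' Metric.closedBall c r := by
    by_contra hh
    push Not at hh
    exact hcon (mem_of_superset (Metric.ball_mem_nhds _ hδ) hh)
  obtain ⟨ℓ, hℓ, hℓ'⟩ := exists_log_of_starConvex
    ((convex_closedBall c r).starConvex (Metric.mem_closedBall_self hr.le))
    (Metric.mem_closedBall_self hr.le) (f := fun z => f z - w) (by fun_prop)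
    (fun x hx h => hwn ⟨x, hx, by linear_combination h⟩)
  have hmem : ∀ z : Metric.sphere (0 : ℂ) r, c + z ∈ Metric.sphere c r := fun z => by
    simp
  have hmem' : ∀ z : Metric.sphere (0 : ℂ) r, c + z ∈ Metric.closedBall c r := fun z =>
    Metric.sphere_subset_closedBall (hmem z)
  have step1 := exists_log_of_homotopy (X := Metric.sphere (0 : ℂ) r)
    (fun p => f (c + p.2) - (w + (p.1 : ℝ) * (f c - w)))
    (by
      apply Continuous.sub
      · exact hf.comp_continuous (by fun_prop) fun p => hmem' p.2
      · fun_prop)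
    (fun p h => by
      have h1 : f (c + p.2) ∈ Metric.ball (f c) δ := by
        rw [sub_eq_zero.1 h]
        have := (convex_ball (f c) δ).add_smul_sub_mem hw (Metric.mem_ball_self hδ) p.1.2
        simpa using this
      exact hball h1 ⟨_, hmem p.2, rfl⟩)
    ⟨fun z => ℓ (c + z), hℓ.comp_continuous (by fun_prop) hmem', fun z => by
      simp [hℓ' _ (hmem' z)]⟩
  have hn1 : ∀ p : unitInterval × Metric.sphere (0 : ℂ) r,
      c + p.2 / (1 + (p.1 : ℝ)) ∈ Metric.closedBall c r := by
    intro p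
    have h1 := p.2.2
    have h2 := p.1.2.1
    have : ‖(1 : ℂ) + (p.1 : ℝ)‖ = 1 + p.1 := by
      rw [← Complex.ofReal_one, ← Complex.ofReal_add, Complex.norm_real, Real.norm_of_nonneg]
      positivity
    simp only [mem_sphere_iff_norm, sub_zero] at h1
    simp only [Metric.mem_closedBall, dist_self_add_left, norm_div, this, h1]
    apply div_le_self hr.le
    linarith
  have hn2 : ∀ p : unitInterval × Metric.sphere (0 : ℂ) r,
      c - (p.1 : ℝ) * p.2 / (1 + (p.1 : ℝ)) ∈ Metric.closedBall c r := by
    intro p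
    have h1 := p.2.2
    have h2 := p.1.2.1
    have h3 := p.1.2.2
    have : ‖(1 : ℂ) + (p.1 : ℝ)‖ = 1 + p.1 := by
      rw [← Complex.ofReal_one, ← Complex.ofReal_add, Complex.norm_real, Real.norm_of_nonneg]
      positivity
    simp only [mem_sphere_iff_norm, sub_zero] at h1
    simp only [Metric.mem_closedBall, dist_self_sub_left, norm_div, this, h1, norm_mul,
      Complex.norm_real, Real.norm_of_nonneg h2]
    rw [div_le_iff₀ (by positivity)]
    nlinarith
  have hden : ∀ t : unitInterval, (1 : ℂ) + (t : ℝ) ≠ 0 := by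
    intro t
    rw [← Complex.ofReal_one, ← Complex.ofReal_add, Complex.ofReal_ne_zero]
    have := t.2.1
    positivity
  have step2 := exists_log_of_homotopy (X := Metric.sphere (0 : ℂ) r)
    (fun p => f (c + p.2 / (1 + (p.1 : ℝ))) - f (c - (p.1 : ℝ) * p.2 / (1 + (p.1 : ℝ))))
    (by
      apply Continuous.sub
      · refine hf.comp_continuous ?_ hn1
        refine continuous_const.add (Continuous.div ?_ ?_ fun p => hden p.1) <;> fun_prop
      · refine hf.comp_continuous ?_ hn2
        refine continuous_const.sub (Continuous.div ?_ ?_ fun p => hden p.1) <;> fun_prop)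
    (fun p h => by
      have h1 := hi (hn1 p) (hn2 p) (sub_eq_zero.1 h)
      have h2 : (p.2 : ℂ) * (1 + (p.1 : ℝ)) = 0 := by
        have := hden p.1
        field_simp at h1
        linear_combination h1
      have h3 : (p.2 : ℂ) = 0 := (mul_eq_zero.1 h2).resolve_right (hden p.1)
      have h4 := p.2.2
      rw [h3] at h4
      simp at h4
      exact hr.ne h4)
    (by
      obtain ⟨g, hg, h⟩ := step1
      exact ⟨g, hg, fun x => by simp [h]⟩)
  refine not_exists_log_of_odd hr.le
    (f := fun z => f (c + z / 2) - f (c - z / 2)) (fun z => ?_) ?_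
  · simp [neg_div, sub_eq_add_neg]
  · obtain ⟨g, hg, h⟩ := step2
    refine ⟨g, hg, fun z => ?_⟩
    rw [h]
    norm_num

/-- Invariance of domain in the plane. -/
theorem isOpen_image_of_injOn {f : ℂ → ℂ} {U : Set ℂ} (hU : IsOpen U) (hf : ContinuousOn f U)
    (hi : InjOn f U) : IsOpen (f '' U) := by
  rw [isOpen_iff_mem_nhds]
  rintro _ ⟨c, hc, rfl⟩
  obtain ⟨r, hr, hs⟩ := Metric.nhds_basis_closedBall.mem_iff.1 (hU.mem_nhds hc)
  exact mem_of_superset (image_closedBall_mem_nhds hr (hf.mono hs) (hi.mono hs)) (image_mono hs)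

/-- Continuous logarithms of the difference quotient and of the displacement of a plane
homeomorphism, compatible with each other. -/
structure SlopeLog (h : ℂ → ℂ) where
  τ : ℂ × ℂ → ℂ
  θ : ℂ → ℂ
  contτ : ContinuousOn τ {p | p.1 ≠ p.2}
  contθ : Continuous θ
  expτ : ∀ z w, z ≠ w → Complex.exp (τ (z, w)) = (h z - h w) / (z - w)
  expθ : ∀ z, Complex.exp (θ z) = h z - z
  symm : ∀ z w, z ≠ w → τ (z, w) = τ (w, z)
  rel : ∀ z, θ (h z) = θ z + τ (z, h z)

theorem isPreconnected_offDiag : IsPreconnected {p : ℂ × ℂ | p.1 ≠ p.2} := by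
  have : {p : ℂ × ℂ | p.1 ≠ p.2} = (fun q : ℂ × ℂ => (q.1, q.1 + q.2)) '' (univ ×ˢ {0}ᶜ) := by
    ext ⟨z, w⟩
    simp only [mem_ofPred_eq, mem_image, mem_prod, mem_univ, true_and, mem_compl_iff,
      mem_singleton_iff, Prod.mk.injEq, Prod.exists]
    constructor
    · intro h
      exact ⟨z, w - z, sub_ne_zero.2 (Ne.symm h), rfl, by ring⟩
    · rintro ⟨a, b, hb, rfl, rfl⟩
      simpa using hb
  rw [this]
  refine (isPreconnected_univ.prod ?_).image _ (by fun_prop)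
  exact (isConnected_compl_singleton_of_one_lt_rank one_lt_rank_complex 0).isPreconnected

theorem nonempty_slopeLog {H : ℝ → ℂ ≃ₜ ℂ} (hH : Continuous fun p : ℝ × ℂ => H p.1 p.2)
    (h0 : H 0 = Homeomorph.refl ℂ) (hfp : ∀ z, H 1 z ≠ z) : Nonempty (SlopeLog (H 1)) := by
  obtain ⟨g, hg, hge⟩ := exists_log_of_homotopy (X := {p : ℂ × ℂ // p.1 ≠ p.2})
    (fun q => (H q.1 q.2.1.1 - H q.1 q.2.1.2) / (q.2.1.1 - q.2.1.2))
    (by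
      refine Continuous.div ?_ (by fun_prop) fun q => sub_ne_zero.2 q.2.2
      refine Continuous.sub ?_ ?_
      · exact hH.comp (f := fun q : unitInterval × {p : ℂ × ℂ // p.1 ≠ p.2} =>
          ((q.1 : ℝ), q.2.1.1)) (by fun_prop)
      · exact hH.comp (f := fun q : unitInterval × {p : ℂ × ℂ // p.1 ≠ p.2} =>
          ((q.1 : ℝ), q.2.1.2)) (by fun_prop))
    (fun q => div_ne_zero (sub_ne_zero.2 fun hh => q.2.2 ((H q.1).injective hh))
      (sub_ne_zero.2 q.2.2))
    ⟨fun _ => 0, continuous_const, fun x => by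
      have := sub_ne_zero.2 x.2
      simp [h0, this]⟩
  replace hge : ∀ x, Complex.exp (g x) = (H 1 x.1.1 - H 1 x.1.2) / (x.1.1 - x.1.2) := by
    simpa using hge
  have hsymm : ∀ z w : ℂ, ∀ (h1 : z ≠ w), g ⟨(z, w), h1⟩ = g ⟨(w, z), h1.symm⟩ := by
    intro z w h1
    have : PreconnectedSpace {p : ℂ × ℂ // p.1 ≠ p.2} :=
      isPreconnected_iff_preconnectedSpace.1 isPreconnected_offDiag
    have := log_const (g := fun q : {p : ℂ × ℂ // p.1 ≠ p.2} =>
      g q - g ⟨(q.1.2, q.1.1), q.2.symm⟩) (by fun_prop) (c := 1) (fun q => by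
        rw [Complex.exp_sub, hge, hge]
        have h2 := sub_ne_zero.2 q.2
        have h3 := sub_ne_zero.2 q.2.symm
        have h4 := sub_ne_zero.2 fun hh => q.2 ((H 1).injective hh)
        have h5 := sub_ne_zero.2 fun hh => q.2.symm ((H 1).injective hh)
        rw [← neg_sub (H 1 q.1.2), ← neg_sub q.1.2, neg_div_neg_eq, div_self]
        exact div_ne_zero h5 h3) ⟨(z, w), h1⟩ ⟨(w, z), h1.symm⟩
    simp only at this
    linear_combination this / 2
  obtain ⟨θ, hθ, hθe⟩ := exists_log_of_starConvex (starConvex_univ (0 : ℂ)) (mem_univ _)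
    (f := fun z => H 1 z - z) (by fun_prop) (fun z _ => sub_ne_zero.2 (hfp z))
  rw [continuousOn_univ] at hθ
  simp only [mem_univ, forall_const] at hθe
  have hc := fun z => log_const (g := fun z => θ (H 1 z) - θ z - g ⟨(z, H 1 z), (hfp z).symm⟩)
    (by fun_prop) (c := 1) (fun z => by
      rw [Complex.exp_sub, Complex.exp_sub, hge, hθe, hθe]
      have h1 := sub_ne_zero.2 (hfp z)
      have h2 := sub_ne_zero.2 (hfp z).symm
      have h3 := sub_ne_zero.2 (hfp (H 1 z)).symm
      rw [← neg_sub (H 1 (H 1 z)) (H 1 z), ← neg_sub (H 1 z) z, neg_div_neg_eq, div_self]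
      exact div_ne_zero (sub_ne_zero.2 (hfp _)) h1) z 0
  set c := θ (H 1 0) - θ 0 - g ⟨(0, H 1 0), (hfp 0).symm⟩ with hcdef
  have hce : Complex.exp c = 1 := by
    rw [hcdef, Complex.exp_sub, Complex.exp_sub, hge, hθe, hθe]
    have h1 := sub_ne_zero.2 (hfp 0)
    rw [← neg_sub (H 1 (H 1 0)) (H 1 0), ← neg_sub (H 1 0) 0, neg_div_neg_eq, div_self]
    exact div_ne_zero (sub_ne_zero.2 (hfp _)) h1
  classical
  refine ⟨⟨fun p => if hp : p.1 ≠ p.2 then g ⟨p, hp⟩ + c else 0, θ, ?_, hθ, ?_, hθe, ?_, ?_⟩⟩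
  · rw [continuousOn_iff_continuous_domRestrict]
    have : Continuous fun q => g q + c := by fun_prop
    refine this.congr ?_
    rintro ⟨x, hx⟩
    have hx' : x.1 ≠ x.2 := hx
    simp [Set.domRestrict, hx']
  · intro z w hzw
    simp only [ne_eq, hzw, not_false_eq_true, dite_true, Complex.exp_add, hce, hge, mul_one]
  · intro z w hzw
    simp only [ne_eq, hzw, not_false_eq_true, dite_true, hzw.symm, hsymm z w hzw]
  · intro z
    have h1 := (hfp z).symm
    simp only [ne_eq, h1, not_false_eq_true, dite_true]
    have := hc z
    linear_combination this

theorem equivariant_nat {h : ℂ → ℂ} {Γ : ℝ → ℂ} (hΓ : ∀ u, Γ (u + 1) = h (Γ u)) (n : ℕ) (u : ℝ) :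
    Γ (u + n) = h^[n] (Γ u) := by
  induction n with
  | zero => simp
  | succ n ih => rw [Function.iterate_succ_apply', ← ih, ← hΓ]; push_cast; ring_nf

theorem equivariant_int {h : ℂ → ℂ} {Γ : ℝ → ℂ} (hi : Function.Injective h)
    (hΓ : ∀ u, Γ (u + 1) = h (Γ u)) (n : ℤ) {u v : ℝ} :
    Γ (u + n) = Γ (v + n) ↔ Γ u = Γ v := by
  obtain ⟨k, rfl | rfl⟩ := n.eq_nat_or_neg
  · simp only [Int.cast_natCast, equivariant_nat hΓ]
    exact (hi.iterate k).eq_iff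
  · rw [← (hi.iterate k).eq_iff, ← equivariant_nat hΓ, ← equivariant_nat hΓ]
    simp

theorem window_injective {h : ℂ → ℂ} {Γ : ℝ → ℂ} (hi : Function.Injective h)
    (hΓ : ∀ u, Γ (u + 1) = h (Γ u)) (hw : InjOn Γ (Ico 0 2)) {u v : ℝ} (huv : u < v)
    (h1 : v ≤ u + 1) : Γ u ≠ Γ v := by
  intro he
  have : Γ (u - ⌊u⌋) = Γ (v - ⌊u⌋) := by
    rw [← equivariant_int hi hΓ ⌊u⌋]
    simpa using he
  have h2 := Int.floor_le u
  have h3 := Int.lt_floor_add_one u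
  have := hw ⟨by linarith, by linarith⟩ ⟨by linarith, by linarith⟩ this
  linarith

/-- Brouwer's lemma for equivariant curves. -/
theorem SlopeLog.injective_of_window {h : ℂ → ℂ} (S : SlopeLog h) (hi : Function.Injective h)
    {Γ : ℝ → ℂ} (hΓc : Continuous Γ) (hΓ : ∀ u, Γ (u + 1) = h (Γ u)) (hw : InjOn Γ (Ico 0 2)) :
    Function.Injective Γ := by
  by_contra hcon
  have hwin : ∀ u v, u < v → v ≤ u + 1 → Γ u ≠ Γ v := fun u v => window_injective hi hΓ hw
  obtain ⟨s₁, t₁, hst₁, he₁⟩ : ∃ s t, s < t ∧ Γ s = Γ t := by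
    simp only [Function.Injective] at hcon
    push Not at hcon
    obtain ⟨a, b, hab, hne⟩ := hcon
    rcases lt_or_gt_of_ne hne with h1 | h1
    · exact ⟨a, b, h1, hab⟩
    · exact ⟨b, a, h1, hab.symm⟩
  let K : Set (ℝ × ℝ) := {p | 0 ≤ p.1 ∧ p.1 + 1 ≤ p.2 ∧ Γ p.1 = Γ p.2}
  have hKc : IsClosed K := by
    have e : K = {p | 0 ≤ p.1} ∩ ({p | p.1 + 1 ≤ p.2} ∩ {p | Γ p.1 = Γ p.2}) := by
      ext p; simp [K]
    rw [e]
    exact (isClosed_le (by fun_prop) (by fun_prop)).inter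
      ((isClosed_le (by fun_prop) (by fun_prop)).inter (isClosed_eq (by fun_prop) (by fun_prop)))
  have hmemK : ∀ s t, 0 ≤ s → s < t → Γ s = Γ t → (s, t) ∈ K := by
    intro s t hs hst he
    refine ⟨hs, ?_, he⟩
    by_contra hh
    exact hwin s t hst (by simp at hh; linarith) he
  obtain ⟨s₂, t₂, hK2⟩ : ∃ s t, (s, t) ∈ K := by
    refine ⟨s₁ - ⌊s₁⌋, t₁ - ⌊s₁⌋, hmemK _ _ (by linarith [Int.floor_le s₁]) (by linarith) ?_⟩
    rw [← equivariant_int hi hΓ ⌊s₁⌋]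
    simpa using he₁
  obtain ⟨⟨s, t⟩, hst, hmin⟩ : ∃ p ∈ K, ∀ q ∈ K, p.2 ≤ q.2 := by
    have hcomp : IsCompact (K ∩ (Icc 0 t₂ ×ˢ Icc 0 t₂)) :=
      (isCompact_Icc.prod isCompact_Icc).inter_left hKc
    obtain ⟨p, hp, hpm⟩ := hcomp.exists_isMinOn (f := Prod.snd)
      ⟨(s₂, t₂), hK2, by
        obtain ⟨a, b, -⟩ := hK2
        simp only [mem_prod, mem_Icc] at *
        refine ⟨⟨a, ?_⟩, ?_, ?_⟩ <;> linarith⟩ continuous_snd.continuousOn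
    refine ⟨p, hp.1, fun q hq => ?_⟩
    by_cases hqt : q.2 ≤ t₂
    · obtain ⟨a, b, c⟩ := id hq
      refine hpm ⟨hq, ?_⟩
      simp only [mem_prod, mem_Icc] at *
      refine ⟨⟨a, ?_⟩, ?_, ?_⟩ <;> linarith
    · have := hp.2.2.2
      linarith
  obtain ⟨hs0, hs1, hse⟩ := id hst
  change ∀ q ∈ K, t ≤ q.2 at hmin
  change 0 ≤ s at hs0
  change s + 1 ≤ t at hs1
  change Γ s = Γ t at hse
  have hs1' : s + 1 < t := by
    refine lt_of_le_of_ne hs1 fun hh => ?_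
    exact hwin s t (by linarith) hh.ge hse
  have ht2 : 2 ≤ t := by
    by_contra hh
    have := hw ⟨hs0, by linarith⟩ ⟨by linarith, by linarith⟩ hse
    linarith
  have hslt : s < 1 := by
    by_contra hh
    have := hmin _ (hmemK (s - 1) (t - 1) (by linarith) (by linarith) (by
      have := equivariant_int hi hΓ 1 (u := s - 1) (v := t - 1)
      simp at this
      exact this.1 hse))
    simp at this
    linarith
  have hinj : ∀ u v, 0 ≤ u → u < v → v ≤ t → (u, v) ≠ (s, t) → Γ u ≠ Γ v := by
    intro u v hu huv hvt hne he
    have h1 := hmin _ (hmemK u v hu huv he)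
    simp only at h1
    obtain rfl : v = t := le_antisymm hvt h1
    have hus : u ≠ s := fun h => hne (by rw [h])
    have he' := he.trans hse.symm
    rcases lt_or_gt_of_ne hus with h2 | h2
    · have := hmin _ (hmemK u s hu h2 he')
      simp at this; linarith
    · have := hmin _ (hmemK s u hs0 h2 he'.symm)
      simp at this; linarith
  let W : Set (ℝ × ℝ) := {p | 0 ≤ p.1 ∧ p.1 < p.2 ∧ p.2 ≤ t ∧ p ≠ (s, t)}
  have hW0 : ((0 : ℝ), (1 : ℝ)) ∈ W := by
    refine ⟨le_rfl, by norm_num, by simp; linarith, fun h => ?_⟩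
    simp at h; linarith
  have hWs : StarConvex ℝ ((0 : ℝ), (1 : ℝ)) W := by
    rw [starConvex_iff_segment_subset]
    rintro ⟨u, v⟩ ⟨h1, h2, h3, h4⟩
    rintro _ ⟨a, b, ha, hb, hab, rfl⟩
    simp only [W, mem_ofPred_eq, Prod.smul_mk, Prod.mk_add_mk, smul_eq_mul] at *
    obtain rfl : a = 1 - b := by linarith
    refine ⟨by positivity, ?_, ?_, fun hh => ?_⟩
    · rcases hb.eq_or_lt with rfl | hb'
      · simp
      · nlinarith
    · nlinarith
    · simp only [Prod.mk.injEq] at hh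
      obtain ⟨e1, e2⟩ := hh
      have hb1 : b = 1 := by
        by_contra hb1
        have : b < 1 := lt_of_le_of_ne (by linarith) hb1
        nlinarith
      subst hb1
      exact h4 (by simp at e1 e2; rw [e1, e2])
  have hΓne : ∀ p ∈ W, Γ p.2 - Γ p.1 ≠ 0 := fun p hp =>
    sub_ne_zero.2 (hinj p.1 p.2 hp.1 hp.2.1 hp.2.2.1 hp.2.2.2).symm
  obtain ⟨a, ha, hae⟩ := exists_log_of_starConvex hWs hW0 (f := fun p => Γ p.2 - Γ p.1)
    (by fun_prop) hΓne
  have hmem1 : ∀ u ∈ Icc 0 (t - 1), (u, u + 1) ∈ W := by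
    rintro u ⟨h1, h2⟩
    refine ⟨h1, by simp, by simp; linarith, fun h => ?_⟩
    simp at h; linarith
  have hk := fun u (hu : u ∈ Icc 0 (t - 1)) => log_const_on (S := Icc 0 (t - 1))
    isPreconnected_Icc (g := fun u => a (u, u + 1) - S.θ (Γ u)) (c := 1)
    (by
      have := S.contθ
      exact (ha.comp (by fun_prop) fun u hu => hmem1 u hu).sub (by fun_prop))
    (fun u hu => by
      rw [Complex.exp_sub, hae _ (hmem1 u hu), S.expθ]
      simp only [hΓ]
      apply div_self
      rw [← hΓ]
      exact hΓne _ (hmem1 u hu)) hu (y := 0) ⟨le_rfl, by linarith⟩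
  let T : Set (ℝ × ℝ) := {p | 0 ≤ p.1 ∧ p.1 < p.2 ∧ p.2 ≤ t - 1}
  have hTW : ∀ p ∈ T, p ∈ W := by
    rintro p ⟨h1, h2, h3⟩
    refine ⟨h1, h2, by linarith, fun h => ?_⟩
    rw [h] at h3; simp at h3; linarith
  have hTW' : ∀ p ∈ T, (p.1 + 1, p.2 + 1) ∈ W := by
    rintro p ⟨h1, h2, h3⟩
    refine ⟨by simp; linarith, by simpa, by simp; linarith, fun h => ?_⟩
    simp at h; linarith
  have hTc : Convex ℝ T := by
    have e : T = {p | 0 ≤ p.1} ∩ ({p | p.1 - p.2 < 0} ∩ {p | p.2 ≤ t - 1}) := by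
      ext p; simp [T]
    rw [e]
    refine (convex_halfSpace_ge (𝕜 := ℝ) ⟨?_, ?_⟩ _).inter
      ((convex_halfSpace_lt (𝕜 := ℝ) ⟨?_, ?_⟩ _).inter (convex_halfSpace_le (𝕜 := ℝ) ⟨?_, ?_⟩ _))
    all_goals intros; simp; try ring
  have hT0 : ((0 : ℝ), (1 : ℝ)) ∈ T := ⟨le_rfl, by norm_num, by simp; linarith⟩
  have hTne : ∀ p ∈ T, Γ p.1 ≠ Γ p.2 := fun p hp => (sub_ne_zero.1 (hΓne _ (hTW p hp))).symm
  have hR := fun p (hp : p ∈ T) => log_const_on hTc.isPreconnected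
    (g := fun p => a (p.1 + 1, p.2 + 1) - a p - S.τ (Γ p.1, Γ p.2)) (c := 1)
    (by
      refine ((ha.comp (by fun_prop) fun p hp => hTW' p hp).sub (ha.mono hTW)).sub ?_
      exact S.contτ.comp (by fun_prop) fun p hp => hTne p hp)
    (fun p hp => by
      have h1 := hΓne _ (hTW p hp)
      have h2 := hΓne _ (hTW' p hp)
      simp only [hΓ] at h2
      rw [Complex.exp_sub, Complex.exp_sub, hae _ (hTW p hp), hae _ (hTW' p hp),
        S.expτ _ _ (hTne p hp)]
      simp only [hΓ]
      rw [← neg_sub (h _) (h (Γ p.1)), ← neg_sub (Γ p.2) (Γ p.1), neg_div_neg_eq]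
      exact div_self (div_ne_zero h2 h1)) hp hT0
  have hΓ1 : Γ 1 = h (Γ 0) := by simpa using hΓ 0
  have hR0 : a (0 + 1, 1 + 1) - a (0, 1) - S.τ (Γ 0, Γ 1) = 0 := by
    have h1 := hk 1 ⟨by norm_num, by linarith⟩
    rw [hΓ1, S.rel] at h1
    simp only [zero_add] at h1 ⊢
    rw [hΓ1]
    linear_combination h1
  simp only [hR0] at hR
  have hRs := hR (s, t - 1) ⟨hs0, by simp; linarith, le_rfl⟩
  simp only [sub_add_cancel] at hRs
  have hk1 := hk (t - 1) ⟨by linarith, le_rfl⟩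
  have hk2 := hk s ⟨hs0, by linarith⟩
  have hΓt : Γ s = h (Γ (t - 1)) := by rw [hse, ← hΓ]; simp
  have hne : Γ s ≠ Γ (t - 1) := hTne (s, t - 1) ⟨hs0, by simp; linarith, le_rfl⟩
  have hsy := S.symm _ _ hne
  have hrel := S.rel (Γ (t - 1))
  rw [← hΓt] at hrel
  simp only [sub_add_cancel] at hk1
  have hDe : ∀ c ∈ Ioo s t, Complex.exp (a (c, t) - a (s, c)) = -1 := by
    rintro c ⟨h1, h2⟩
    have m1 : (c, t) ∈ W := ⟨by simp; linarith, h2, le_rfl, fun h => by simp at h; linarith⟩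
    have m2 : (s, c) ∈ W := ⟨hs0, h1, by simp; linarith, fun h => by simp at h; linarith⟩
    have n1 := hΓne _ m1
    have n2 := hΓne _ m2
    rw [Complex.exp_sub, hae _ m1, hae _ m2]
    simp only at n2 ⊢
    rw [← hse, ← neg_sub, neg_div, div_self n2]
  have hDc := log_const_on (S := Ioo s t) isPreconnected_Ioo (g := fun c => a (c, t) - a (s, c))
    (by
      refine (ha.comp (by fun_prop) ?_).sub (ha.comp (by fun_prop) ?_)
      · rintro c ⟨h1, h2⟩
        exact ⟨by simp; linarith, h2, le_rfl, fun h => by simp at h; linarith⟩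
      · rintro c ⟨h1, h2⟩
        exact ⟨hs0, h1, by simp; linarith, fun h => by simp at h; linarith⟩) hDe
    (x := t - 1) (y := s + 1) ⟨by linarith, by linarith⟩ ⟨by linarith, by linarith⟩
  have hD1 := hDe (t - 1) ⟨by linarith, by linarith⟩
  have : a (t - 1, t) - a (s, t - 1) = 0 := by
    linear_combination (hDc + hRs + hk1 - hk2 - hrel + hsy) / 2
  rw [this, Complex.exp_zero] at hD1
  norm_num at hD1

section

open Metric

theorem exists_ultralimit {U : Set ℂ} {f : ℕ → ℂ → ℂ}
    (hb : ∀ n, MapsTo (f n) U (ball 0 1)) :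
    ∃ F : ℂ → ℂ, ∀ z ∈ U, Tendsto (fun n => f n z) (hyperfilter ℕ) (𝓝 (F z)) := by
  have : ∀ z, ∃ w, z ∈ U → Tendsto (fun n => f n z) (hyperfilter ℕ) (𝓝 w) := by
    intro z
    by_cases hz : z ∈ U
    · obtain ⟨w, -, hw⟩ := (isCompact_closedBall (0 : ℂ) 1).ultrafilter_le_nhds
        ((hyperfilter ℕ).map fun n => f n z) (by
          rw [le_principal_iff]
          change ∀ᶠ n in (hyperfilter ℕ : Filter ℕ), f n z ∈ closedBall 0 1
          exact Eventually.of_forall fun n => ball_subset_closedBall (hb n hz))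
      exact ⟨w, fun _ => hw⟩
    · exact ⟨0, fun h => absurd h hz⟩
  choose F hF using this
  exact ⟨F, hF⟩

/-- Montel's theorem: a sequence of holomorphic maps into the disc converges locally uniformly
along an ultrafilter. -/
theorem exists_tendstoLocallyUniformlyOn {U : Set ℂ} (hU : IsOpen U) {f : ℕ → ℂ → ℂ}
    (hd : ∀ n, DifferentiableOn ℂ (f n) U) (hb : ∀ n, MapsTo (f n) U (ball 0 1)) :
    ∃ F : ℂ → ℂ, TendstoLocallyUniformlyOn f F (hyperfilter ℕ : Filter ℕ) U := by
  obtain ⟨F, hF⟩ := exists_ultralimit hb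
  refine ⟨F, ?_⟩
  rw [Metric.tendstoLocallyUniformlyOn_iff]
  intro ε hε z hz
  obtain ⟨r, hr, hrU⟩ := Metric.isOpen_iff.1 hU z hz
  have hL : ∀ n, ∀ u ∈ ball z r, dist (f n u) (f n z) ≤ 2 / r * dist u z := by
    intro n u hu
    refine Complex.dist_le_div_mul_dist_of_mapsTo_ball ((hd n).mono hrU) ?_ hu
    intro v hv
    have h1 := hb n (hrU hv)
    have h2 := hb n hz
    rw [mem_ball] at h1 h2
    rw [mem_closedBall]
    calc dist (f n v) (f n z) ≤ dist (f n v) 0 + dist (f n z) 0 := dist_triangle_right _ _ _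
      _ ≤ 2 := by linarith
  have hLF : ∀ u ∈ ball z r, dist (F u) (F z) ≤ 2 / r * dist u z := fun u hu =>
    le_of_tendsto ((hF u (hrU hu)).dist (hF z hz)) (Eventually.of_forall fun n => hL n u hu)
  set δ := min r (ε * r / 8) with hδ
  have hδ0 : 0 < δ := by positivity
  refine ⟨ball z δ, mem_nhdsWithin_of_mem_nhds (ball_mem_nhds _ hδ0), ?_⟩
  have hev := Metric.tendsto_nhds.1 (hF z hz) (ε / 3) (by positivity)
  filter_upwards [hev] with n hn u hu
  have hn' : dist (f n z) (F z) < ε / 3 := hn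
  have hur : u ∈ ball z r := ball_subset_ball (min_le_left _ _) hu
  have hsm : 2 / r * dist u z ≤ ε / 4 := by
    have : dist u z ≤ ε * r / 8 := (mem_ball.1 hu).le.trans (min_le_right _ _)
    calc 2 / r * dist u z ≤ 2 / r * (ε * r / 8) := by gcongr
      _ = ε / 4 := by field_simp; ring
  have h1 := hL n u hur
  have h2 := hLF u hur
  calc dist (F u) (f n u) ≤ dist (F u) (F z) + dist (F z) (f n z) + dist (f n z) (f n u) :=
        dist_triangle4 _ _ _ _
    _ < ε := by rw [dist_comm (F z), dist_comm (f n z) (f n u)]; linarith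

/-- Hurwitz's theorem for limits of injective functions. -/
theorem injOn_of_tendstoLocallyUniformlyOn {ι : Type*} {l : Filter ι} [l.NeBot] {U : Set ℂ}
    (hU : IsOpen U) (hUc : IsPreconnected U) {f : ι → ℂ → ℂ} {F : ℂ → ℂ}
    (hd : ∀ n, DifferentiableOn ℂ (f n) U) (hi : ∀ n, InjOn (f n) U)
    (hF : TendstoLocallyUniformlyOn f F l U) (hne : ∃ p ∈ U, ∃ q ∈ U, F p ≠ F q) :
    InjOn F U := by
  have hFd : DifferentiableOn ℂ F U := hF.differentiableOn (Eventually.of_forall hd) hU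
  intro p hp q hq hpq
  by_contra hpq'
  have hev : ∀ᶠ z in 𝓝[≠] q, F z ≠ F q := by
    by_contra hcon
    rw [not_eventually] at hcon
    push Not at hcon
    have := (hFd.analyticOnNhd hU).eqOn_of_preconnected_of_frequently_eq
      (analyticOnNhd_const (v := F q)) hUc hq hcon
    obtain ⟨a, ha, b, hb, hab⟩ := hne
    exact hab ((this ha).trans (this hb).symm)
  rw [eventually_nhdsWithin_iff] at hev
  have hev2 : ∀ᶠ z in 𝓝 q, z ∈ U ∧ z ≠ p ∧ (z ∈ ({q}ᶜ : Set ℂ) → F z ≠ F q) :=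
    (hU.eventually_mem hq).and ((eventually_ne_nhds (Ne.symm hpq')).and hev)
  obtain ⟨r, hr, hrs⟩ := nhds_basis_closedBall.mem_iff.1 hev2
  have hsub : closedBall q r ⊆ U := fun z hz => (hrs hz).1
  have hcont : ContinuousOn (fun z => ‖F z - F q‖) (sphere q r) := by
    have := hFd.continuousOn.mono (sphere_subset_closedBall.trans hsub)
    fun_prop
  obtain ⟨z₀, hz₀, hmin⟩ := (isCompact_sphere q r).exists_isMinOn
    (NormedSpace.sphere_nonempty.2 hr.le) hcont
  set m := ‖F z₀ - F q‖ with hm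
  have hm0 : 0 < m := by
    rw [hm, norm_pos_iff, sub_ne_zero]
    refine (hrs (sphere_subset_closedBall hz₀)).2.2 ?_
    rintro rfl
    simp at hz₀
    exact hr.ne hz₀
  have hK : IsCompact (insert p (closedBall q r)) := (isCompact_closedBall q r).insert p
  have hKU : insert p (closedBall q r) ⊆ U := insert_subset hp hsub
  have hunif := (tendstoLocallyUniformlyOn_iff_forall_isCompact hU).1 hF _ hKU hK
  rw [Metric.tendstoUniformlyOn_iff] at hunif
  obtain ⟨n, hn⟩ := (hunif (m / 5) (by positivity)).exists
  have hnp := hn p (mem_insert _ _)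
  have hnq := hn q (mem_insert_of_mem _ (mem_closedBall_self hr.le))
  have hnz : ∀ z ∈ closedBall q r, f n z - f n p ≠ 0 := fun z hz =>
    sub_ne_zero.2 fun h => (hrs hz).2.1 (hi n (hsub hz) hp h)
  have hdiff : DiffContOnCl ℂ (fun z => (f n z - f n p)⁻¹) (ball q r) := by
    refine DifferentiableOn.diffContOnCl ?_
    rw [closure_ball _ hr.ne']
    exact (((hd n).mono hsub).sub_const _).inv hnz
  have hfr : ∀ z ∈ frontier (ball q r), ‖(f n z - f n p)⁻¹‖ ≤ (3 / 5 * m)⁻¹ := by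
    rw [frontier_ball _ hr.ne']
    intro z hz
    have h1 : m ≤ ‖F z - F q‖ := hmin hz
    have h2 := hn z (mem_insert_of_mem _ (sphere_subset_closedBall hz))
    rw [norm_inv]
    apply inv_anti₀ (by positivity)
    rw [dist_eq_norm] at h2 hnp
    have : F z - F q = (F z - f n z) + (f n z - f n p) - (F p - f n p) := by rw [hpq]; ring
    have h3 := norm_sub_le ((F z - f n z) + (f n z - f n p)) (F p - f n p)
    have h4 := norm_add_le (F z - f n z) (f n z - f n p)
    rw [← this] at h3
    linarith
  have := Complex.norm_le_of_forall_mem_frontier_norm_le isBounded_ball hdiff hfr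
    (subset_closure (mem_ball_self hr))
  rw [norm_inv, inv_le_inv₀ (norm_pos_iff.2 (hnz q (mem_closedBall_self hr.le))) (by positivity)]
    at this
  rw [dist_eq_norm] at hnp hnq
  have e : f n q - f n p = (F p - f n p) - (F q - f n q) := by rw [hpq]; ring
  have h3 := norm_sub_le (F p - f n p) (F q - f n q)
  rw [← e] at h3
  linarith

/-- The disc automorphism exchanging `0` and `w`, up to sign. -/
noncomputable def discAut (w z : ℂ) : ℂ := (z - w) / (1 - (starRingEnd ℂ) w * z)

theorem discAut_den_ne {w z : ℂ} (hw : ‖w‖ < 1) (hz : ‖z‖ < 1) :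
    1 - (starRingEnd ℂ) w * z ≠ 0 := by
  intro h
  have h1 : (starRingEnd ℂ) w * z = 1 := by linear_combination -h
  have h2 : ‖w‖ * ‖z‖ = 1 := by
    have := congrArg norm h1
    simpa using this
  nlinarith [norm_nonneg w, norm_nonneg z]

theorem discAut_norm_lt {w z : ℂ} (hw : ‖w‖ < 1) (hz : ‖z‖ < 1) : ‖discAut w z‖ < 1 := by
  have hden := discAut_den_ne hw hz
  rw [discAut, norm_div, div_lt_one (norm_pos_iff.2 hden)]
  apply lt_of_pow_lt_pow_left₀ 2 (norm_nonneg _)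
  rw [← Complex.normSq_eq_norm_sq, ← Complex.normSq_eq_norm_sq]
  have h1 : Complex.normSq w < 1 := by
    rw [Complex.normSq_eq_norm_sq]; nlinarith [norm_nonneg w]
  have h2 : Complex.normSq z < 1 := by
    rw [Complex.normSq_eq_norm_sq]; nlinarith [norm_nonneg z]
  simp only [Complex.normSq_apply, Complex.sub_re, Complex.sub_im, Complex.mul_re, Complex.mul_im,
    Complex.conj_re, Complex.conj_im, Complex.one_re, Complex.one_im] at *
  nlinarith [mul_pos (sub_pos.2 h1) (sub_pos.2 h2)]

theorem discAut_injOn {w : ℂ} (hw : ‖w‖ < 1) : InjOn (discAut w) (ball 0 1) := by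
  intro a ha b hb h
  rw [mem_ball_zero_iff] at ha hb
  have h1 := discAut_den_ne hw ha
  have h2 := discAut_den_ne hw hb
  rw [discAut, discAut, div_eq_div_iff h1 h2] at h
  have h3 := discAut_den_ne hw hw
  have : (a - b) * (1 - (starRingEnd ℂ) w * w) = 0 := by linear_combination h
  exact sub_eq_zero.1 ((mul_eq_zero.1 this).resolve_right h3)

theorem discAut_hasDerivAt {w z : ℂ} (hw : ‖w‖ < 1) (hz : ‖z‖ < 1) :
    HasDerivAt (discAut w) ((1 - (starRingEnd ℂ) w * w) / (1 - (starRingEnd ℂ) w * z) ^ 2) z := by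
  have hden := discAut_den_ne hw hz
  have h1 : HasDerivAt (fun z => z - w) 1 z := (hasDerivAt_id z).sub_const w
  have h2 : HasDerivAt (fun z => 1 - (starRingEnd ℂ) w * z) (-((starRingEnd ℂ) w * 1)) z :=
    ((hasDerivAt_id z).const_mul _).const_sub 1
  have h3 := h1.div h2 hden
  have e : (1 * (1 - (starRingEnd ℂ) w * z) - (z - w) * -((starRingEnd ℂ) w * 1)) =
      1 - (starRingEnd ℂ) w * w := by ring
  rw [e] at h3
  exact h3

theorem hasDerivAt_sqrt {g s : ℂ → ℂ} {g' z : ℂ} (hs : ContinuousAt s z)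
    (h : ∀ᶠ w in 𝓝 z, s w ^ 2 = g w) (h0 : s z ≠ 0) (hg : HasDerivAt g g' z) :
    HasDerivAt s (g' / (2 * s z)) z := by
  rw [hasDerivAt_iff_tendsto_slope] at hg ⊢
  have h1 : Tendsto (fun w => slope g z w / (s w + s z)) (𝓝[≠] z) (𝓝 (g' / (2 * s z))) := by
    refine hg.div ?_ (by simpa using h0)
    have : Tendsto (fun w => s w + s z) (𝓝 z) (𝓝 (s z + s z)) := hs.tendsto.add_const _
    rw [← two_mul] at this
    exact this.mono_left nhdsWithin_le_nhds
  refine h1.congr' ?_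
  have h2 : ∀ᶠ w in 𝓝 z, s w + s z ≠ 0 := by
    have : ContinuousAt (fun w => s w + s z) z := by fun_prop
    exact this.eventually_ne (by simpa [← two_mul] using h0)
  filter_upwards [nhdsWithin_le_nhds h, nhdsWithin_le_nhds h2] with w hw hw2
  rw [slope_def_field, slope_def_field, ← hw, ← h.self_of_nhds]
  field_simp
  ring

/-- The Riemann mapping theorem for bounded domains carrying logarithms. -/
theorem exists_riemannMap {U : Set ℂ} (hU : IsOpen U) (hUc : IsPreconnected U)
    (hUb : Bornology.IsBounded U)
    (hlog : ∀ g : ℂ → ℂ, ContinuousOn g U → (∀ z ∈ U, g z ≠ 0) →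
      ∃ l : ℂ → ℂ, ContinuousOn l U ∧ ∀ z ∈ U, Complex.exp (l z) = g z)
    {a : ℂ} (ha : a ∈ U) :
    ∃ f : ℂ → ℂ, DifferentiableOn ℂ f U ∧ InjOn f U ∧ f '' U = ball 0 1 ∧ f a = 0 := by
  let 𝓕 : Set (ℂ → ℂ) := {f | DifferentiableOn ℂ f U ∧ InjOn f U ∧ MapsTo f U (ball 0 1) ∧ f a = 0}
  obtain ⟨r, hr, hrU⟩ := Metric.isOpen_iff.1 hU a ha
  obtain ⟨R, hR⟩ := hUb.subset_ball a
  have hR0 : 0 < R := by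
    have := hR ha
    simpa using this
  have hf0 : (fun z => (z - a) / (R : ℂ)) ∈ 𝓕 := by
    have hRc : (R : ℂ) ≠ 0 := by exact_mod_cast hR0.ne'
    refine ⟨by fun_prop, ?_, ?_, by simp⟩
    · intro z _ w _ h
      simp only at h
      field_simp at h
      linear_combination h
    · intro z hz
      have h1 := hR hz
      rw [mem_ball, dist_eq_norm] at h1
      rw [mem_ball_zero_iff, norm_div, Complex.norm_real, Real.norm_of_nonneg hR0.le,
        div_lt_one hR0]
      exact h1
  let S : Set ℝ := (fun f => ‖deriv f a‖) '' 𝓕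
  have hSne : S.Nonempty := ⟨_, _, hf0, rfl⟩
  have hSb : BddAbove S := by
    refine ⟨1 / r, ?_⟩
    rintro _ ⟨f, ⟨h1, h2, h3, h4⟩, rfl⟩
    refine Complex.norm_deriv_le_div_of_mapsTo_ball (h1.mono hrU) ?_ hr
    intro z hz
    rw [h4]
    exact ball_subset_closedBall (h3 (hrU hz))
  obtain ⟨u, -, hu, huS⟩ := exists_seq_tendsto_sSup hSne hSb
  choose f hf hfu using huS
  obtain ⟨F, hF⟩ := exists_tendstoLocallyUniformlyOn hU (fun n => (hf n).1) (fun n => (hf n).2.2.1)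
  have hFd : DifferentiableOn ℂ F U :=
    hF.differentiableOn (Eventually.of_forall fun n => (hf n).1) hU
  have hder : ‖deriv F a‖ = sSup S := by
    have h1 := (hF.deriv (Eventually.of_forall fun n => (hf n).1) hU).tendsto_at ha
    have h2 : Tendsto u (hyperfilter ℕ : Filter ℕ) (𝓝 (sSup S)) :=
      hu.mono_left Nat.hyperfilter_le_atTop
    refine tendsto_nhds_unique h1.norm (h2.congr fun n => ?_)
    exact (hfu n).symm
  have hpos : 0 < sSup S := by
    have h1 := le_csSup hSb ⟨_, hf0, rfl⟩
    refine lt_of_lt_of_le ?_ h1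
    have : HasDerivAt (fun z : ℂ => (z - a) / (R : ℂ)) (1 / R) a :=
      ((hasDerivAt_id a).sub_const a).div_const _
    simp only [this.deriv, norm_pos_iff]
    have hRc : (R : ℂ) ≠ 0 := by exact_mod_cast hR0.ne'
    simpa using hRc
  have hFa : F a = 0 := by
    refine tendsto_nhds_unique (hF.tendsto_at ha) ?_
    refine tendsto_const_nhds.congr fun n => ?_
    exact (hf n).2.2.2.symm
  have hFne : ∃ p ∈ U, ∃ q ∈ U, F p ≠ F q := by
    by_contra hcon
    push Not at hcon
    have : F =ᶠ[𝓝 a] fun _ => F a := by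
      filter_upwards [hU.mem_nhds ha] with z hz using hcon z hz a ha
    rw [this.deriv_eq] at hder
    simp at hder
    linarith
  have hFi : InjOn F U := injOn_of_tendstoLocallyUniformlyOn hU hUc (fun n => (hf n).1)
    (fun n => (hf n).2.1) hF hFne
  have hFm : MapsTo F U (ball 0 1) := by
    have h1 : F '' U ⊆ closedBall 0 1 := by
      rintro _ ⟨z, hz, rfl⟩
      exact isClosed_closedBall.mem_of_tendsto (hF.tendsto_at hz)
        (Eventually.of_forall fun n => ball_subset_closedBall ((hf n).2.2.1 hz))
    have h2 := (isOpen_image_of_injOn hU hFd.continuousOn hFi).subset_interior_iff.2 h1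
    rw [interior_closedBall _ one_ne_zero] at h2
    exact fun z hz => h2 (mem_image_of_mem F hz)
  have hFn : ∀ z ∈ U, ‖F z‖ < 1 := fun z hz => mem_ball_zero_iff.1 (hFm hz)
  refine ⟨F, hFd, hFi, Subset.antisymm hFm.image_subset ?_, hFa⟩
  intro w hw
  by_contra hwn
  rw [mem_ball_zero_iff] at hw
  have hFw : ∀ z ∈ U, F z ≠ w := fun z hz h => hwn ⟨z, hz, h⟩
  have hw0 : w ≠ 0 := fun h => hwn ⟨a, ha, by rw [hFa, h]⟩
  have hGd : ∀ z ∈ U, HasDerivAt (fun z => discAut w (F z)) ((1 - (starRingEnd ℂ) w * w) /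
      (1 - (starRingEnd ℂ) w * F z) ^ 2 * deriv F z) z := fun z hz =>
    (discAut_hasDerivAt hw (hFn z hz)).comp z (hFd.differentiableAt (hU.mem_nhds hz)).hasDerivAt
  have hGc : ContinuousOn (fun z => discAut w (F z)) U := fun z hz =>
    (hGd z hz).continuousAt.continuousWithinAt
  have hGne : ∀ z ∈ U, discAut w (F z) ≠ 0 := fun z hz =>
    div_ne_zero (sub_ne_zero.2 (hFw z hz)) (discAut_den_ne hw (hFn z hz))
  obtain ⟨l, hl, hle⟩ := hlog _ hGc hGne
  let s : ℂ → ℂ := fun z => Complex.exp (l z / 2)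
  have hs2 : ∀ z ∈ U, s z ^ 2 = discAut w (F z) := by
    intro z hz
    rw [← hle z hz, ← Complex.exp_nat_mul]
    congr 1
    push_cast
    ring
  have hs0 : ∀ z, s z ≠ 0 := fun z => Complex.exp_ne_zero _
  have hsc : ContinuousOn s U := by
    have : ContinuousOn (fun z => l z / 2) U := hl.div_const 2
    exact Complex.continuous_exp.comp_continuousOn this
  have hsd : ∀ z ∈ U, HasDerivAt s ((1 - (starRingEnd ℂ) w * w) /
      (1 - (starRingEnd ℂ) w * F z) ^ 2 * deriv F z / (2 * s z)) z := fun z hz =>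
    hasDerivAt_sqrt (hsc.continuousAt (hU.mem_nhds hz))
      (by filter_upwards [hU.mem_nhds hz] with v hv using hs2 v hv) (hs0 z) (hGd z hz)
  have hsn : ∀ z ∈ U, ‖s z‖ < 1 := by
    intro z hz
    have h1 := discAut_norm_lt hw (hFn z hz)
    rw [← hs2 z hz, norm_pow] at h1
    nlinarith [norm_nonneg (s z)]
  have hb := hsn a ha
  have hmem : (fun z => discAut (s a) (s z)) ∈ 𝓕 := by
    refine ⟨fun z hz => ?_, ?_, ?_, ?_⟩
    · exact ((discAut_hasDerivAt hb (hsn z hz)).comp z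
        (hsd z hz)).differentiableAt.differentiableWithinAt
    · intro p hp q hq h
      have h1 : s p = s q := discAut_injOn hb (mem_ball_zero_iff.2 (hsn p hp))
        (mem_ball_zero_iff.2 (hsn q hq)) h
      have h2 : discAut w (F p) = discAut w (F q) := by rw [← hs2 p hp, ← hs2 q hq, h1]
      exact hFi hp hq (discAut_injOn hw (hFm hp) (hFm hq) h2)
    · intro z hz
      exact mem_ball_zero_iff.2 (discAut_norm_lt hb (hsn z hz))
    · simp [discAut]
  have hle' := le_csSup hSb ⟨_, hmem, rfl⟩
  have hD := ((discAut_hasDerivAt hb hb).comp a (hsd a ha)).deriv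
  have hnorm : ‖deriv (fun z => discAut (s a) (s z)) a‖
      = (1 - ‖w‖ ^ 2) / ((1 - ‖w‖) * (2 * ‖s a‖)) * sSup S := by
    have hsa : ‖s a‖ ^ 2 = ‖w‖ := by
      rw [← norm_pow, hs2 a ha, hFa, discAut]; simp
    have e1 : (starRingEnd ℂ) (s a) * s a = (‖w‖ : ℝ) := by
      rw [mul_comm, Complex.mul_conj, Complex.normSq_eq_norm_sq, hsa]
    have e2 : (starRingEnd ℂ) w * w = (‖w‖ ^ 2 : ℝ) := by
      rw [mul_comm, Complex.mul_conj, Complex.normSq_eq_norm_sq]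
    change deriv (fun z => discAut (s a) (s z)) a = _ at hD
    rw [hD, hFa, e1, e2, mul_zero, sub_zero, one_pow, div_one, norm_mul, norm_div, norm_div,
      norm_mul, norm_mul, norm_pow, hder, ← Complex.ofReal_one, ← Complex.ofReal_sub,
      ← Complex.ofReal_sub, Complex.norm_real, Complex.norm_real, Real.norm_of_nonneg,
      Real.norm_of_nonneg]
    · have : 1 - ‖w‖ ≠ 0 := by linarith
      have h2 := norm_pos_iff.2 (hs0 a)
      rw [Complex.norm_ofNat]
      field_simp
    · nlinarith [norm_nonneg w]
    · linarith
  simp only [hnorm] at hle'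
  have hsa : ‖s a‖ ^ 2 = ‖w‖ := by
    rw [← norm_pow, hs2 a ha, hFa, discAut]; simp
  have h2 := norm_pos_iff.2 (hs0 a)
  have hlt : 1 < (1 - ‖w‖ ^ 2) / ((1 - ‖w‖) * (2 * ‖s a‖)) := by
    have h3 : 0 < 1 - ‖w‖ := by linarith
    rw [lt_div_iff₀ (by positivity), ← hsa]
    rw [← hsa] at h3
    nlinarith [mul_pos h3 (pow_pos (sub_pos.2 hb) 2)]
  nlinarith

end

section

open Metric MeasureTheory

theorem lintegral_deriv_sq_lt_top {U : Set ℂ} {φ : ℂ → ℂ} (hU : IsOpen U)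
    (hd : DifferentiableOn ℂ φ U) (hi : InjOn φ U) (hb : Bornology.IsBounded (φ '' U)) :
    ∫⁻ z in U, ENNReal.ofReal (‖deriv φ z‖ ^ 2) < ⊤ := by
  have h1 : ∀ z ∈ U, HasFDerivWithinAt φ
      ((ContinuousLinearMap.toSpanSingleton ℂ (deriv φ z)).restrictScalars ℝ) U z := fun z hz =>
    ((hd.differentiableAt (hU.mem_nhds hz)).hasDerivAt.hasFDerivAt.restrictScalars
      ℝ).hasFDerivWithinAt
  have h2 := lintegral_image_eq_lintegral_abs_det_fderiv_mul volume hU.measurableSet h1 hi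
    (fun _ => 1)
  have h3 : ∀ z, |((ContinuousLinearMap.toSpanSingleton ℂ (deriv φ z)).restrictScalars ℝ).det|
      = ‖deriv φ z‖ ^ 2 := by
    intro z
    simp [ContinuousLinearMap.det, LinearMap.det_restrictScalars, Algebra.norm_complex_eq,
      Complex.normSq_eq_norm_sq]
  simp only [h3, mul_one, lintegral_one, Measure.restrict_apply_univ] at h2
  rw [← h2]
  exact hb.measure_lt_top

theorem cos_ge_of_mem_Icc {c a b t : ℝ} (ha : -Real.pi < a) (hb : b < Real.pi)
    (hca : c < Real.cos a) (hcb : c < Real.cos b) (ht : t ∈ Icc a b) : c < Real.cos t := by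
  rcases le_total 0 t with h | h
  · exact hcb.trans_le (Real.cos_le_cos_of_nonneg_of_le_pi h hb.le ht.2)
  · rw [← Real.cos_neg] at hca ⊢
    exact hca.trans_le
      (Real.cos_le_cos_of_nonneg_of_le_pi (by linarith) (by linarith) (by linarith [ht.1]))

theorem mem_ball_one_polar {r t : ℝ} (hr : 0 < r) :
    (r : ℂ) * Complex.exp (t * Complex.I) ∈ ball (1 : ℂ) 1 ↔ r / 2 < Real.cos t := by
  rw [mem_ball, dist_eq_norm, ← abs_norm, ← sq_lt_one_iff_abs_lt_one,
    ← Complex.normSq_eq_norm_sq, Complex.exp_mul_I, Complex.normSq_apply]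
  simp only [Complex.sub_re, Complex.mul_re, Complex.ofReal_re, Complex.add_re, Complex.cos_ofReal_re,
    Complex.sin_ofReal_re, Complex.I_re, Complex.sin_ofReal_im, Complex.I_im, Complex.ofReal_im,
    Complex.add_im, Complex.cos_ofReal_im, Complex.mul_im, Complex.one_re, Complex.sub_im,
    Complex.one_im]
  have h := Real.sin_sq_add_cos_sq t
  have e : ∀ c s : ℝ, s ^ 2 + c ^ 2 = 1 →
      (r * (c + (s * 0 - 0 * 1)) - 0 * (0 + (s * 1 + 0 * 0)) - 1) *
        (r * (c + (s * 0 - 0 * 1)) - 0 * (0 + (s * 1 + 0 * 0)) - 1) +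
      (r * (0 + (s * 1 + 0 * 0)) + 0 * (c + (s * 0 - 0 * 1)) - 0) *
        (r * (0 + (s * 1 + 0 * 0)) + 0 * (c + (s * 0 - 0 * 1)) - 0) =
      1 + r * (r - 2 * c) := by
    intro c s hcs
    linear_combination r ^ 2 * hcs
  rw [e _ _ h]
  constructor
  · intro h1
    have : r * (r - 2 * Real.cos t) < 0 := by linarith
    by_contra hcon
    push Not at hcon
    nlinarith
  · intro h1
    nlinarith

theorem arc_energy {φ : ℂ → ℂ} (hd : DifferentiableOn ℂ φ (ball 1 1)) {r ε a b : ℝ} (hr : 0 < r)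
    (hε : 0 < ε) (ha : -Real.pi < a) (hb : b < Real.pi) (hab : a ≤ b)
    (hca : r / 2 < Real.cos a) (hcb : r / 2 < Real.cos b)
    (hφ : ε < ‖φ (r * Complex.exp (b * Complex.I)) - φ (r * Complex.exp (a * Complex.I))‖) :
    ENNReal.ofReal (ε ^ 2 / (2 * Real.pi) * r⁻¹) ≤ ENNReal.ofReal r *
      ∫⁻ t in Ioo (-Real.pi) Real.pi, (ball (1 : ℂ) 1).indicator
        (fun z => ENNReal.ofReal (‖deriv φ z‖ ^ 2)) (r * Complex.exp (t * Complex.I)) := by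
  set γ : ℝ → ℂ := fun t => r * Complex.exp (t * Complex.I) with hγ
  have hmem : ∀ t ∈ Icc a b, γ t ∈ ball (1 : ℂ) 1 := fun t ht =>
    (mem_ball_one_polar hr).2 (cos_ge_of_mem_Icc ha hb hca hcb ht)
  have hγd : ∀ t : ℝ, HasDerivAt γ (r * (Complex.exp (t * Complex.I) * Complex.I)) t := by
    intro t
    have h1 : HasDerivAt (fun t : ℝ => (t : ℂ) * Complex.I) (1 * Complex.I) t :=
      (Complex.ofRealCLM.hasDerivAt (x := t)).mul_const Complex.I
    rw [one_mul] at h1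
    exact h1.cexp.const_mul _
  have hnγ : ∀ t : ℝ, ‖(r : ℂ) * (Complex.exp (t * Complex.I) * Complex.I)‖ = r := by
    intro t
    rw [norm_mul, norm_mul, Complex.norm_exp_ofReal_mul_I, Complex.norm_real, Complex.norm_I,
      Real.norm_of_nonneg hr.le]
    ring
  have hcomp : ∀ t ∈ Icc a b, HasDerivAt (fun t => φ (γ t))
      ((r * (Complex.exp (t * Complex.I) * Complex.I)) • deriv φ (γ t)) t := fun t ht =>
    ((hd.differentiableAt (isOpen_ball.mem_nhds (hmem t ht))).hasDerivAt).scomp t (hγd t)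
  have hdc : ContinuousOn (fun t => ‖deriv φ (γ t)‖ ^ 2) (Icc a b) := by
    have h1 : ContinuousOn (deriv φ) (ball 1 1) := (hd.deriv isOpen_ball).continuousOn
    have h2 : ContinuousOn γ (Icc a b) := fun t _ => (hγd t).continuousAt.continuousWithinAt
    exact ((h1.comp h2 hmem).norm).pow 2
  set δ := ε / (4 * Real.pi) with hδ
  have hpi := Real.pi_pos
  have hδ0 : 0 < δ := by positivity
  have hii : IntervalIntegrable (fun t => ‖deriv φ (γ t)‖ ^ 2) volume a b := by
    apply ContinuousOn.intervalIntegrable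
    rwa [uIcc_of_le hab]
  have hint2 : IntervalIntegrable (fun t => δ + r ^ 2 / (4 * δ) * ‖deriv φ (γ t)‖ ^ 2)
      volume a b := intervalIntegrable_const.add (hii.const_mul _)
  have hB := norm_sub_le_integral_of_norm_deriv_le_of_le (f := fun t => φ (γ t)) hab
    (fun t ht => (hcomp t ht).continuousAt.continuousWithinAt)
    (fun t ht => (hcomp t (Ioo_subset_Icc_self ht)).differentiableAt.differentiableWithinAt)
    (B := fun t => δ + r ^ 2 / (4 * δ) * ‖deriv φ (γ t)‖ ^ 2)
    (Eventually.of_forall fun t ht => by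
      rw [(hcomp t (Ioo_subset_Icc_self ht)).deriv, norm_smul, hnγ]
      have : δ + r ^ 2 / (4 * δ) * ‖deriv φ (γ t)‖ ^ 2 - r * ‖deriv φ (γ t)‖ =
        (2 * δ - r * ‖deriv φ (γ t)‖) ^ 2 / (4 * δ) := by field_simp; ring
      have h2 : 0 ≤ (2 * δ - r * ‖deriv φ (γ t)‖) ^ 2 / (4 * δ) := by positivity
      linarith) hint2
  rw [intervalIntegral.integral_add intervalIntegrable_const (hii.const_mul _),
    intervalIntegral.integral_const, intervalIntegral.integral_const_mul, smul_eq_mul] at hB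
  set I := ∫ t in a..b, ‖deriv φ (γ t)‖ ^ 2 with hI
  have hkey : ε ^ 2 / (2 * Real.pi) ≤ r ^ 2 * I := by
    have h1 : (b - a) * δ ≤ ε / 2 := by
      calc (b - a) * δ ≤ (2 * Real.pi) * δ := by gcongr; linarith
        _ = ε / 2 := by rw [hδ]; field_simp; norm_num
    have h2 : r ^ 2 / (4 * δ) * I = r ^ 2 * I * Real.pi / ε := by
      rw [hδ]; field_simp
    have h3 : ε / 2 ≤ r ^ 2 * I * Real.pi / ε := by
      have : ε < ‖φ (γ b) - φ (γ a)‖ := hφ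
      linarith
    rw [le_div_iff₀ hε] at h3
    rw [div_le_iff₀ (by positivity)]
    nlinarith
  have hle : ENNReal.ofReal I ≤ ∫⁻ t in Ioo (-Real.pi) Real.pi, (ball (1 : ℂ) 1).indicator
        (fun z => ENNReal.ofReal (‖deriv φ z‖ ^ 2)) (γ t) := by
    rw [hI, intervalIntegral.integral_of_le hab, integral_Ioc_eq_integral_Ioo,
      ofReal_integral_eq_lintegral_ofReal]
    · calc ∫⁻ t in Ioo a b, ENNReal.ofReal (‖deriv φ (γ t)‖ ^ 2)
          = ∫⁻ t in Ioo a b, (ball (1 : ℂ) 1).indicator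
              (fun z => ENNReal.ofReal (‖deriv φ z‖ ^ 2)) (γ t) := by
            refine setLIntegral_congr_fun measurableSet_Ioo fun t ht => ?_
            rw [indicator_of_mem (hmem t (Ioo_subset_Icc_self ht))]
        _ ≤ _ := lintegral_mono_set (Ioo_subset_Ioo ha.le hb.le)
    · change IntegrableOn _ _ _
      rw [← integrableOn_Ioc_iff_integrableOn_Ioo]
      exact (intervalIntegrable_iff_integrableOn_Ioc_of_le hab).1 hii
    · exact Eventually.of_forall fun t => by positivity
  calc ENNReal.ofReal (ε ^ 2 / (2 * Real.pi) * r⁻¹) ≤ ENNReal.ofReal (r * I) := by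
        apply ENNReal.ofReal_le_ofReal
        rw [← div_eq_mul_inv, div_le_iff₀ hr]
        linarith
    _ = ENNReal.ofReal r * ENNReal.ofReal I := ENNReal.ofReal_mul hr.le
    _ ≤ _ := by gcongr

/-- The length-area principle: among the circular crosscuts around a boundary point of a disc,
some have images of small diameter. -/
theorem exists_small_crosscut {φ : ℂ → ℂ} (hd : DifferentiableOn ℂ φ (ball 1 1))
    (hi : InjOn φ (ball 1 1)) (hb : Bornology.IsBounded (φ '' ball 1 1)) {ε b : ℝ} (hε : 0 < ε)
    (hb0 : 0 < b) : ∃ r ∈ Ioo 0 b, ∀ z ∈ ball (1 : ℂ) 1, ∀ w ∈ ball (1 : ℂ) 1, ‖z‖ = r → ‖w‖ = r →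
      ‖φ z - φ w‖ ≤ ε := by
  by_contra hcon
  push Not at hcon
  set F : ℂ → ENNReal := (ball (1 : ℂ) 1).indicator
        (fun z => ENNReal.ofReal (‖deriv φ z‖ ^ 2)) with hF
  have hpt : ∀ r ∈ Ioo 0 b, ENNReal.ofReal (ε ^ 2 / (2 * Real.pi) * r⁻¹) ≤ ENNReal.ofReal r *
      ∫⁻ t in Ioo (-Real.pi) Real.pi, F (r * Complex.exp (t * Complex.I)) := by
    intro r hr
    obtain ⟨z, hz, w, hw, hzr, hwr, hzw⟩ := hcon r hr
    have key : ∀ z ∈ ball (1 : ℂ) 1, ‖z‖ = r → -Real.pi < z.arg ∧ z.arg < Real.pi ∧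
        r / 2 < Real.cos z.arg ∧ (r : ℂ) * Complex.exp (z.arg * Complex.I) = z := by
      intro z hz hzr
      have e : (r : ℂ) * Complex.exp (z.arg * Complex.I) = z := by
        rw [← hzr]; exact Complex.norm_mul_exp_arg_mul_I z
      have h1 : r / 2 < Real.cos z.arg := by
        rw [← mem_ball_one_polar hr.1, e]; exact hz
      refine ⟨Complex.neg_pi_lt_arg z, (Complex.arg_le_pi z).lt_of_ne ?_, h1, e⟩
      intro h
      rw [h, Real.cos_pi] at h1
      linarith [hr.1]
    obtain ⟨z1, z2, z3, z4⟩ := key z hz hzr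
    obtain ⟨w1, w2, w3, w4⟩ := key w hw hwr
    rcases le_total z.arg w.arg with h | h
    · refine arc_energy hd hr.1 hε z1 w2 h z3 w3 ?_
      rwa [z4, w4, norm_sub_rev]
    · refine arc_energy hd hr.1 hε w1 z2 h w3 z3 ?_
      rwa [z4, w4]
  have hmeas : Measurable F := by
    refine Measurable.indicator ?_ measurableSet_ball
    exact ((measurable_deriv φ).norm.pow_const 2).ennreal_ofReal
  have htot := lintegral_deriv_sq_lt_top isOpen_ball hd hi hb
  rw [← lintegral_indicator measurableSet_ball, ← hF, ← Complex.lintegral_comp_polarCoord_symm,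
    polarCoord_target, Measure.volume_eq_prod, ← Measure.prod_restrict, lintegral_prod] at htot
  · have h1 : ∫⁻ r in Ioo 0 b, ENNReal.ofReal (ε ^ 2 / (2 * Real.pi) * r⁻¹) < ⊤ := by
      refine lt_of_le_of_lt ?_ htot
      calc _ ≤ ∫⁻ r in Ioo 0 b, ∫⁻ t in Ioo (-Real.pi) Real.pi,
            ENNReal.ofReal r • F (Complex.polarCoord.symm (r, t)) := by
            refine setLIntegral_mono' measurableSet_Ioo fun r hr => ?_
            refine (hpt r hr).trans ?_
            rw [← lintegral_const_mul']
            · refine le_of_eq (lintegral_congr fun t => ?_)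
              rw [Complex.polarCoord_symm_apply, Complex.exp_mul_I]
              simp
            · exact ENNReal.ofReal_ne_top
        _ ≤ _ := lintegral_mono_set Ioo_subset_Ioi_self
    have h2 : IntegrableOn (fun r : ℝ => ε ^ 2 / (2 * Real.pi) * r⁻¹) (Ioo 0 b) := by
      refine ⟨(by fun_prop : Measurable fun r : ℝ =>
        ε ^ 2 / (2 * Real.pi) * r⁻¹).aestronglyMeasurable, ?_⟩
      rw [hasFiniteIntegral_iff_ofReal]
      · exact h1
      · filter_upwards [ae_restrict_mem measurableSet_Ioo] with r hr
        have := hr.1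
        have := Real.pi_pos
        change 0 ≤ _
        positivity
    have h3 : IntegrableOn (fun r : ℝ => r⁻¹) (Ioo 0 b) := by
      have hne : ε ^ 2 / (2 * Real.pi) ≠ 0 := by
        have := Real.pi_pos
        positivity
      have := h2.const_mul (ε ^ 2 / (2 * Real.pi))⁻¹
      simpa only [inv_mul_cancel_left₀ hne, IntegrableOn] using this
    rw [← intervalIntegrable_iff_integrableOn_Ioo_of_le hb0.le, intervalIntegrable_inv_iff] at h3
    rcases h3 with h3 | h3
    · exact hb0.ne h3
    · exact h3 left_mem_uIcc
  · apply Measurable.aemeasurable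
    have : Measurable fun p : ℝ × ℝ => F (Complex.polarCoord.symm p) := by
      refine hmeas.comp (Continuous.measurable ?_)
      refine Continuous.congr (f := fun p : ℝ × ℝ =>
        (p.1 : ℂ) * (Real.cos p.2 + Real.sin p.2 * Complex.I)) (by fun_prop) fun p => ?_
      rw [Complex.polarCoord_symm_apply]
    exact (ENNReal.measurable_ofReal.comp measurable_fst).smul this

end

section

open Metric

theorem exists_radius_of_norm_le {m : ℂ → ℂ} (hc : ContinuousOn m (ball 0 1))
    (hi : InjOn m (ball 0 1)) (hm : m '' ball 0 1 = ball 0 1) {s : ℝ} (hs : s < 1) :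
    ∃ t < 1, ∀ z ∈ ball (0 : ℂ) 1, ‖m z‖ ≤ s → ‖z‖ < t := by
  have hsub : ∀ t : Iio (1 : ℝ), ball (0 : ℂ) t ⊆ ball 0 1 := fun t => ball_subset_ball t.2.le
  have hne : Nonempty (Iio (1 : ℝ)) := ⟨⟨0, mem_Iio.2 zero_lt_one⟩⟩
  obtain ⟨t, ht⟩ := (isCompact_closedBall (0 : ℂ) s).elim_directed_cover
    (fun t : Iio (1 : ℝ) => m '' ball 0 t)
    (fun t => isOpen_image_of_injOn isOpen_ball (hc.mono (hsub t)) (hi.mono (hsub t))) (by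
      intro y hy
      have hy1 : y ∈ ball (0 : ℂ) 1 := closedBall_subset_ball hs hy
      rw [← hm] at hy1
      obtain ⟨z, hz, rfl⟩ := hy1
      rw [mem_ball_zero_iff] at hz
      refine mem_iUnion.2 ⟨⟨(‖z‖ + 1) / 2, by rw [mem_Iio]; linarith⟩, z, ?_, rfl⟩
      rw [mem_ball_zero_iff]
      change _ < (‖z‖ + 1) / 2
      linarith)
    (Monotone.directed_le fun a b hab => image_mono (ball_subset_ball hab))
  refine ⟨t, t.2, fun z hz hzs => ?_⟩
  obtain ⟨w, hw, hwz⟩ := ht (mem_closedBall_zero_iff.2 hzs)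
  rw [← hi (hsub t hw) hz hwz]
  exact mem_ball_zero_iff.1 hw

theorem exists_norm_eq_on_sphere {w₀ : ℂ} (hw : ‖w₀‖ = 1) {r v : ℝ} (hr : 0 < r) (hr1 : r < 1)
    (hv : v ∈ Icc (1 - r) (1 + r)) : ∃ w, ‖w - w₀‖ = r ∧ ‖w‖ = v := by
  have hpre : IsPreconnected (sphere w₀ r) := isPreconnected_sphere one_lt_rank_complex _ _
  have h1 : w₀ * (1 - r : ℝ) ∈ sphere w₀ r := by
    rw [mem_sphere, dist_eq_norm, show w₀ * (1 - r : ℝ) - w₀ = -(w₀ * (r : ℝ)) by push_cast; ring,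
      norm_neg, norm_mul, hw, Complex.norm_real, Real.norm_of_nonneg hr.le, one_mul]
  have h2 : w₀ * (1 + r : ℝ) ∈ sphere w₀ r := by
    rw [mem_sphere, dist_eq_norm, show w₀ * (1 + r : ℝ) - w₀ = w₀ * (r : ℝ) by push_cast; ring,
      norm_mul, hw, Complex.norm_real, Real.norm_of_nonneg hr.le, one_mul]
  have h := hpre.intermediate_value h1 h2 continuous_norm.continuousOn
  rw [norm_mul, norm_mul, hw, Complex.norm_real, Complex.norm_real,
    Real.norm_of_nonneg (by linarith), Real.norm_of_nonneg (by linarith), one_mul, one_mul] at h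
  obtain ⟨w, hw1, hw2⟩ := h hv
  exact ⟨w, by rwa [mem_sphere, dist_eq_norm] at hw1, hw2⟩

theorem norm_sub_sq_le_of_cap {y ξ : ℂ} {ε : ℝ} (hy : ‖y‖ < 1) (hξ : ‖ξ‖ = 1)
    (h : 1 - ε ≤ (y * (starRingEnd ℂ) ξ).re) : ‖y - ξ‖ ^ 2 ≤ 2 * ε := by
  have h1 : Complex.normSq y < 1 := by
    rw [Complex.normSq_eq_norm_sq]; nlinarith [norm_nonneg y]
  have h2 : Complex.normSq ξ = 1 := by
    rw [Complex.normSq_eq_norm_sq, hξ]; norm_num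
  rw [← Complex.normSq_eq_norm_sq]
  simp only [Complex.normSq_apply, Complex.sub_re, Complex.sub_im, Complex.mul_re,
    Complex.conj_re, Complex.conj_im] at *
  nlinarith

theorem re_mul_conj_le (y : ℂ) {ξ : ℂ} (hξ : ‖ξ‖ = 1) : (y * (starRingEnd ℂ) ξ).re ≤ ‖y‖ := by
  refine (Complex.re_le_norm _).trans ?_
  rw [norm_mul, Complex.norm_conj, hξ, mul_one]

/-- If small crosscuts have small images, boundary neighbourhoods map into small caps. -/
theorem exists_cap {m : ℂ → ℂ} (hc : ContinuousOn m (ball 0 1))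
    (hi : InjOn m (ball 0 1)) (hm : m '' ball 0 1 = ball 0 1) {w₀ : ℂ} (hw₀ : ‖w₀‖ = 1)
    (hcut : ∀ ε > 0, ∀ b > 0, ∃ r ∈ Ioo 0 b, ∀ z ∈ ball (0 : ℂ) 1, ∀ w ∈ ball (0 : ℂ) 1,
      ‖z - w₀‖ = r → ‖w - w₀‖ = r → ‖m z - m w‖ ≤ ε) {ε : ℝ} (hε : 0 < ε) (hε1 : ε < 1 - ‖m 0‖) :
    ∃ r > 0, ∃ ξ, ‖ξ‖ = 1 ∧ ∀ z ∈ ball (0 : ℂ) 1, ‖z - w₀‖ < r →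
      1 - ε ≤ (m z * (starRingEnd ℂ) ξ).re := by
  obtain ⟨r, ⟨hr0, hr1⟩, hr⟩ := hcut (ε / 2) (by positivity) (1 / 2) (by norm_num)
  obtain ⟨t, ht, htm⟩ := exists_radius_of_norm_le hc hi hm (s := 1 - ε / 2) (by linarith)
  obtain ⟨w, hw1, hw2⟩ := exists_norm_eq_on_sphere hw₀ hr0 (by linarith)
    (v := (1 + max t (1 - r)) / 2)
    ⟨by linarith [le_max_right t (1 - r)], by
      have : max t (1 - r) < 1 := max_lt ht (by linarith)
      linarith⟩
  have hmax : max t (1 - r) < 1 := max_lt ht (by linarith)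
  have hwb : w ∈ ball (0 : ℂ) 1 := by rw [mem_ball_zero_iff, hw2]; linarith
  have hmw : 1 - ε / 2 < ‖m w‖ := by
    by_contra hcon
    have := htm w hwb (not_lt.1 hcon)
    linarith [le_max_left t (1 - r)]
  have hm0 := norm_nonneg (m 0)
  have hmw0 : 0 < ‖m w‖ := by linarith
  set ξ : ℂ := m w / ‖m w‖ with hξ
  have hξ1 : ‖ξ‖ = 1 := by
    rw [hξ, norm_div, Complex.norm_real, norm_norm, div_self hmw0.ne']
  have hwξ : (m w * (starRingEnd ℂ) ξ).re = ‖m w‖ := by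
    rw [hξ, map_div₀, Complex.conj_ofReal, mul_div_assoc', Complex.mul_conj,
      Complex.normSq_eq_norm_sq, ← Complex.ofReal_div, Complex.ofReal_re]
    field_simp
  refine ⟨r, hr0, ξ, hξ1, ?_⟩
  let Y : Set ℂ := ball 0 1 ∩ {y | (y * (starRingEnd ℂ) ξ).re < 1 - ε}
  have hYc : IsPreconnected Y := by
    refine ((convex_ball 0 1).inter ?_).isPreconnected
    refine convex_halfSpace_lt (f := fun y : ℂ => (y * (starRingEnd ℂ) ξ).re) ?_ _
    exact ⟨fun a b => by simp [add_mul], fun a b => by simp [mul_assoc]⟩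
  have hW : IsOpen (ball (0 : ℂ) 1 ∩ ball w₀ r) := isOpen_ball.inter isOpen_ball
  have hV : IsOpen (ball (0 : ℂ) 1 ∩ (closedBall w₀ r)ᶜ) :=
    isOpen_ball.inter isClosed_closedBall.isOpen_compl
  have hWm := isOpen_image_of_injOn hW (hc.mono inter_subset_left) (hi.mono inter_subset_left)
  have hVm := isOpen_image_of_injOn hV (hc.mono inter_subset_left) (hi.mono inter_subset_left)
  have hdisj : Disjoint (m '' (ball (0 : ℂ) 1 ∩ ball w₀ r))
      (m '' (ball (0 : ℂ) 1 ∩ (closedBall w₀ r)ᶜ)) := by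
    rw [Set.disjoint_left]
    rintro _ ⟨z, hz, rfl⟩ ⟨w, hw, hwz⟩
    rw [hi hw.1 hz.1 hwz] at hw
    exact hw.2 (ball_subset_closedBall hz.2)
  have hcov : Y ⊆ m '' (ball (0 : ℂ) 1 ∩ ball w₀ r) ∪
      m '' (ball (0 : ℂ) 1 ∩ (closedBall w₀ r)ᶜ) := by
    rintro y ⟨hy1, hy2⟩
    rw [← hm] at hy1
    obtain ⟨z, hz, rfl⟩ := hy1
    rcases lt_trichotomy ‖z - w₀‖ r with h | h | h
    · exact Or.inl ⟨z, ⟨hz, by rwa [mem_ball, dist_eq_norm]⟩, rfl⟩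
    · exfalso
      have h1 := hr w hwb z hz hw1 h
      have h2 := re_mul_conj_le (m w - m z) hξ1
      rw [sub_mul, Complex.sub_re, hwξ] at h2
      change (m z * (starRingEnd ℂ) ξ).re < 1 - ε at hy2
      linarith
    · refine Or.inr ⟨z, ⟨hz, ?_⟩, rfl⟩
      rw [mem_compl_iff, mem_closedBall, dist_eq_norm]
      exact not_le.2 h
  rcases hYc.subset_or_subset hWm hVm hdisj hcov with h | h
  · exfalso
    have h0 : (0 : ℂ) ∈ ball (0 : ℂ) 1 ∩ (closedBall w₀ r)ᶜ := by
      refine ⟨mem_ball_self one_pos, ?_⟩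
      rw [mem_compl_iff, mem_closedBall, dist_eq_norm, zero_sub, norm_neg, hw₀]
      linarith
    have h1 : m 0 ∈ Y := by
      refine ⟨hm ▸ mem_image_of_mem m h0.1, ?_⟩
      have := re_mul_conj_le (m 0) hξ1
      change (m 0 * (starRingEnd ℂ) ξ).re < 1 - ε
      linarith
    exact Set.disjoint_left.1 hdisj (h h1) (mem_image_of_mem m h0)
  · intro z hz hzr
    by_contra hcon
    have h1 : m z ∈ Y := ⟨hm ▸ mem_image_of_mem m hz, not_le.1 hcon⟩
    refine Set.disjoint_left.1 hdisj (mem_image_of_mem m ⟨hz, ?_⟩) (h h1)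
    rwa [mem_ball, dist_eq_norm]

theorem exists_boundary_limit {m : ℂ → ℂ} (hc : ContinuousOn m (ball 0 1))
    (hi : InjOn m (ball 0 1)) (hm : m '' ball 0 1 = ball 0 1) {w₀ : ℂ} (hw₀ : ‖w₀‖ = 1)
    (hcut : ∀ ε > 0, ∀ b > 0, ∃ r ∈ Ioo 0 b, ∀ z ∈ ball (0 : ℂ) 1, ∀ w ∈ ball (0 : ℂ) 1,
      ‖z - w₀‖ = r → ‖w - w₀‖ = r → ‖m z - m w‖ ≤ ε) :
    ∃ y, Tendsto m (𝓝[ball 0 1] w₀) (𝓝 y) := by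
  have hne : (𝓝[ball 0 1] w₀).NeBot := by
    rw [← mem_closure_iff_nhdsWithin_neBot, closure_ball _ one_ne_zero, mem_closedBall_zero_iff,
      hw₀]
  rw [← cauchy_map_iff_exists_tendsto, Metric.cauchy_iff]
  refine ⟨hne.map m, fun ε hε => ?_⟩
  have hm0 : ‖m 0‖ < 1 := by
    rw [← mem_ball_zero_iff, ← hm]
    exact mem_image_of_mem m (mem_ball_self one_pos)
  set η := min (ε ^ 2 / 16) ((1 - ‖m 0‖) / 2) with hη
  have hη0 : 0 < η := lt_min (by positivity) (by linarith)
  obtain ⟨r, hr, ξ, hξ, h⟩ := exists_cap hc hi hm hw₀ hcut hη0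
    ((min_le_right _ _).trans_lt (by linarith))
  refine ⟨m '' (ball 0 1 ∩ ball w₀ r), ?_, ?_⟩
  · refine image_mem_map ?_
    exact inter_mem self_mem_nhdsWithin (mem_nhdsWithin_of_mem_nhds (ball_mem_nhds _ hr))
  · have key : ∀ z ∈ ball (0 : ℂ) 1 ∩ ball w₀ r, dist (m z) ξ < ε / 2 := by
      intro z hz
      have h1 : ‖m z‖ < 1 := by
        rw [← mem_ball_zero_iff, ← hm]
        exact mem_image_of_mem m hz.1
      have h2 := norm_sub_sq_le_of_cap h1 hξ (h z hz.1 (by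
        have := hz.2
        rwa [mem_ball, dist_eq_norm] at this))
      rw [dist_eq_norm]
      have h3 : η ≤ ε ^ 2 / 16 := min_le_left _ _
      apply lt_of_pow_lt_pow_left₀ 2 (by positivity)
      nlinarith [sq_pos_of_pos hε]
    rintro _ ⟨z, hz, rfl⟩ _ ⟨w, hw, rfl⟩
    have h1 := key z hz
    have h2 := key w hw
    have := dist_triangle_right (m z) (m w) ξ
    linarith

theorem exists_extension_closedBall {m : ℂ → ℂ} (hc : ContinuousOn m (ball 0 1))
    (hi : InjOn m (ball 0 1)) (hm : m '' ball 0 1 = ball 0 1)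
    (hlim : ∀ w₀ : ℂ, ‖w₀‖ = 1 → ∃ y, Tendsto m (𝓝[ball 0 1] w₀) (𝓝 y)) :
    ∃ M : ℂ → ℂ, ContinuousOn M (closedBall 0 1) ∧ EqOn M m (ball 0 1) ∧
      MapsTo M (sphere 0 1) (sphere 0 1) ∧ M '' closedBall 0 1 = closedBall 0 1 := by
  have hall : ∀ w ∈ closedBall (0 : ℂ) 1, ∃ y, Tendsto m (𝓝[ball 0 1] w) (𝓝 y) := by
    intro w hw
    rcases (mem_closedBall_zero_iff.1 hw).lt_or_eq with h | h
    · exact ⟨m w, hc w (mem_ball_zero_iff.2 h)⟩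
    · exact hlim w h
  have hcl : closedBall (0 : ℂ) 1 ⊆ closure (ball 0 1) := by rw [closure_ball _ one_ne_zero]
  have hMc := continuousOn_extendFrom hcl hall
  set M := extendFrom (ball 0 1) m with hM
  have hMe : EqOn M m (ball 0 1) := fun z hz =>
    extendFrom_eq (subset_closure hz) (hc z hz)
  have hMn : ∀ w ∈ closedBall (0 : ℂ) 1, Tendsto m (𝓝[ball 0 1] w) (𝓝 (M w)) := fun w hw =>
    tendsto_extendFrom (hall w hw)
  have hMcl : MapsTo M (closedBall 0 1) (closedBall 0 1) := by
    intro w hw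
    have hne : (𝓝[ball 0 1] w).NeBot := mem_closure_iff_nhdsWithin_neBot.1 (hcl hw)
    refine isClosed_closedBall.mem_of_tendsto (hMn w hw) ?_
    filter_upwards [self_mem_nhdsWithin] with z hz
    exact ball_subset_closedBall (hm ▸ mem_image_of_mem m hz)
  refine ⟨M, hMc, hMe, ?_, ?_⟩
  · intro w hw
    have hwc := sphere_subset_closedBall hw
    have hne : (𝓝[ball 0 1] w).NeBot := mem_closure_iff_nhdsWithin_neBot.1 (hcl hwc)
    rw [mem_sphere_zero_iff_norm] at hw ⊢
    refine le_antisymm (mem_closedBall_zero_iff.1 (hMcl hwc)) ?_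
    by_contra hcon
    rw [not_le] at hcon
    obtain ⟨t, ht, htm⟩ := exists_radius_of_norm_le hc hi hm (s := (1 + ‖M w‖) / 2) (by linarith)
    have h1 : ∀ᶠ z in 𝓝[ball 0 1] w, ‖m z‖ < (1 + ‖M w‖) / 2 :=
      (hMn w hwc).norm.eventually_lt_const (by linarith)
    have h2 : ∀ᶠ z in 𝓝[ball 0 1] w, t < ‖z‖ := by
      refine Tendsto.eventually_const_lt (u := t) (v := ‖w‖) (by linarith) ?_
      exact continuous_norm.continuousAt.mono_left nhdsWithin_le_nhds
    obtain ⟨z, hz1, hz2, hz3⟩ := (h1.and (h2.and self_mem_nhdsWithin)).exists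
    exact absurd (htm z hz3 hz1.le) (not_lt.2 hz2.le)
  · refine Subset.antisymm hMcl.image_subset ?_
    have hcomp := ((isCompact_closedBall (0 : ℂ) 1).image_of_continuousOn hMc).isClosed
    rw [← closure_ball (0 : ℂ) one_ne_zero] at hcomp ⊢
    refine hcomp.closure_subset_iff.2 ?_
    intro y hy
    rw [← hm] at hy
    obtain ⟨z, hz, rfl⟩ := hy
    exact ⟨z, subset_closure hz, hMe hz⟩

end

section

open Metric

theorem isPreconnected_collar {ξ : ℂ} (hξ : ‖ξ‖ = 1) {c s : ℝ} (hs : 0 ≤ s) :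
    IsPreconnected {z : ℂ | (s < ‖z‖ ∧ ‖z‖ < 1) ∧ (z * (starRingEnd ℂ) ξ).re < c * ‖z‖} := by
  have hΦ : OrdConnected {φ : ℝ | (-Real.pi < φ ∧ φ ≤ Real.pi) ∧ -c < Real.cos φ} := by
    refine ⟨fun a ha b hb t ht => ⟨⟨ha.1.1.trans_le ht.1, ht.2.trans hb.1.2⟩, ?_⟩⟩
    rcases le_total 0 t with h | h
    · exact hb.2.trans_le (Real.cos_le_cos_of_nonneg_of_le_pi h hb.1.2 ht.2)
    · have := ha.2
      rw [← Real.cos_neg] at this ⊢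
      exact this.trans_le
        (Real.cos_le_cos_of_nonneg_of_le_pi (by linarith) (by linarith [ha.1.1])
          (by linarith [ht.1]))
  have hcont : Continuous fun p : ℝ × ℝ => -(p.1 : ℂ) * ξ * Complex.exp (p.2 * Complex.I) := by
    fun_prop
  have hξ2 : ξ * (starRingEnd ℂ) ξ = 1 := by
    rw [Complex.mul_conj, Complex.normSq_eq_norm_sq, hξ]; norm_num
  have hξ3 : (starRingEnd ℂ) ξ * ξ = 1 := by rw [mul_comm, hξ2]
  convert ((isPreconnected_Ioo (a := s) (b := 1)).prod hΦ.isPreconnected).image _ hcont.continuousOn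
    using 1
  ext z
  constructor
  · rintro ⟨⟨h1, h2⟩, h3⟩
    set u := -(z * (starRingEnd ℂ) ξ) with hu
    have hun : ‖u‖ = ‖z‖ := by rw [hu, norm_neg, norm_mul, Complex.norm_conj, hξ, mul_one]
    have hue := Complex.norm_mul_exp_arg_mul_I u
    have hre : ‖u‖ * Real.cos u.arg = u.re := Complex.norm_mul_cos_arg u
    refine ⟨(‖z‖, u.arg), ⟨⟨h1, h2⟩, ⟨Complex.neg_pi_lt_arg u, Complex.arg_le_pi u⟩, ?_⟩, ?_⟩
    · change -c < Real.cos u.arg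
      have h4 : u.re = -(z * (starRingEnd ℂ) ξ).re := by rw [hu, Complex.neg_re]
      rw [hun, h4] at hre
      have h0 : 0 < ‖z‖ := by linarith
      by_contra hcon
      rw [not_lt] at hcon
      nlinarith
    · change -(‖z‖ : ℂ) * ξ * Complex.exp (u.arg * Complex.I) = z
      rw [hun] at hue
      calc -(‖z‖ : ℂ) * ξ * Complex.exp (u.arg * Complex.I)
          = -ξ * ((‖z‖ : ℂ) * Complex.exp (u.arg * Complex.I)) := by ring
        _ = z := by rw [hue, hu]; linear_combination z * hξ3
  · rintro ⟨⟨ρ, φ⟩, ⟨⟨h1, h2⟩, -, h3⟩, rfl⟩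
    change s < ρ at h1
    change ρ < 1 at h2
    change -c < Real.cos φ at h3
    have h0 : 0 < ρ := by linarith
    have hn : ‖-(ρ : ℂ) * ξ * Complex.exp (φ * Complex.I)‖ = ρ := by
      rw [norm_mul, norm_mul, norm_neg, hξ, Complex.norm_exp_ofReal_mul_I, Complex.norm_real,
        Real.norm_of_nonneg h0.le]
      ring
    refine ⟨?_, ?_⟩
    · change s < ‖-(ρ : ℂ) * ξ * Complex.exp (φ * Complex.I)‖ ∧ _ < 1
      rw [hn]
      exact ⟨h1, h2⟩
    · change (-(ρ : ℂ) * ξ * Complex.exp (φ * Complex.I) * (starRingEnd ℂ) ξ).re <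
        c * ‖-(ρ : ℂ) * ξ * Complex.exp (φ * Complex.I)‖
      rw [hn, show -(ρ : ℂ) * ξ * Complex.exp (φ * Complex.I) * (starRingEnd ℂ) ξ =
        -(ρ * Complex.exp (φ * Complex.I)) by
          linear_combination (-(ρ : ℂ) * Complex.exp (φ * Complex.I)) * hξ2,
        Complex.neg_re, Complex.re_ofReal_mul, Complex.exp_ofReal_mul_I_re]
      nlinarith

theorem eq_endpoint_of_chord {a b z : ℂ} (hab : a ≠ b) (ha : ‖a‖ = 1) (hb : ‖b‖ = 1)
    (hz : ‖z‖ = 1) (h : ((z - a) * (starRingEnd ℂ) (b - a)).im = 0) : z = a ∨ z = b := by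
  have hs : ∀ u : ℂ, ‖u‖ = 1 → u * (starRingEnd ℂ) u = 1 := fun u hu => by
    rw [Complex.mul_conj, Complex.normSq_eq_norm_sq, hu]; norm_num
  have h1 : (z - a) * (starRingEnd ℂ) (b - a) = (starRingEnd ℂ) (z - a) * (b - a) := by
    have := Complex.conj_eq_iff_im.2 h
    rw [map_mul, Complex.conj_conj] at this
    exact this.symm
  simp only [map_sub] at h1
  have h2 : (z - a) * (b - z) * (b - a) = 0 := by
    have e1 := hs a ha
    have e2 := hs b hb
    have e3 := hs z hz
    set a' := (starRingEnd ℂ) a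
    set b' := (starRingEnd ℂ) b
    set z' := (starRingEnd ℂ) z
    have : a * b * z * ((z - a) * (b' - a') - (z' - a') * (b - a)) = 0 := by rw [h1]; ring
    linear_combination this - (a * z * (z - a)) * e2 + (b * z * (z - a)) * e1 +
      (a * b * (b - a)) * e3 - (b * z * (b - a)) * e1
  have hba : b - a ≠ 0 := sub_ne_zero.2 hab.symm
  rcases mul_eq_zero.1 ((mul_eq_zero.1 h2).resolve_right hba) with h | h
  · exact Or.inl (sub_eq_zero.1 h)
  · exact Or.inr (sub_eq_zero.1 h).symm

theorem re_mul_conj_lt_one {y ξ : ℂ} (hy : ‖y‖ = 1) (hξ : ‖ξ‖ = 1) (h : y ≠ ξ) :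
    (y * (starRingEnd ℂ) ξ).re < 1 := by
  have h0 : 0 < ‖y - ξ‖ ^ 2 := pow_pos (norm_pos_iff.2 (sub_ne_zero.2 h)) 2
  have h1 : Complex.normSq y = 1 := by rw [Complex.normSq_eq_norm_sq, hy]; norm_num
  have h2 : Complex.normSq ξ = 1 := by rw [Complex.normSq_eq_norm_sq, hξ]; norm_num
  rw [← Complex.normSq_eq_norm_sq] at h0
  simp only [Complex.normSq_apply, Complex.sub_re, Complex.sub_im, Complex.mul_re,
    Complex.conj_re, Complex.conj_im] at *
  nlinarith

theorem exists_chord_side {a b : ℂ} (hab : a ≠ b) (ha : ‖a‖ = 1) (hb : ‖b‖ = 1) {σ : ℝ}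
    (hσ : σ ^ 2 = 1) : ∃ w : ℂ, ‖w‖ = 1 ∧ 0 < σ * ((w - a) * (starRingEnd ℂ) (b - a)).im := by
  have hd : 0 < ‖b - a‖ := norm_pos_iff.2 (sub_ne_zero.2 hab.symm)
  have hσ1 : |σ| = 1 := by
    rw [← sq_eq_sq₀ (abs_nonneg _) zero_le_one, sq_abs, hσ, one_pow]
  refine ⟨σ * Complex.I * ((b - a) / ‖b - a‖), ?_, ?_⟩
  · rw [norm_mul, norm_mul, norm_div, Complex.norm_real, Complex.norm_real, norm_norm,
      div_self hd.ne', Complex.norm_I, Real.norm_eq_abs, hσ1]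
    norm_num
  · have e : (σ * Complex.I * ((b - a) / ‖b - a‖) - a) * (starRingEnd ℂ) (b - a) =
        (σ * ‖b - a‖ : ℝ) * Complex.I - a * (starRingEnd ℂ) (b - a) := by
      have h1 : (b - a) * (starRingEnd ℂ) (b - a) = ((‖b - a‖ ^ 2 : ℝ) : ℂ) := by
        rw [Complex.mul_conj, Complex.normSq_eq_norm_sq]
      have hne : (‖b - a‖ : ℂ) ≠ 0 := by exact_mod_cast hd.ne'
      rw [sub_mul, sub_left_inj]
      calc σ * Complex.I * ((b - a) / ‖b - a‖) * (starRingEnd ℂ) (b - a)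
          = σ * Complex.I * ((b - a) * (starRingEnd ℂ) (b - a)) / ‖b - a‖ := by ring
        _ = _ := by rw [h1]; push_cast; field_simp
    rw [e, Complex.sub_im, Complex.im_ofReal_mul, Complex.I_im, mul_one]
    set u := a * (starRingEnd ℂ) (b - a) with hu
    have hun : ‖u‖ = ‖b - a‖ := by rw [hu, norm_mul, ha, Complex.norm_conj, one_mul]
    have hure : u.re < 0 := by
      have h1 := re_mul_conj_lt_one ha hb hab
      have h2 : (a * (starRingEnd ℂ) a) = 1 := by
        rw [Complex.mul_conj, Complex.normSq_eq_norm_sq, ha]; norm_num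
      rw [hu, map_sub, mul_sub, h2, Complex.sub_re, Complex.one_re]
      linarith
    have h3 : u.re ^ 2 + u.im ^ 2 = ‖b - a‖ ^ 2 := by
      rw [← hun, ← Complex.normSq_eq_norm_sq, Complex.normSq_apply]; ring
    have h4 : |u.im| < ‖b - a‖ := by
      apply abs_lt_of_sq_lt_sq _ hd.le
      nlinarith
    have h5 : σ * u.im ≤ |u.im| := by
      calc σ * u.im ≤ |σ * u.im| := le_abs_self _
        _ = |u.im| := by rw [abs_mul, hσ1, one_mul]
    nlinarith

/-- A continuous extension to the closed disc of a homeomorphism of the open disc which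
identifies two boundary points is constant on a boundary arc. -/
theorem exists_constant_arc {M : ℂ → ℂ} (hMc : ContinuousOn M (closedBall 0 1))
    (hi : InjOn M (ball 0 1)) (hm : M '' ball 0 1 = ball 0 1)
    (hs : MapsTo M (sphere 0 1) (sphere 0 1)) {a b : ℂ} (hab : a ≠ b) (ha : ‖a‖ = 1)
    (hb : ‖b‖ = 1) (hM : M a = M b) :
    ∃ w, ‖w‖ = 1 ∧ ∃ ρ > 0, ∀ z, ‖z‖ = 1 → ‖z - w‖ < ρ → M z = M a := by
  set ξ := M a with hξdef
  have hn : ∀ z, ‖z‖ = 1 → ‖M z‖ = 1 := fun z hz => by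
    have := hs (mem_sphere_zero_iff_norm.2 hz)
    rwa [mem_sphere_zero_iff_norm] at this
  have hnb : ∀ z, ‖z‖ < 1 → ‖M z‖ < 1 := fun z hz => by
    rw [← mem_ball_zero_iff, ← hm]
    exact mem_image_of_mem M (mem_ball_zero_iff.2 hz)
  have hξ : ‖ξ‖ = 1 := hn a ha
  have hξ1 : (ξ * (starRingEnd ℂ) ξ).re = 1 := by
    rw [Complex.mul_conj, Complex.normSq_eq_norm_sq, hξ]; norm_num
  set l : ℂ → ℝ := fun z => ((z - a) * (starRingEnd ℂ) (b - a)).im with hl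
  have hlc : Continuous l := by
    rw [hl]
    exact Complex.continuous_im.comp ((continuous_id.sub continuous_const).mul continuous_const)
  suffices h : (∀ z, ‖z‖ = 1 → 0 < l z → M z = ξ) ∨ (∀ z, ‖z‖ = 1 → l z < 0 → M z = ξ) by
    rcases h with h | h
    · obtain ⟨w, hw, hlw⟩ := exists_chord_side hab ha hb (σ := 1) (by norm_num)
      rw [one_mul] at hlw
      obtain ⟨ρ, hρ, hρs⟩ := Metric.isOpen_iff.1 (isOpen_lt continuous_const hlc) w hlw
      exact ⟨w, hw, ρ, hρ, fun z hz hzw => h z hz (hρs (by rwa [mem_ball, dist_eq_norm]))⟩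
    · obtain ⟨w, hw, hlw⟩ := exists_chord_side hab ha hb (σ := -1) (by norm_num)
      have hlw' : l w < 0 := by
        change ((w - a) * (starRingEnd ℂ) (b - a)).im < 0
        linarith
      obtain ⟨ρ, hρ, hρs⟩ := Metric.isOpen_iff.1 (isOpen_lt hlc continuous_const) w hlw'
      exact ⟨w, hw, ρ, hρ, fun z hz hzw => h z hz (hρs (by rwa [mem_ball, dist_eq_norm]))⟩
  by_contra hcon
  push Not at hcon
  obtain ⟨⟨p, hp, hlp, hMp⟩, q, hq, hlq, hMq⟩ := hcon
  have hp1 := re_mul_conj_lt_one (hn p hp) hξ hMp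
  have hq1 := re_mul_conj_lt_one (hn q hq) hξ hMq
  obtain ⟨c, hc, hc1⟩ := exists_between (max_lt hp1 hq1)
  have hcp := (le_max_left _ _).trans_lt hc
  have hcq := (le_max_right _ _).trans_lt hc
  have hK : IsCompact {z ∈ closedBall (0 : ℂ) 1 | l z = 0 ∧
      (M z * (starRingEnd ℂ) ξ).re ≤ c * ‖M z‖} := by
    refine (isCompact_closedBall (0 : ℂ) 1).of_isClosed_subset ?_ (sep_subset _ _)
    have h1 : ContinuousOn (fun z => (M z * (starRingEnd ℂ) ξ).re - c * ‖M z‖)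
        (closedBall 0 1) :=
      (Complex.continuous_re.comp_continuousOn (hMc.mul continuousOn_const)).sub
        (continuousOn_const.mul hMc.norm)
    have h2 := (h1.preimage_isClosed_of_isClosed isClosed_closedBall (isClosed_Iic (a := 0))).inter
      (isClosed_singleton.preimage hlc (t := {0}))
    convert h2 using 1
    ext z
    simp only [mem_inter_iff, mem_preimage, mem_Iic, mem_singleton_iff, sub_nonpos, mem_ofPred_eq]
    tauto
  obtain ⟨s, hs0, hs1, hsK⟩ : ∃ s : ℝ, 0 ≤ s ∧ s < 1 ∧ ∀ z ∈ closedBall (0 : ℂ) 1, l z = 0 →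
      (M z * (starRingEnd ℂ) ξ).re ≤ c * ‖M z‖ → ‖M z‖ ≤ s := by
    rcases eq_empty_or_nonempty {z ∈ closedBall (0 : ℂ) 1 | l z = 0 ∧
      (M z * (starRingEnd ℂ) ξ).re ≤ c * ‖M z‖} with h | h
    · refine ⟨0, le_rfl, one_pos, fun z h1 h2 h3 => ?_⟩
      exact absurd (show z ∈ {z ∈ closedBall (0 : ℂ) 1 | l z = 0 ∧
        (M z * (starRingEnd ℂ) ξ).re ≤ c * ‖M z‖} from ⟨h1, h2, h3⟩) (by rw [h]; simp)
    · obtain ⟨z₀, ⟨h1, h2, h3⟩, hmax⟩ := hK.exists_isMaxOn h (hMc.norm.mono (sep_subset _ _))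
      refine ⟨‖M z₀‖, norm_nonneg _, ?_, fun z h4 h5 h6 => hmax ⟨h4, h5, h6⟩⟩
      rcases (mem_closedBall_zero_iff.1 h1).lt_or_eq with h4 | h4
      · exact hnb _ h4
      · exfalso
        have h5 : M z₀ = ξ := by
          rcases eq_endpoint_of_chord hab ha hb h4 h2 with h | h
          · rw [h]
          · rw [h, ← hM]
        rw [h5, hξ1, hξ, mul_one] at h3
        linarith
  have hC := isPreconnected_collar hξ (c := c) hs0
  have hS1 : IsOpen (ball (0 : ℂ) 1 ∩ {z | 0 < l z}) :=
    isOpen_ball.inter (isOpen_lt continuous_const hlc)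
  have hS2 : IsOpen (ball (0 : ℂ) 1 ∩ {z | l z < 0}) :=
    isOpen_ball.inter (isOpen_lt hlc continuous_const)
  have hbc := hMc.mono ball_subset_closedBall
  have hO1 := isOpen_image_of_injOn hS1 (hbc.mono inter_subset_left) (hi.mono inter_subset_left)
  have hO2 := isOpen_image_of_injOn hS2 (hbc.mono inter_subset_left) (hi.mono inter_subset_left)
  have hdisj : Disjoint (M '' (ball (0 : ℂ) 1 ∩ {z | 0 < l z}))
      (M '' (ball (0 : ℂ) 1 ∩ {z | l z < 0})) := by
    rw [Set.disjoint_left]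
    rintro _ ⟨z, hz, rfl⟩ ⟨w, hw, hwz⟩
    rw [hi hw.1 hz.1 hwz] at hw
    exact lt_asymm (show 0 < l z from hz.2) (show l z < 0 from hw.2)
  have hcov := hC.subset_or_subset hO1 hO2 hdisj (by
    rintro y ⟨⟨h1, h2⟩, h3⟩
    have hy : y ∈ M '' ball 0 1 := by rw [hm]; exact mem_ball_zero_iff.2 h2
    obtain ⟨z, hz, rfl⟩ := hy
    rcases lt_trichotomy (l z) 0 with h | h | h
    · exact Or.inr ⟨z, ⟨hz, h⟩, rfl⟩
    · exact absurd (hsK z (ball_subset_closedBall hz) h h3.le) (not_le.2 h1)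
    · exact Or.inl ⟨z, ⟨hz, h⟩, rfl⟩)
  have hnear : ∀ p, ‖p‖ = 1 → (M p * (starRingEnd ℂ) ξ).re < c → ∀ O : Set ℂ, IsOpen O → p ∈ O →
      ∃ z ∈ ball (0 : ℂ) 1, z ∈ O ∧
        M z ∈ {z : ℂ | (s < ‖z‖ ∧ ‖z‖ < 1) ∧ (z * (starRingEnd ℂ) ξ).re < c * ‖z‖} := by
    intro p hp hpc O hO hpO
    have hpcl : p ∈ closedBall (0 : ℂ) 1 := mem_closedBall_zero_iff.2 hp.le
    have hne : (𝓝[ball 0 1] p).NeBot := by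
      rw [← mem_closure_iff_nhdsWithin_neBot, closure_ball _ one_ne_zero]
      exact hpcl
    have ht : Tendsto M (𝓝[ball 0 1] p) (𝓝 (M p)) :=
      (hMc p hpcl).mono_left (nhdsWithin_mono _ ball_subset_closedBall)
    have h1 : ∀ᶠ z in 𝓝[ball 0 1] p, s < ‖M z‖ :=
      ht.norm.eventually_const_lt (by rw [hn p hp]; exact hs1)
    have h2 : ∀ᶠ z in 𝓝[ball 0 1] p, (M z * (starRingEnd ℂ) ξ).re - c * ‖M z‖ < 0 := by
      have h3 : Tendsto (fun z => (M z * (starRingEnd ℂ) ξ).re - c * ‖M z‖) (𝓝[ball 0 1] p)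
          (𝓝 ((M p * (starRingEnd ℂ) ξ).re - c * ‖M p‖)) :=
        ((Complex.continuous_re.tendsto _).comp (ht.mul_const _)).sub (ht.norm.const_mul c)
      exact h3.eventually_lt_const (by rw [hn p hp]; linarith)
    have h6 : ∀ᶠ z in 𝓝[ball 0 1] p, z ∈ O := nhdsWithin_le_nhds (hO.mem_nhds hpO)
    have h7 : ∀ᶠ z in 𝓝[ball 0 1] p, z ∈ ball (0 : ℂ) 1 := self_mem_nhdsWithin
    obtain ⟨z, h4, h5, h6, h7⟩ := (h1.and (h2.and (h6.and h7))).exists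
    exact ⟨z, h7, h6, ⟨h4, hnb z (mem_ball_zero_iff.1 h7)⟩, by linarith⟩
  obtain ⟨zp, hzp, hlzp, hCp⟩ := hnear p hp hcp _ (isOpen_lt continuous_const hlc) hlp
  obtain ⟨zq, hzq, hlzq, hCq⟩ := hnear q hq hcq _ (isOpen_lt hlc continuous_const) hlq
  rcases hcov with h | h
  · exact Set.disjoint_left.1 hdisj (h hCq) (mem_image_of_mem M ⟨hzq, hlzq⟩)
  · exact Set.disjoint_left.1 hdisj (mem_image_of_mem M ⟨hzp, hlzp⟩) (h hCp)

/-- A holomorphic function on the disc, continuous up to the boundary and constant on a boundary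
arc, takes that constant value at the centre. -/
theorem apply_zero_eq_of_constant_arc {f : ℂ → ℂ} (hf : DiffContOnCl ℂ f (ball 0 1)) {c w : ℂ}
    {ρ : ℝ} (hρ : 0 < ρ) (hw : ‖w‖ = 1) (h : ∀ z, ‖z‖ = 1 → ‖z - w‖ < ρ → f z = c) : f 0 = c := by
  obtain ⟨t, hts, htf, ht⟩ := (isCompact_sphere (0 : ℂ) 1).elim_finite_subcover_image
    (b := sphere (0 : ℂ) 1) (c := fun ζ => ball (w * ζ) ρ) (fun _ _ => isOpen_ball) (by
      intro z hz
      rw [mem_sphere_zero_iff_norm] at hz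
      have hw' : w * (starRingEnd ℂ) w = 1 := by
        rw [Complex.mul_conj, Complex.normSq_eq_norm_sq, hw]; norm_num
      refine mem_iUnion₂.2 ⟨z * (starRingEnd ℂ) w, ?_, ?_⟩
      · rw [mem_sphere_zero_iff_norm, norm_mul, Complex.norm_conj, hz, hw, one_mul]
      · have : w * (z * (starRingEnd ℂ) w) = z := by linear_combination z * hw'
        rw [this]
        exact mem_ball_self hρ)
  have hcball : DiffContOnCl ℂ (fun z => ∏ ζ ∈ htf.toFinset, (f ((starRingEnd ℂ) ζ * z) - c))
      (ball 0 1) := by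
    have key : ∀ ζ ∈ t, ∀ z : ℂ, ‖(starRingEnd ℂ) ζ * z‖ = ‖z‖ := by
      intro ζ hζ z
      rw [norm_mul, Complex.norm_conj, mem_sphere_zero_iff_norm.1 (hts hζ), one_mul]
    refine ⟨DifferentiableOn.fun_finsetProd fun ζ hζ => ?_, continuousOn_finsetProd _ fun ζ hζ => ?_⟩
    · refine (hf.differentiableOn.comp (differentiable_id.const_mul _).differentiableOn
        fun z hz => ?_).sub_const c
      rw [mem_ball_zero_iff] at hz ⊢
      exact (key ζ (htf.mem_toFinset.1 hζ) z).trans_lt hz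
    · refine (hf.continuousOn.comp (continuous_const.mul continuous_id).continuousOn
        fun z hz => ?_).sub continuousOn_const
      rw [closure_ball _ one_ne_zero, mem_closedBall_zero_iff] at hz ⊢
      exact (key ζ (htf.mem_toFinset.1 hζ) z).trans_le hz
  have h0 := Complex.norm_le_of_forall_mem_frontier_norm_le isBounded_ball hcball (C := 0) (by
    intro z hz
    rw [frontier_ball _ one_ne_zero] at hz
    obtain ⟨ζ, hζ, hzζ⟩ := mem_iUnion₂.1 (ht hz)
    rw [mem_sphere_zero_iff_norm] at hz
    have hζ1 := mem_sphere_zero_iff_norm.1 (hts hζ)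
    have hζζ : (starRingEnd ℂ) ζ * ζ = 1 := by
      rw [mul_comm, Complex.mul_conj, Complex.normSq_eq_norm_sq, hζ1]; norm_num
    rw [Finset.prod_eq_zero (htf.mem_toFinset.2 hζ), norm_zero]
    rw [h, sub_self]
    · rw [norm_mul, Complex.norm_conj, hζ1, hz, one_mul]
    · have h1 : (starRingEnd ℂ) ζ * z - w = (starRingEnd ℂ) ζ * (z - w * ζ) := by
        linear_combination w * hζζ
      rw [h1, norm_mul, Complex.norm_conj, hζ1, one_mul, ← dist_eq_norm]
      exact hzζ) (subset_closure (mem_ball_self one_pos))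
  have h1 := norm_le_zero_iff.1 h0
  obtain ⟨ζ, -, h2⟩ := Finset.prod_eq_zero_iff.1 h1
  rw [mul_zero] at h2
  exact sub_eq_zero.1 h2

end

section

open Metric

theorem exists_discHomeo {H : ℂ ≃ₜ ℂ} {ψ : ℂ → ℂ} (hd : DifferentiableOn ℂ ψ (ball 0 1))
    (hi : InjOn ψ (ball 0 1)) (hψ : ψ '' ball 0 1 = H '' ball 0 1) :
    ∃ M : ℂ → ℂ, ContinuousOn M (closedBall 0 1) ∧ InjOn M (closedBall 0 1) ∧
      M '' closedBall 0 1 = closedBall 0 1 ∧ MapsTo M (sphere 0 1) (sphere 0 1) ∧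
      MapsTo M (ball 0 1) (ball 0 1) ∧ ∀ z ∈ ball (0 : ℂ) 1, H (M z) = ψ z := by
  set m : ℂ → ℂ := fun z => H.symm (ψ z) with hmdef
  have hc : ContinuousOn m (ball 0 1) := H.symm.continuous.comp_continuousOn hd.continuousOn
  have hmi : InjOn m (ball 0 1) := fun z hz w hw h => hi hz hw (H.symm.injective h)
  have hm : m '' ball 0 1 = ball 0 1 := by
    have : m '' ball 0 1 = H.symm '' (ψ '' ball 0 1) := by rw [image_image]
    rw [this, hψ, image_image]
    simp
  have hu : UniformContinuousOn H.symm (H '' closedBall 0 1) :=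
    ((isCompact_closedBall _ _).image H.continuous).uniformContinuousOn_of_continuous
      H.symm.continuous.continuousOn
  have hψH : ∀ z ∈ ball (0 : ℂ) 1, ψ z ∈ H '' closedBall 0 1 := fun z hz =>
    image_mono ball_subset_closedBall (hψ ▸ mem_image_of_mem ψ hz)
  obtain ⟨M, hMc, hMm, hMs, hMcl⟩ := exists_extension_closedBall hc hmi hm fun w₀ hw₀ =>
    exists_boundary_limit hc hmi hm hw₀ fun ε hε b hb => by
      rw [Metric.uniformContinuousOn_iff] at hu
      obtain ⟨δ, hδ, hδε⟩ := hu ε hε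
      have hw' : w₀ * (starRingEnd ℂ) w₀ = 1 := by
        rw [Complex.mul_conj, Complex.normSq_eq_norm_sq, hw₀]; norm_num
      have hmaps : MapsTo (fun z => w₀ * (1 - z)) (ball 1 1) (ball 0 1) := fun z hz => by
        rw [mem_ball_zero_iff, norm_mul, hw₀, one_mul, ← dist_eq_norm, dist_comm]
        exact hz
      have hw0 : w₀ ≠ 0 := by rintro rfl; simp at hw₀
      obtain ⟨r, hr, hrr⟩ := exists_small_crosscut (φ := fun z => ψ (w₀ * (1 - z)))
        (hd.comp (by fun_prop) hmaps)
        (fun z hz w hw h => by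
          have := hi (hmaps hz) (hmaps hw) h
          have := mul_left_cancel₀ hw0 this
          linear_combination -this)
        (((isCompact_closedBall (0 : ℂ) 1).image H.continuous).isBounded.subset (by
          rintro _ ⟨z, hz, rfl⟩
          exact hψH _ (hmaps hz))) (half_pos hδ) hb
      have hb1 : ∀ z ∈ ball (0 : ℂ) 1, 1 - (starRingEnd ℂ) w₀ * z ∈ ball (1 : ℂ) 1 := by
        intro z hz
        rw [mem_ball, dist_eq_norm, sub_sub_cancel_left, norm_neg, norm_mul, Complex.norm_conj, hw₀,
          one_mul]
        exact mem_ball_zero_iff.1 hz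
      have hb2 : ∀ z : ℂ, ‖1 - (starRingEnd ℂ) w₀ * z‖ = ‖z - w₀‖ := by
        intro z
        have : 1 - (starRingEnd ℂ) w₀ * z = (starRingEnd ℂ) w₀ * (w₀ - z) := by
          linear_combination -hw'
        rw [this, norm_mul, Complex.norm_conj, hw₀, one_mul, norm_sub_rev]
      have hb3 : ∀ z : ℂ, w₀ * (1 - (1 - (starRingEnd ℂ) w₀ * z)) = z := by
        intro z
        linear_combination z * hw'
      refine ⟨r, hr, fun z hz w hw hzr hwr => ?_⟩
      have h1 := hrr _ (hb1 z hz) _ (hb1 w hw) (by rw [hb2, hzr]) (by rw [hb2, hwr])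
      simp only [hb3] at h1
      rw [← dist_eq_norm]
      exact (hδε _ (hψH z hz) _ (hψH w hw)
        (by rw [dist_eq_norm]; exact h1.trans_lt (half_lt_self hδ))).le
  have hMb : MapsTo M (ball 0 1) (ball 0 1) := fun z hz => by
    rw [hMm hz, ← hm]; exact mem_image_of_mem m hz
  have hHM : ∀ z ∈ ball (0 : ℂ) 1, H (M z) = ψ z := fun z hz => by
    rw [hMm hz, hmdef, H.apply_symm_apply]
  have hMi : InjOn M (ball 0 1) := fun z hz w hw h => by
    rw [hMm hz, hMm hw] at h; exact hmi hz hw h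
  have hMball : M '' ball 0 1 = ball 0 1 := by rw [hMm.image_eq, hm]
  refine ⟨M, hMc, ?_, hMcl, hMs, hMb, hHM⟩
  intro z hz w hw h
  have hn : ∀ {z : ℂ}, z ∈ closedBall (0 : ℂ) 1 → (z ∈ ball (0 : ℂ) 1 ↔ M z ∈ ball (0 : ℂ) 1) := by
    intro z hz
    refine ⟨fun h => hMb h, fun h => ?_⟩
    rcases (mem_closedBall_zero_iff.1 hz).lt_or_eq with h1 | h1
    · exact mem_ball_zero_iff.2 h1
    · have h2 := mem_sphere_zero_iff_norm.1 (hMs (mem_sphere_zero_iff_norm.2 h1))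
      have h3 := mem_ball_zero_iff.1 h
      linarith
  by_cases hzb : z ∈ ball (0 : ℂ) 1
  · exact hMi hzb ((hn hw).2 (h ▸ (hn hz).1 hzb)) h
  have hwb : w ∉ ball (0 : ℂ) 1 := fun hwb => hzb ((hn hz).2 (h ▸ (hn hw).1 hwb))
  have hz1 : ‖z‖ = 1 :=
    le_antisymm (mem_closedBall_zero_iff.1 hz) (not_lt.1 fun h => hzb (mem_ball_zero_iff.2 h))
  have hw1 : ‖w‖ = 1 :=
    le_antisymm (mem_closedBall_zero_iff.1 hw) (not_lt.1 fun h => hwb (mem_ball_zero_iff.2 h))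
  by_contra hzw
  obtain ⟨p, hp, ρ, hρ, hconst⟩ := exists_constant_arc hMc hMi hMball hMs hzw hz1 hw1 h
  have h0 : (0 : ℂ) ∈ ball (0 : ℂ) 1 := mem_ball_self one_pos
  have h1 : H (M 0) = H (M z) := by
    refine apply_zero_eq_of_constant_arc (f := fun z => H (M z)) ⟨?_, ?_⟩ hρ hp
      fun y hy hyp => by rw [hconst y hy hyp]
    · exact hd.congr hHM
    · rw [closure_ball _ one_ne_zero]
      exact H.continuous.comp_continuousOn hMc
  have h2 := H.injective h1
  exact hzb ((hn hz).2 (h2 ▸ hMb h0))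

/-- A simply connected domain, normalised: conformal parametrisation by the unit disc. -/
theorem exists_conformal_param {J : Set ℂ} (hJ : IsOpen J) (hJc : IsPreconnected J)
    (hJb : Bornology.IsBounded J)
    (hlog : ∀ g : ℂ → ℂ, ContinuousOn g J → (∀ z ∈ J, g z ≠ 0) →
      ∃ l : ℂ → ℂ, ContinuousOn l J ∧ ∀ z ∈ J, Complex.exp (l z) = g z) {a : ℂ} (ha : a ∈ J) :
    ∃ ψ : ℂ → ℂ, DifferentiableOn ℂ ψ (ball 0 1) ∧ InjOn ψ (ball 0 1) ∧ ψ '' ball 0 1 = J ∧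
      ψ 0 = a ∧ deriv ψ 0 ≠ 0 := by
  obtain ⟨f, hfd, hfi, hfU, hfa⟩ := exists_riemannMap hJ hJc hJb hlog ha
  set ψ := Function.invFunOn f J with hψ
  have hb : ∀ w ∈ ball (0 : ℂ) 1, ∃ z ∈ J, f z = w := fun w hw => by
    rw [← hfU] at hw; exact hw
  have hψJ : ∀ w ∈ ball (0 : ℂ) 1, ψ w ∈ J := fun w hw => Function.invFunOn_mem (hb w hw)
  have hfψ : ∀ w ∈ ball (0 : ℂ) 1, f (ψ w) = w := fun w hw => Function.invFunOn_eq (hb w hw)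
  have hψf : ∀ z ∈ J, ψ (f z) = z := fun z hz => hfi.leftInvOn_invFunOn hz
  have hψc : ContinuousOn ψ (ball 0 1) := by
    rw [continuousOn_open_iff isOpen_ball]
    intro V hV
    have : ball 0 1 ∩ ψ ⁻¹' V = f '' (J ∩ V) := by
      ext w
      constructor
      · rintro ⟨hw, hwV⟩
        exact ⟨ψ w, ⟨hψJ w hw, hwV⟩, hfψ w hw⟩
      · rintro ⟨z, ⟨hz, hzV⟩, rfl⟩
        refine ⟨hfU ▸ mem_image_of_mem f hz, ?_⟩
        rw [mem_preimage, hψf z hz]; exact hzV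
    rw [this]
    exact isOpen_image_of_injOn (hJ.inter hV) (hfd.continuousOn.mono inter_subset_left)
      (hfi.mono inter_subset_left)
  have hψ0 : ψ 0 = a := by rw [← hfa]; exact hψf a ha
  have hψi : InjOn ψ (ball 0 1) := fun z hz w hw h => by rw [← hfψ z hz, h, hfψ w hw]
  have hderiv : ∀ w ∈ ball (0 : ℂ) 1, deriv f (ψ w) ≠ 0 → DifferentiableAt ℂ ψ w := by
    intro w hw h0
    exact (HasDerivAt.of_local_left_inverse (hψc.continuousAt (isOpen_ball.mem_nhds hw))
      ((hfd.differentiableAt (hJ.mem_nhds (hψJ w hw))).hasDerivAt) h0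
      (Filter.eventually_of_mem (isOpen_ball.mem_nhds hw) hfψ)).differentiableAt
  have han : AnalyticOnNhd ℂ (deriv f) J := (hfd.analyticOnNhd hJ).deriv
  have hiso : ∀ z ∈ J, ∀ᶠ y in 𝓝[≠] z, deriv f y ≠ 0 := by
    intro z hz
    rcases (han z hz).eventually_eq_zero_or_eventually_ne_zero with h | h
    · exfalso
      obtain ⟨ε, hε, hball⟩ := Metric.eventually_nhds_iff_ball.1 (h.and (hJ.eventually_mem hz))
      have hconst : ∀ y ∈ ball z ε, f y = f z := fun y hy => by
        refine (convex_ball z ε).is_const_of_fderivWithin_eq_zero (𝕜 := ℂ) (f := f)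
          (hfd.mono fun y hy => (hball y hy).2) (fun y hy => ?_) hy (mem_ball_self hε)
        rw [fderivWithin_of_isOpen isOpen_ball hy]
        ext
        simpa using (hball y hy).1
      have h1 : z + (ε / 2 : ℝ) ∈ ball z ε := by
        rw [mem_ball, dist_eq_norm, add_sub_cancel_left, Complex.norm_real, Real.norm_eq_abs,
          abs_of_pos (by positivity)]
        linarith
      have h2 := hfi (hball _ h1).2 hz (hconst _ h1)
      have h3 : ((ε / 2 : ℝ) : ℂ) = 0 := by simpa using h2
      rw [Complex.ofReal_eq_zero] at h3
      linarith
    · exact h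
  have hdiff : DifferentiableOn ℂ ψ (ball 0 1) := by
    intro w hw
    have hcw := hψc.continuousAt (isOpen_ball.mem_nhds hw)
    have ht : Tendsto ψ (𝓝[≠] w) (𝓝[≠] (ψ w)) := by
      refine tendsto_nhdsWithin_iff.2 ⟨hcw.tendsto.mono_left nhdsWithin_le_nhds, ?_⟩
      filter_upwards [nhdsWithin_le_nhds (isOpen_ball.mem_nhds hw), self_mem_nhdsWithin]
        with y hy hyw h
      exact hyw (hψi hy hw h)
    have h1 : ∀ᶠ y in 𝓝[≠] w, deriv f (ψ y) ≠ 0 := ht.eventually (hiso _ (hψJ w hw))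
    have h2 : ∀ᶠ y in 𝓝[≠] w, DifferentiableAt ℂ ψ y := by
      filter_upwards [h1, nhdsWithin_le_nhds (isOpen_ball.mem_nhds hw)] with y h3 h4
      exact hderiv y h4 h3
    exact (Complex.analyticAt_of_differentiable_on_punctured_nhds_of_continuousAt h2
      hcw).differentiableAt.differentiableWithinAt
  refine ⟨ψ, hdiff, hψi, ?_, hψ0, fun h0 => ?_⟩
  · apply Subset.antisymm
    · rintro _ ⟨w, hw, rfl⟩; exact hψJ w hw
    · intro z hz
      exact ⟨f z, hfU ▸ mem_image_of_mem f hz, hψf z hz⟩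
  · have h00 : (0 : ℂ) ∈ ball (0 : ℂ) 1 := mem_ball_self one_pos
    have h1 := (hfd.differentiableAt (hJ.mem_nhds (hψJ 0 h00))).hasDerivAt.comp (0 : ℂ)
      (hdiff.differentiableAt (isOpen_ball.mem_nhds h00)).hasDerivAt
    have h2 : HasDerivAt (f ∘ ψ) 1 0 :=
      (hasDerivAt_id (0 : ℂ)).congr_of_eventuallyEq
        (Filter.eventually_of_mem (isOpen_ball.mem_nhds h00) hfψ)
    have := h1.unique h2
    rw [h0, mul_zero] at this
    exact zero_ne_one this

end

section

open Metric

theorem exists_homeomorph_of_norm_eq {f : ℂ → ℂ} (hc : Continuous f) (hi : Function.Injective f)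
    {R : ℝ} (hn : ∀ z, R ≤ ‖z‖ → ‖f z‖ = ‖z‖) : ∃ F : ℂ ≃ₜ ℂ, ⇑F = f := by
  have hp : Tendsto f (cocompact ℂ) (cocompact ℂ) := by
    rw [← Metric.cobounded_eq_cocompact, ← tendsto_norm_atTop_iff_cobounded]
    refine tendsto_norm_cobounded_atTop.congr' ?_
    filter_upwards [tendsto_norm_cobounded_atTop.eventually_ge_atTop R] with z hz
    exact (hn z hz).symm
  have hopen : IsOpenMap f := fun U hU => isOpen_image_of_injOn hU hc.continuousOn hi.injOn
  have hclosed : IsClosed (range f) :=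
    (isProperMap_iff_tendsto_cocompact.2 ⟨hc, hp⟩).isClosedMap.isClosed_range
  have hsurj : Function.Surjective f := by
    rw [← range_eq_univ]
    exact IsClopen.eq_univ ⟨hclosed, hopen.isOpen_range⟩ (range_nonempty f)
  exact ⟨(Equiv.ofBijective f ⟨hi, hsurj⟩).toHomeomorphOfContinuousOpen hc hopen, rfl⟩

theorem strictMono_angle {K : ℂ → ℝ} (hK : ContinuousOn K (sphere 0 1))
    (hi : InjOn (fun w => w * Complex.exp (K w * Complex.I)) (sphere 0 1)) :
    StrictMono fun t : ℝ => t + K (Complex.exp (t * Complex.I)) := by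
  have hsph : ∀ t : ℝ, Complex.exp (t * Complex.I) ∈ sphere (0 : ℂ) 1 := fun t => by
    rw [mem_sphere_zero_iff_norm, Complex.norm_exp_ofReal_mul_I]
  have hper : ∀ (t : ℝ) (n : ℤ), Complex.exp ((t + n * (2 * Real.pi) : ℝ) * Complex.I) =
      Complex.exp (t * Complex.I) := fun t n => by
    rw [Complex.exp_eq_exp_iff_exists_int]
    exact ⟨n, by push_cast; ring⟩
  have hc : Continuous fun t : ℝ => t + K (Complex.exp (t * Complex.I)) :=
    continuous_id.add (hK.comp_continuous (by fun_prop) hsph)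
  have hinj : Function.Injective fun t : ℝ => t + K (Complex.exp (t * Complex.I)) := by
    intro s t hst
    simp only at hst
    have h1 := hi (hsph s) (hsph t) (by
      simp only [← Complex.exp_add]
      congr 1
      have : (s : ℂ) + K (Complex.exp (s * Complex.I)) = t + K (Complex.exp (t * Complex.I)) := by
        exact_mod_cast hst
      linear_combination Complex.I * this)
    rw [h1] at hst
    linarith
  rcases hc.strictMono_of_inj hinj with h | h
  · exact h
  · exfalso
    have h1 := h (show (0 : ℝ) < 0 + (1 : ℤ) * (2 * Real.pi) by push_cast; linarith [Real.pi_pos])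
    simp only [hper] at h1
    push_cast at h1
    linarith [Real.pi_pos]

theorem exists_twist {K : ℂ → ℝ} (hK : ContinuousOn K (sphere 0 1))
    (hi : InjOn (fun w => w * Complex.exp (K w * Complex.I)) (sphere 0 1)) :
    ∃ F : ℂ ≃ₜ ℂ, (∀ z, ‖F z‖ = ‖z‖) ∧ (∀ z, ‖z‖ ≤ 1 / 2 → F z = z) ∧
      ∀ z, ‖z‖ = 1 → F z = z * Complex.exp (K z * Complex.I) := by
  have hmono := strictMono_angle hK hi
  set χ : ℝ → ℝ := fun s => max 0 (min 1 (2 * s - 1)) with hχ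
  have hχc : Continuous χ := by fun_prop
  have hχ0 : ∀ s, 0 ≤ χ s := fun s => le_max_left _ _
  have hχ1 : ∀ s, χ s ≤ 1 := fun s => max_le zero_le_one (min_le_left _ _)
  have hχs : ∀ s, s ≤ 1 / 2 → χ s = 0 := fun s hs =>
    max_eq_left ((min_le_right _ _).trans (by linarith))
  set f : ℂ → ℂ := fun z => z * Complex.exp ((χ ‖z‖ * K (z / ‖z‖) : ℝ) * Complex.I) with hf
  have hfn : ∀ z, ‖f z‖ = ‖z‖ := fun z => by
    rw [hf, norm_mul, Complex.norm_exp_ofReal_mul_I, mul_one]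
  have hf0 : ∀ z, ‖z‖ ≤ 1 / 2 → f z = z := fun z hz => by
    simp [hf, hχs _ hz]
  have hf1 : ∀ z, ‖z‖ = 1 → f z = z * Complex.exp (K z * Complex.I) := fun z hz => by
    have : χ 1 = 1 := by norm_num [hχ]
    simp [hf, hz, this]
  have hfc : Continuous f := by
    rw [continuous_iff_continuousAt]
    intro z
    by_cases hz : z = 0
    · have h1 : ∀ᶠ w in 𝓝 z, w = f w := by
        filter_upwards [ball_mem_nhds z (show (0 : ℝ) < 1 / 2 by norm_num)] with w hw
        rw [hz, mem_ball_zero_iff] at hw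
        exact (hf0 w hw.le).symm
      exact continuousAt_id.congr h1
    · have hdiv : ContinuousAt (fun w : ℂ => w / (‖w‖ : ℂ)) z :=
        continuousAt_id.div (by fun_prop) (by simpa using hz)
      have hKz : ContinuousAt (fun w : ℂ => K (w / (‖w‖ : ℂ))) z := by
        have hmem : ∀ w : ℂ, w ≠ 0 → w / (‖w‖ : ℂ) ∈ sphere (0 : ℂ) 1 := fun w hw => by
          rw [mem_sphere_zero_iff_norm, norm_div, Complex.norm_real, norm_norm, div_self]
          exact norm_ne_zero_iff.2 hw
        have := (hK _ (hmem z hz)).tendsto.comp (tendsto_nhdsWithin_iff.2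
          ⟨hdiv.tendsto, (eventually_ne_nhds hz).mono hmem⟩)
        exact this
      have h2 : ContinuousAt (fun w : ℂ => χ ‖w‖ * K (w / (‖w‖ : ℂ))) z :=
        (hχc.comp continuous_norm).continuousAt.mul hKz
      exact continuousAt_id.mul (Complex.continuous_exp.continuousAt.comp
        ((Complex.continuous_ofReal.continuousAt.comp h2).mul continuousAt_const))
  have hfi : Function.Injective f := by
    intro z w hzw
    have hn : ‖z‖ = ‖w‖ := by rw [← hfn z, hzw, hfn w]
    by_cases hz : z = 0
    · rw [hz, norm_zero] at hn
      rw [hz, norm_eq_zero.1 hn.symm]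
    have hz0 : (‖z‖ : ℂ) ≠ 0 := by simpa using hz
    have hpol : ∀ u : ℂ, u ≠ 0 → u / (‖u‖ : ℂ) = Complex.exp (u.arg * Complex.I) := fun u hu => by
      have h0 : (‖u‖ : ℂ) ≠ 0 := by simpa using hu
      rw [div_eq_iff h0, mul_comm, Complex.norm_mul_exp_arg_mul_I]
    have hw : w ≠ 0 := by
      rintro rfl; rw [norm_zero, norm_eq_zero] at hn; exact hz hn
    have hzp := Complex.norm_mul_exp_arg_mul_I z
    have hwp := Complex.norm_mul_exp_arg_mul_I w
    set s := χ ‖z‖ with hs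
    simp only [hf] at hzw
    rw [← hn, hpol z hz] at hzw
    rw [show w / (‖z‖ : ℂ) = w / (‖w‖ : ℂ) by rw [hn], hpol w hw] at hzw
    rw [← hs] at hzw
    set a := z.arg
    set b := w.arg
    rw [← hzp, ← hwp, ← hn, mul_assoc, mul_assoc] at hzw
    have h3 := mul_left_cancel₀ hz0 hzw
    rw [← Complex.exp_add, ← Complex.exp_add, Complex.exp_eq_exp_iff_exists_int] at h3
    obtain ⟨n, h3⟩ := h3
    have h4 : (a + s * K (Complex.exp (a * Complex.I)) : ℝ) =
        b + n * (2 * Real.pi) + s * K (Complex.exp (b * Complex.I)) := by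
      have : ((a + s * K (Complex.exp (a * Complex.I)) : ℝ) : ℂ) =
          ((b + n * (2 * Real.pi) + s * K (Complex.exp (b * Complex.I)) : ℝ) : ℂ) := by
        push_cast at h3 ⊢
        linear_combination (-Complex.I) * h3 +
          ((a : ℂ) + s * K (Complex.exp (a * Complex.I)) - b -
            s * K (Complex.exp (b * Complex.I)) - n * (2 * Real.pi)) * Complex.I_sq
      exact_mod_cast this
    have hper : Complex.exp ((b + n * (2 * Real.pi) : ℝ) * Complex.I) =
        Complex.exp (b * Complex.I) := by
      rw [Complex.exp_eq_exp_iff_exists_int]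
      exact ⟨n, by push_cast; ring⟩
    have hmono' : StrictMono fun t : ℝ => t + s * K (Complex.exp (t * Complex.I)) := by
      intro u v huv
      have h5 := hmono huv
      simp only at h5 ⊢
      rcases (hχ0 ‖z‖).eq_or_lt with h6 | h6
      · rw [hs, ← h6]; linarith
      · nlinarith [hχ1 ‖z‖]
    have h5 : a = b + n * (2 * Real.pi) := by
      apply hmono'.injective
      simp only
      rw [hper, h4]
    rw [← hzp, ← hwp, ← hn, ← hper, ← h5]
  obtain ⟨F, hF⟩ := exists_homeomorph_of_norm_eq (R := 0) hfc hfi fun z _ => hfn z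
  exact ⟨F, by rwa [hF], by rwa [hF], by rwa [hF]⟩

/-- A map with a nonzero derivative can be straightened near the origin by a homeomorphism supported
in an arbitrarily small disc. -/
theorem exists_straightening {ψ : ℂ → ℂ} {lam : ℂ} (hψ : HasStrictDerivAt ψ lam 0) (h0 : lam ≠ 0)
    {η : ℝ} (hη : 0 < η) :
    ∃ k : ℂ ≃ₜ ℂ, (∀ z, η ≤ ‖z‖ → k z = z) ∧ k 0 = 0 ∧
      ∀ᶠ z in 𝓝 0, ψ (k z) = ψ 0 + lam * z := by
  have hl : 0 < ‖lam‖ := norm_pos_iff.2 h0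
  set ε := ‖lam‖ / 8 with hε
  have hε0 : 0 < ε := by positivity
  have h1 := hψ.hasStrictFDerivAt.isLittleO.def hε0
  rw [Metric.eventually_nhds_iff_ball] at h1
  obtain ⟨δ₀, hδ₀, hball⟩ := h1
  set δ := min δ₀ η / 2 with hδ
  have hδ0 : 0 < δ := by positivity
  have hδ1 : 2 * δ ≤ δ₀ := by rw [hδ]; linarith [min_le_left δ₀ η]
  have hδ2 : 2 * δ ≤ η := by rw [hδ]; linarith [min_le_right δ₀ η]
  set q : ℂ → ℂ := fun z => ψ z - ψ 0 - lam * z with hq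
  have hqL : ∀ z w : ℂ, ‖z‖ < 2 * δ → ‖w‖ < 2 * δ → ‖q z - q w‖ ≤ ε * ‖z - w‖ := by
    intro z w hz hw
    have := hball (z, w) (by
      rw [← ball_prod_same]
      exact ⟨mem_ball_zero_iff.2 (hz.trans_le hδ1), mem_ball_zero_iff.2 (hw.trans_le hδ1)⟩)
    simp only [ContinuousLinearMap.toSpanSingleton_apply, smul_eq_mul] at this
    refine le_trans (le_of_eq ?_) this
    congr 1
    simp only [hq]; ring
  have hq0 : q 0 = 0 := by simp [hq]
  have hqb : ∀ z : ℂ, ‖z‖ < 2 * δ → ‖q z‖ ≤ 2 * ε * δ := by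
    intro z hz
    have := hqL z 0 hz (by simpa using hδ0)
    rw [hq0, sub_zero, sub_zero] at this
    nlinarith
  set χ : ℂ → ℝ := fun z => max 0 (min 1 (2 - ‖z‖ / δ)) with hχ
  have hχ0 : ∀ z, 0 ≤ χ z := fun s => le_max_left _ _
  have hχ1 : ∀ z, χ z ≤ 1 := fun s => max_le zero_le_one (min_le_left _ _)
  have hχout : ∀ z, 2 * δ ≤ ‖z‖ → χ z = 0 := fun z hz => by
    refine max_eq_left ((min_le_right _ _).trans ?_)
    rw [sub_nonpos, le_div_iff₀ hδ0]; exact hz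
  have hχin : ∀ z, ‖z‖ ≤ δ → χ z = 1 := fun z hz => by
    have : ‖z‖ / δ ≤ 1 := (div_le_one hδ0).2 hz
    simp only [hχ]
    rw [min_eq_left (by linarith), max_eq_right zero_le_one]
  have hχL : ∀ z w, |χ z - χ w| ≤ ‖z - w‖ / δ := by
    intro z w
    have h2 : |χ z - χ w| ≤ |‖z‖ / δ - ‖w‖ / δ| := by
      have a1 := abs_max_sub_max_le_max 0 (min 1 (2 - ‖z‖ / δ)) 0 (min 1 (2 - ‖w‖ / δ))
      have e0 : ∀ c d : ℝ, max |c - c| |d| = |d| := fun c d => by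
        rw [sub_self, abs_zero, max_eq_right (abs_nonneg d)]
      rw [e0] at a1
      have a2 := abs_min_sub_min_le_max 1 (2 - ‖z‖ / δ) 1 (2 - ‖w‖ / δ)
      rw [e0] at a2
      refine (a1.trans a2).trans (le_of_eq ?_)
      rw [abs_sub_comm]; congr 1; ring
    refine h2.trans ?_
    rw [← sub_div, abs_div, abs_of_pos hδ0]
    gcongr
    exact abs_norm_sub_norm_le z w
  have hmix : ∀ z w : ℂ, ‖z‖ < 2 * δ → ‖χ z * q z - χ w * q w‖ ≤ 3 * ε * ‖z - w‖ := by
    intro z w hz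
    have hA : ‖((χ z - χ w : ℝ) : ℂ) * q z‖ ≤ 2 * ε * ‖z - w‖ := by
      rw [norm_mul, Complex.norm_real, Real.norm_eq_abs]
      calc |χ z - χ w| * ‖q z‖ ≤ ‖z - w‖ / δ * (2 * ε * δ) :=
            mul_le_mul (hχL z w) (hqb z hz) (norm_nonneg _) (by positivity)
        _ = 2 * ε * ‖z - w‖ := by field_simp
    rcases lt_or_ge ‖w‖ (2 * δ) with hw | hw
    · have hB : ‖((χ w : ℝ) : ℂ) * (q z - q w)‖ ≤ ε * ‖z - w‖ := by
        rw [norm_mul, Complex.norm_real, Real.norm_eq_abs, abs_of_nonneg (hχ0 w)]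
        calc χ w * ‖q z - q w‖ ≤ 1 * (ε * ‖z - w‖) :=
              mul_le_mul (hχ1 w) (hqL z w hz hw) (norm_nonneg _) zero_le_one
          _ = _ := one_mul _
      have : (χ z : ℂ) * q z - χ w * q w =
          ((χ z - χ w : ℝ) : ℂ) * q z + ((χ w : ℝ) : ℂ) * (q z - q w) := by push_cast; ring
      rw [this]
      exact (norm_add_le _ _).trans (by linarith)
    · have h3 := hχout w hw
      have : (χ z : ℂ) * q z - χ w * q w = ((χ z - χ w : ℝ) : ℂ) * q z := by
        rw [h3]; push_cast; ring
      rw [this]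
      refine hA.trans ?_
      have := norm_nonneg (z - w)
      nlinarith
  have hLip : ∀ z w : ℂ, ‖χ z * q z - χ w * q w‖ ≤ 3 * ε * ‖z - w‖ := by
    intro z w
    rcases lt_or_ge ‖z‖ (2 * δ) with hz | hz
    · exact hmix z w hz
    rcases lt_or_ge ‖w‖ (2 * δ) with hw | hw
    · rw [norm_sub_rev, norm_sub_rev z]
      exact hmix w z hw
    · rw [hχout z hz, hχout w hw]
      simp only [Complex.ofReal_zero, zero_mul, sub_zero, norm_zero]
      positivity
  set G : ℂ → ℂ := fun z => z + lam⁻¹ * (χ z * q z) with hG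
  have hGdist : ∀ z w, ‖z - w‖ / 2 ≤ ‖G z - G w‖ := by
    intro z w
    have h2 : G z - G w = (z - w) + lam⁻¹ * (χ z * q z - χ w * q w) := by simp only [hG]; ring
    have h3 : ‖lam⁻¹ * (χ z * q z - χ w * q w)‖ ≤ ‖z - w‖ / 2 := by
      rw [norm_mul, norm_inv]
      calc ‖lam‖⁻¹ * ‖χ z * q z - χ w * q w‖ ≤ ‖lam‖⁻¹ * (3 * ε * ‖z - w‖) := by
            gcongr; exact hLip z w
        _ = 3 / 8 * ‖z - w‖ := by rw [hε]; field_simp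
        _ ≤ _ := by linarith [norm_nonneg (z - w)]
    rw [h2]
    have := norm_sub_le_norm_add (z - w) (lam⁻¹ * (χ z * q z - χ w * q w))
    linarith
  have hGc : Continuous G := by
    have : LipschitzWith (Real.toNNReal (3 * ε)) fun z => (χ z : ℂ) * q z :=
      LipschitzWith.of_dist_le_mul fun z w => by
        rw [dist_eq_norm, dist_eq_norm, Real.coe_toNNReal _ (by positivity)]
        exact hLip z w
    exact continuous_id.add (continuous_const.mul this.continuous)
  have hGi : Function.Injective G := by
    intro z w h
    have := hGdist z w
    rw [h, sub_self, norm_zero] at this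
    exact sub_eq_zero.1 (norm_le_zero_iff.1 (by linarith))
  have hGout : ∀ z, 2 * δ ≤ ‖z‖ → G z = z := fun z hz => by simp [hG, hχout z hz]
  obtain ⟨F, hF⟩ := exists_homeomorph_of_norm_eq (R := 2 * δ) hGc hGi fun z hz => by rw [hGout z hz]
  have hsymm : ∀ z, G z = z → F.symm z = z := fun z hz => by
    rw [Homeomorph.symm_apply_eq, hF, hz]
  have h00 : F.symm 0 = 0 := hsymm 0 (by simp [hG, hq0])
  refine ⟨F.symm, fun z hz => hsymm z (hGout z (hδ2.trans hz)), h00, ?_⟩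
  have hev : ∀ᶠ z in 𝓝 0, ‖F.symm z‖ < δ := by
    have : ContinuousAt (fun z => ‖F.symm z‖) 0 := by fun_prop
    exact this.eventually_lt_const (by simpa only [h00, norm_zero] using hδ0)
  filter_upwards [hev] with z hz
  have h2 : G (F.symm z) = z := by rw [← hF, F.apply_symm_apply]
  simp only [hG, hq, hχin _ hz.le] at h2
  generalize F.symm z = u at *
  rw [← h2]
  push_cast
  field_simp
  ring

end

section

open Metric

/-- After composition with a homeomorphism supported near `h x`, the map `h` is a complex similarity
near `x`. -/
theorem SlopeLog.exists_linearization {h : ℂ ≃ₜ ℂ} (S : SlopeLog h) (x : ℂ) {ε : ℝ} (hε : 0 < ε) :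
    ∃ (g : ℂ ≃ₜ ℂ) (μ : ℂ), μ ≠ 0 ∧ (∀ z, ε ≤ ‖z - h x‖ → g z = z) ∧
      ∀ᶠ z in 𝓝 x, g (h z) = h x + μ * (z - x) := by
  obtain ⟨δ, hδ, hδε⟩ := Metric.continuousAt_iff.1 (h.continuous.continuousAt (x := x)) ε hε
  set r : ℝ := δ / 2 with hr
  have hr0 : 0 < r := by positivity
  have hrC : (r : ℂ) ≠ 0 := Complex.ofReal_ne_zero.2 hr0.ne'
  set H : ℂ ≃ₜ ℂ := (Homeomorph.mulLeft₀ (r : ℂ) hrC).trans ((Homeomorph.addLeft x).trans h)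
    with hHdef
  have hH : ∀ z, H z = h (x + r * z) := fun z => rfl
  have hHsymm : ∀ z, H.symm (h z) = (z - x) / r := fun z => by
    rw [Homeomorph.symm_apply_eq, hH]
    congr 1
    field_simp
    ring
  have hH0 : H 0 = h x := by rw [hH, mul_zero, add_zero]
  have hJo : IsOpen (H '' ball 0 1) := H.isOpenMap _ isOpen_ball
  have hJc : IsPreconnected (H '' ball 0 1) :=
    (convex_ball (0 : ℂ) 1).isPreconnected.image _ H.continuous.continuousOn
  have hJb : Bornology.IsBounded (H '' ball 0 1) :=
    ((isCompact_closedBall (0 : ℂ) 1).image H.continuous).isBounded.subset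
      (image_mono ball_subset_closedBall)
  have h0b : (0 : ℂ) ∈ ball (0 : ℂ) 1 := mem_ball_self one_pos
  obtain ⟨ψ, hψd, hψi, hψJ, hψ0, hψ'⟩ := exists_conformal_param hJo hJc hJb (by
    intro g hg hg0
    obtain ⟨l, hl, hle⟩ := exists_log_of_starConvex ((convex_ball (0 : ℂ) 1).starConvex h0b) h0b
      (f := fun z => g (H z)) (hg.comp H.continuous.continuousOn (mapsTo_image _ _))
      (fun z hz => hg0 _ (mem_image_of_mem _ hz))
    refine ⟨fun z => l (H.symm z), hl.comp H.symm.continuous.continuousOn ?_, ?_⟩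
    · rintro _ ⟨z, hz, rfl⟩
      rwa [H.symm_apply_apply]
    · rintro _ ⟨z, hz, rfl⟩
      simp only [H.symm_apply_apply]
      exact hle z hz) (mem_image_of_mem H h0b)
  obtain ⟨M, hMc, hMi, hMcl, hMs, hMb, hHM⟩ := exists_discHomeo hψd hψi hψJ
  have hM0 : M 0 = 0 := H.injective (by rw [hHM 0 h0b, hψ0])
  have hclM : MapsTo M (closedBall 0 1) (closedBall 0 1) := fun z hz =>
    hMcl ▸ mem_image_of_mem M hz
  have hevψ : (fun z => H (M z)) =ᶠ[𝓝 0] ψ := eventually_of_mem (isOpen_ball.mem_nhds h0b) hHM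
  have hψan : AnalyticAt ℂ ψ 0 := hψd.analyticAt (isOpen_ball.mem_nhds h0b)
  set lam := deriv ψ 0 with hlam
  have h0cl : (0 : ℂ) ∈ closedBall (0 : ℂ) 1 := ball_subset_closedBall h0b
  obtain ⟨L, hLc, hL⟩ := exists_log_of_starConvex ((convex_closedBall (0 : ℂ) 1).starConvex h0cl)
    h0cl (f := dslope (fun z => H (M z)) 0)
    ((continuousOn_dslope (closedBall_mem_nhds _ one_pos)).2
      ⟨H.continuous.comp_continuousOn hMc, hψan.differentiableAt.congr_of_eventuallyEq hevψ⟩) (by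
      intro w hw
      by_cases hw0 : w = 0
      · rw [hw0, dslope_same, hevψ.deriv_eq]
        exact hψ'
      · rw [dslope_of_ne _ hw0, slope_def_field]
        refine div_ne_zero (sub_ne_zero.2 fun he => hw0 ?_) (sub_ne_zero.2 hw0)
        exact hMi hw h0cl (H.injective he))
  set N : ℂ → ℂ := fun w => L w - S.τ (x + r * M w, x) - Real.log r with hN
  have hMne : ∀ w ∈ sphere (0 : ℂ) 1, x + r * M w ≠ x := by
    intro w hw he
    have h1 : (r : ℂ) * M w = 0 := by simpa using he
    have h2 := mem_sphere_zero_iff_norm.1 (hMs hw)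
    rw [(mul_eq_zero.1 h1).resolve_left hrC, norm_zero] at h2
    exact zero_ne_one h2
  have hNc : ContinuousOn N (sphere 0 1) := by
    refine ((hLc.mono sphere_subset_closedBall).sub ?_).sub continuousOn_const
    have h1 : ContinuousOn (fun w => (x + r * M w, x)) (sphere (0 : ℂ) 1) :=
      (continuousOn_const.add (continuousOn_const.mul
        (hMc.mono sphere_subset_closedBall))).prodMk continuousOn_const
    exact S.contτ.comp h1 fun w hw => hMne w hw
  have hNexp : ∀ w ∈ sphere (0 : ℂ) 1, M w = w * Complex.exp (N w) := by
    intro w hw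
    have hw0 : w ≠ 0 := by
      rintro rfl; simp at hw
    have h1 := hL w (sphere_subset_closedBall hw)
    have h2 := S.expτ _ _ (hMne w hw)
    rw [dslope_of_ne _ hw0, slope_def_field, hM0, sub_zero, hH0, hH] at h1
    have hM1 : M w ≠ 0 := by
      intro he; apply hMne w hw; rw [he, mul_zero, add_zero]
    rw [hN]
    simp only
    rw [Complex.exp_sub, Complex.exp_sub, h1, h2, ← Complex.ofReal_exp, Real.exp_log hr0]
    have h3 : h (x + r * M w) - h x ≠ 0 := sub_ne_zero.2 fun he => hMne w hw (h.injective he)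
    rw [add_sub_cancel_left]
    generalize h (x + r * M w) - h x = A at h3 ⊢
    field_simp
  have hNre : ∀ w ∈ sphere (0 : ℂ) 1, (N w).re = 0 := by
    intro w hw
    have h1 := congrArg norm (hNexp w hw)
    rw [norm_mul, mem_sphere_zero_iff_norm.1 hw, mem_sphere_zero_iff_norm.1 (hMs hw), one_mul,
      Complex.norm_exp] at h1
    exact Real.exp_eq_one_iff _ |>.1 h1.symm
  have hNK : ∀ w ∈ sphere (0 : ℂ) 1, M w = w * Complex.exp ((N w).im * Complex.I) := by
    intro w hw
    rw [hNexp w hw]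
    congr 2
    apply Complex.ext <;> simp [hNre w hw]
  obtain ⟨P, hPn, hPid, hPs⟩ := exists_twist (K := fun w => (N w).im)
    (Complex.continuous_im.comp_continuousOn hNc)
    (fun z hz w hw hzw => hMi (sphere_subset_closedBall hz) (sphere_subset_closedBall hw) (by
      rw [hNK z hz, hNK w hw]; exact hzw))
  have hPsymm : ∀ z, ‖P.symm z‖ = ‖z‖ := fun z => by rw [← hPn, P.apply_symm_apply]
  obtain ⟨k, hkid, hk0, hkψ⟩ := exists_straightening hψan.hasStrictDerivAt hψ' one_half_pos
  have hkle : ∀ z, ‖z‖ ≤ 1 → ‖k z‖ ≤ 1 := by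
    intro z hz
    by_contra hcon
    push Not at hcon
    have h1 := k.injective (hkid (k z) (by linarith))
    rw [h1] at hcon
    linarith
  set f : ℂ → ℂ := fun z => if ‖z‖ ≤ 1 then M (k (P.symm z)) else z with hf
  have hmaps : ∀ z, ‖z‖ ≤ 1 → k (P.symm z) ∈ closedBall (0 : ℂ) 1 := fun z hz =>
    mem_closedBall_zero_iff.2 (hkle _ ((hPsymm z).trans_le hz))
  have hfin : ∀ z, ‖z‖ ≤ 1 → f z = M (k (P.symm z)) := fun z hz => if_pos hz
  have hfle : ∀ z, ‖z‖ ≤ 1 → ‖f z‖ ≤ 1 := fun z hz => by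
    rw [hfin z hz]; exact mem_closedBall_zero_iff.1 (hclM (hmaps z hz))
  have hfout : ∀ z, 1 < ‖z‖ → f z = z := fun z hz => if_neg (not_le.2 hz)
  have hfc : Continuous f := by
    refine continuous_if_le continuous_norm continuous_const ?_ continuousOn_id ?_
    · exact hMc.comp (k.continuous.comp P.symm.continuous).continuousOn fun z hz => hmaps z hz
    · intro z hz
      have h1 : ‖P.symm z‖ = 1 := (hPsymm z).trans hz
      rw [hkid _ (by rw [h1]; norm_num), hNK _ (mem_sphere_zero_iff_norm.2 h1), ← hPs _ h1,
        P.apply_symm_apply]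
  have hfi : Function.Injective f := by
    intro z w hzw
    rcases le_or_gt ‖z‖ 1 with hz | hz <;> rcases le_or_gt ‖w‖ 1 with hw | hw
    · rw [hfin z hz, hfin w hw] at hzw
      exact P.symm.injective (k.injective (hMi (hmaps z hz) (hmaps w hw) hzw))
    · have := hfle z hz
      rw [hzw, hfout w hw] at this
      linarith
    · have := hfle w hw
      rw [← hzw, hfout z hz] at this
      linarith
    · rwa [hfout z hz, hfout w hw] at hzw
  obtain ⟨F, hF⟩ := exists_homeomorph_of_norm_eq (R := 2) hfc hfi fun z hz => by
    rw [hfout z (by linarith)]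
  refine ⟨H.symm.trans (F.trans H), lam / r, div_ne_zero hψ' hrC, fun z hz => ?_, ?_⟩
  · have h1 : 1 < ‖H.symm z‖ := by
      by_contra hcon
      push Not at hcon
      have h2 : dist (x + r * H.symm z) x < δ := by
        rw [dist_eq_norm, add_sub_cancel_left, norm_mul, Complex.norm_real, Real.norm_eq_abs,
          abs_of_pos hr0]
        nlinarith
      have h3 := hδε h2
      rw [← hH, H.apply_symm_apply, dist_eq_norm] at h3
      linarith
    simp only [Homeomorph.trans_apply]
    rw [hF, hfout _ h1, H.apply_symm_apply]
  · have hu : Tendsto (fun z => (z - x) / (r : ℂ)) (𝓝 x) (𝓝 0) := by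
      have : ContinuousAt (fun z => (z - x) / (r : ℂ)) x := by fun_prop
      simpa [ContinuousAt] using this
    have hkn : ∀ᶠ z in 𝓝 (0 : ℂ), k z ∈ ball (0 : ℂ) 1 :=
      k.continuous.continuousAt.eventually_mem (by rw [hk0]; exact isOpen_ball.mem_nhds h0b)
    have hsm : ∀ᶠ z in 𝓝 (0 : ℂ), ‖z‖ < 1 / 2 := by
      filter_upwards [ball_mem_nhds (0 : ℂ) one_half_pos] with z hz
      exact mem_ball_zero_iff.1 hz
    filter_upwards [hu.eventually (hkn.and (hsm.and hkψ))] with z hz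
    obtain ⟨h1, h2, h3⟩ := hz
    simp only [Homeomorph.trans_apply]
    have h4 : P.symm ((z - x) / r) = (z - x) / r := by
      rw [Homeomorph.symm_apply_eq, hPid _ h2.le]
    rw [hHsymm, hF, hfin _ (by linarith), h4, hHM _ h1, h3, hψ0, hH0, ← hlam]
    field_simp

end

section

open Metric

/-- Extension of a fundamental piece to an equivariant family of curves. -/
theorem exists_equivariant_extension {T : Type*} [TopologicalSpace T] (h : ℂ ≃ₜ ℂ)
    {γ : ℝ × T → ℂ} (hγ : Continuous γ) (h1 : ∀ v, γ (1, v) = h (γ (0, v))) :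
    ∃ Ψ : ℝ × T → ℂ, Continuous Ψ ∧ (∀ u v, Ψ (u + 1, v) = h (Ψ (u, v))) ∧
      ∀ u ∈ Icc (0 : ℝ) 1, ∀ v, Ψ (u, v) = γ (u, v) := by
  set Ψ : ℝ × T → ℂ := fun p => (h ^ ⌊p.1⌋) (γ (Int.fract p.1, p.2)) with hΨ
  have hpow : ∀ (n : ℤ) z, (h ^ (n + 1)) z = h ((h ^ n) z) := fun n z => by
    rw [add_comm, zpow_one_add, Homeomorph.mul_apply]
  have hpow' : ∀ (n : ℤ) z, (h ^ (n + 1)) z = (h ^ n) (h z) := fun n z => by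
    rw [zpow_add_one, Homeomorph.mul_apply]
  have hpiece : ∀ (n : ℤ) (p : ℝ × T), p.1 ∈ Icc (n : ℝ) (n + 1) →
      Ψ p = (h ^ n) (γ (p.1 - n, p.2)) := by
    rintro n ⟨u, v⟩ ⟨hu1, hu2⟩
    rcases hu2.lt_or_eq with hu | hu
    · have : ⌊u⌋ = n := Int.floor_eq_iff.2 ⟨hu1, hu⟩
      simp only [hΨ, Int.fract, this]
    · simp only at hu
      have h2 : u = ((n + 1 : ℤ) : ℝ) := by rw [hu]; push_cast; ring
      have h3 : u - n = 1 := by rw [hu]; ring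
      simp only [hΨ, h3, h1]
      rw [h2, Int.floor_intCast, Int.fract_intCast, hpow']
  refine ⟨Ψ, ?_, fun u v => ?_, fun u hu v => ?_⟩
  · have hlf : LocallyFinite fun n : ℤ => Icc (n : ℝ) (n + 1) ×ˢ (univ : Set T) := by
      intro p
      refine ⟨Ioo (p.1 - 1) (p.1 + 1) ×ˢ univ,
        prod_mem_nhds (Ioo_mem_nhds (by linarith) (by linarith)) univ_mem, ?_⟩
      refine (finite_Icc (⌊p.1⌋ - 2) (⌊p.1⌋ + 2)).subset ?_
      rintro n ⟨⟨u, v⟩, ⟨⟨h2, h3⟩, -⟩, ⟨h4, h5⟩, -⟩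
      simp only at h2 h3 h4 h5
      have h6 := Int.floor_le p.1
      have h7 := Int.lt_floor_add_one p.1
      constructor
      · have : ((⌊p.1⌋ - 2 : ℤ) : ℝ) ≤ n := by push_cast; linarith
        exact_mod_cast this
      · have : (n : ℝ) < ((⌊p.1⌋ + 2 : ℤ) : ℝ) := by push_cast; linarith
        exact_mod_cast this.le
    refine hlf.continuous ?_ (fun n => isClosed_Icc.prod isClosed_univ) fun n => ?_
    · refine eq_univ_of_forall fun p => mem_iUnion.2 ⟨⌊p.1⌋, ⟨Int.floor_le _, ?_⟩, trivial⟩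
      exact (Int.lt_floor_add_one _).le
    · refine ContinuousOn.congr ?_ fun p hp => hpiece n p hp.1
      refine ((h ^ n).continuous.comp (hγ.comp ?_)).continuousOn
      fun_prop
  · simp only [hΨ, Int.floor_add_one, Int.fract_add_one, hpow]
  · have := hpiece 0 (u, v) (by simpa using hu)
    simpa using this

/-- The conclusion of Brouwer's lemma on equivariant curves. -/
def WindowProperty (h : ℂ → ℂ) : Prop :=
  ∀ Γ : ℝ → ℂ, Continuous Γ → (∀ u, Γ (u + 1) = h (Γ u)) → InjOn Γ (Ico 0 2) →
    Function.Injective Γ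

/-- A translation line through `x` which is the union of two radii of a disc near `x`. -/
theorem exists_translation_line {h : ℂ ≃ₜ ℂ} (hfp : ∀ z, h z ≠ z) (hw : WindowProperty h) (x : ℂ) :
    ∃ (Γ : ℝ → ℂ) (p q : ℂ), Continuous Γ ∧ (∀ u, Γ (u + 1) = h (Γ u)) ∧ Function.Injective Γ ∧
      ‖p‖ = ‖q‖ ∧ p ≠ q ∧ (∀ u ∈ Icc (0 : ℝ) (1 / 2), Γ u = x + u * q) ∧
      ∀ u ∈ Icc (0 : ℝ) (1 / 2), Γ (-u) = x + u * p := by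
  set f : ℂ → ℝ := fun z => max ‖z - x‖ ‖h z - x‖ with hf
  have hfc : Continuous f := by fun_prop
  obtain ⟨p, hp⟩ : ∃ p, ∀ z, f p ≤ f z := by
    refine hfc.exists_forall_le' x ?_
    rw [← Metric.cobounded_eq_cocompact]
    have h1 : Tendsto (fun z : ℂ => ‖z - x‖) (Bornology.cobounded ℂ) atTop := by
      refine tendsto_atTop_mono (f := fun z : ℂ => ‖z‖ + -‖x‖) (fun z => ?_)
        (tendsto_atTop_add_const_right _ _ tendsto_norm_cobounded_atTop)
      linarith [norm_sub_norm_le z x]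
    filter_upwards [h1.eventually_ge_atTop (f x)] with z hz
    exact hz.trans (le_max_left _ _)
  set R := f p with hR
  have hshrink : ∀ (y : ℂ) (t : ℝ), t ∈ Ioo (0 : ℝ) 1 → y ≠ x → ‖y + t * (x - y) - x‖ < ‖y - x‖ := by
    intro y t ht hy
    have : y + t * (x - y) - x = ((1 - t : ℝ) : ℂ) * (y - x) := by push_cast; ring
    rw [this, norm_mul, Complex.norm_real, Real.norm_eq_abs, abs_of_pos (by linarith [ht.2])]
    have := norm_pos_iff.2 (sub_ne_zero.2 hy)
    nlinarith [ht.1]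
  have hmin : ∀ z, f z ≤ R → ‖z - x‖ = R ∧ ‖h z - x‖ = R := by
    intro z hz
    have hzR : f z = R := le_antisymm hz (hp z)
    have h1 : ‖z - x‖ ≤ R := (le_max_left _ _).trans hz
    have h2 : ‖h z - x‖ ≤ R := (le_max_right _ _).trans hz
    have hex : ∀ P : ℝ → Prop, (∀ᶠ t in 𝓝 (0 : ℝ), P t) → ∃ t ∈ Ioo (0 : ℝ) 1, P t := by
      intro P hP
      have h3 : ∀ᶠ t in 𝓝[>] (0 : ℝ), t ∈ Ioo (0 : ℝ) 1 := Ioo_mem_nhdsGT one_pos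
      exact (h3.and (hP.filter_mono nhdsWithin_le_nhds)).exists
    constructor
    · by_contra hne
      have h3 : ‖z - x‖ < R := lt_of_le_of_ne h1 hne
      have h4 : h z ≠ x := by
        intro he
        simp only [hf, he, sub_self, norm_zero, max_eq_left (norm_nonneg (z - x))] at hzR
        linarith
      have hev : ∀ᶠ t : ℝ in 𝓝 0, ‖h.symm (h z + t * (x - h z)) - x‖ < R := by
        have hc : ContinuousAt (fun t : ℝ => ‖h.symm (h z + t * (x - h z)) - x‖) 0 := by
          fun_prop
        exact hc.eventually_lt_const (by simpa using h3)
      obtain ⟨t, ht, htR⟩ := hex _ hev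
      have h5 := hp (h.symm (h z + t * (x - h z)))
      refine absurd h5 (not_le.2 (max_lt htR ?_))
      rw [h.apply_symm_apply]
      exact (hshrink _ t ht h4).trans_le h2
    · by_contra hne
      have h3 : ‖h z - x‖ < R := lt_of_le_of_ne h2 hne
      have h4 : z ≠ x := by
        intro he
        simp only [hf, he, sub_self, norm_zero, max_eq_right (norm_nonneg (h x - x))] at hzR
        rw [he] at h3
        linarith
      have hev : ∀ᶠ t : ℝ in 𝓝 0, ‖h (z + t * (x - z)) - x‖ < R := by
        have hc : ContinuousAt (fun t : ℝ => ‖h (z + t * (x - z)) - x‖) 0 := by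
          fun_prop
        exact hc.eventually_lt_const (by simpa using h3)
      obtain ⟨t, ht, htR⟩ := hex _ hev
      have h5 := hp (z + t * (x - z))
      exact absurd h5 (not_le.2 (max_lt ((hshrink _ t ht h4).trans_le h1) htR))
  obtain ⟨hpR, hqR⟩ := hmin p le_rfl
  have hR0 : 0 < R := by
    rcases (norm_nonneg (p - x)).eq_or_lt with h1 | h1
    · exfalso
      have h2 : p = x := sub_eq_zero.1 (norm_eq_zero.1 h1.symm)
      have h3 : h p = x := by
        rw [← h1] at hpR
        rw [← hpR] at hqR
        exact sub_eq_zero.1 (norm_eq_zero.1 hqR)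
      exact hfp p (h3.trans h2.symm)
    · rwa [hpR] at h1
  set q := h p with hq
  have hpq : p ≠ q := (hfp p).symm
  set γ : ℝ × Unit → ℂ := fun s =>
    x + (max 0 (1 - 2 * s.1) : ℝ) * (p - x) + (max 0 (2 * s.1 - 1) : ℝ) * (q - x) with hγ
  have hγc : Continuous γ := by fun_prop
  have hγ0 : ∀ s ≤ (1 / 2 : ℝ), γ (s, ()) = x + (1 - 2 * s : ℝ) * (p - x) := fun s hs => by
    simp only [hγ]
    rw [max_eq_right (by linarith), max_eq_left (by linarith)]; simp
  have hγ1 : ∀ s ≥ (1 / 2 : ℝ), γ (s, ()) = x + (2 * s - 1 : ℝ) * (q - x) := fun s hs => by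
    simp only [hγ]
    rw [max_eq_left (by linarith), max_eq_right (by linarith)]; simp
  have hγe0 : γ (0, ()) = p := by rw [hγ0 0 (by norm_num)]; simp
  have hγe1 : γ (1, ()) = q := by rw [hγ1 1 (by norm_num)]; norm_num
  obtain ⟨Ψ, hΨc, hΨe, hΨγ⟩ := exists_equivariant_extension h hγc (by
    rintro ⟨⟩; rw [hγe0, hγe1])
  have hnorm0 : ∀ s ∈ Icc (0 : ℝ) (1 / 2), ‖γ (s, ()) - x‖ = (1 - 2 * s) * R := by
    intro s hs
    rw [hγ0 s hs.2, add_sub_cancel_left, norm_mul, Complex.norm_real, Real.norm_eq_abs,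
      abs_of_nonneg (by linarith [hs.2]), hpR]
  have hnorm1 : ∀ s ∈ Icc (1 / 2 : ℝ) 1, ‖γ (s, ()) - x‖ = (2 * s - 1) * R := by
    intro s hs
    rw [hγ1 s hs.1, add_sub_cancel_left, norm_mul, Complex.norm_real, Real.norm_eq_abs,
      abs_of_nonneg (by linarith [hs.1]), hqR]
  have hin : ∀ s ∈ Ioo (0 : ℝ) 1, ‖γ (s, ()) - x‖ < R := by
    intro s hs
    rcases le_total s (1 / 2) with h1 | h1
    · rw [hnorm0 s ⟨hs.1.le, h1⟩]; nlinarith [hs.1]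
    · rw [hnorm1 s ⟨h1, hs.2.le⟩]; nlinarith [hs.2]
  have hinj : ∀ s ∈ Icc (0 : ℝ) 1, ∀ t ∈ Icc (0 : ℝ) 1, s < t → γ (s, ()) ≠ γ (t, ()) := by
    intro s hs t ht hst he
    have he' : ‖γ (s, ()) - x‖ = ‖γ (t, ()) - x‖ := by rw [he]
    rcases le_total s (1 / 2) with h1 | h1 <;> rcases le_total t (1 / 2) with h2 | h2
    · rw [hnorm0 s ⟨hs.1, h1⟩, hnorm0 t ⟨ht.1, h2⟩] at he'
      have := mul_right_cancel₀ hR0.ne' he'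
      linarith
    · rw [hnorm0 s ⟨hs.1, h1⟩, hnorm1 t ⟨h2, ht.2⟩] at he'
      have h3 := mul_right_cancel₀ hR0.ne' he'
      rw [hγ0 s h1, hγ1 t h2, h3] at he
      have h4 : (2 * t - 1 : ℝ) ≠ 0 := by intro h; linarith
      have h5 := mul_left_cancel₀ (Complex.ofReal_ne_zero.2 h4) (add_left_cancel he)
      exact hpq (sub_left_inj.1 h5)
    · linarith
    · rw [hnorm1 s ⟨h1, hs.2⟩, hnorm1 t ⟨h2, ht.2⟩] at he'
      have := mul_right_cancel₀ hR0.ne' he'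
      linarith
  have hcross : ∀ s ∈ Ico (0 : ℝ) 1, ∀ t ∈ Ico (0 : ℝ) 1, γ (s, ()) ≠ h (γ (t, ())) := by
    intro s hs t ht he
    have h1 : ‖γ (s, ()) - x‖ ≤ R := by
      rcases hs.1.eq_or_lt with h | h
      · rw [← h, hγe0]; exact hpR.le
      · exact (hin s ⟨h, hs.2⟩).le
    rcases ht.1.eq_or_lt with h | h
    · rw [← h, hγe0, ← hq, ← hγe1] at he
      exact hinj s ⟨hs.1, hs.2.le⟩ 1 ⟨zero_le_one, le_rfl⟩ hs.2 he
    · have h2 := hin t ⟨h, ht.2⟩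
      rw [he] at h1
      have h3 := (hmin (γ (t, ())) (max_le h2.le h1)).1
      linarith
  have hΨ1 : ∀ s ∈ Ico (1 : ℝ) 2, Ψ (s, ()) = h (γ (s - 1, ())) := by
    intro s hs
    rw [← hΨγ (s - 1) ⟨by linarith [hs.1], by linarith [hs.2]⟩, ← hΨe]
    simp
  have hΨi : Function.Injective fun s : ℝ => Ψ (s, ()) := by
    refine hw _ (by fun_prop) (fun u => hΨe u ()) ?_
    have hlt : ∀ s ∈ Ico (0 : ℝ) 2, ∀ t ∈ Ico (0 : ℝ) 2, s < t → Ψ (s, ()) ≠ Ψ (t, ()) := by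
      intro s hs t ht hst he
      rcases lt_or_ge s 1 with h1 | h1 <;> rcases lt_or_ge t 1 with h2 | h2
      · rw [hΨγ s ⟨hs.1, h1.le⟩, hΨγ t ⟨ht.1, h2.le⟩] at he
        exact hinj s ⟨hs.1, h1.le⟩ t ⟨ht.1, h2.le⟩ hst he
      · rw [hΨγ s ⟨hs.1, h1.le⟩, hΨ1 t ⟨h2, ht.2⟩] at he
        exact hcross s ⟨hs.1, h1⟩ (t - 1) ⟨by linarith, by linarith [ht.2]⟩ he
      · linarith
      · rw [hΨ1 s ⟨h1, hs.2⟩, hΨ1 t ⟨h2, ht.2⟩] at he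
        exact hinj (s - 1) ⟨by linarith, by linarith [hs.2]⟩ (t - 1)
          ⟨by linarith, by linarith [ht.2]⟩ (by linarith) (h.injective he)
    intro s hs t ht he
    rcases lt_trichotomy s t with h1 | h1 | h1
    · exact absurd he (hlt s hs t ht h1)
    · exact h1
    · exact absurd he.symm (hlt t ht s hs h1)
  refine ⟨fun u => Ψ (u + 1 / 2, ()), 2 * (p - x), 2 * (q - x), by fun_prop, fun u => ?_, ?_, ?_, ?_,
    fun u hu => ?_, fun u hu => ?_⟩
  · rw [← hΨe]; ring_nf
  · intro s t hst
    have := hΨi hst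
    linarith
  · rw [norm_mul, norm_mul, hpR, hqR]
  · intro he
    exact hpq (sub_left_inj.1 (mul_left_cancel₀ two_ne_zero he))
  · show Ψ (u + 1 / 2, ()) = _
    rw [hΨγ _ ⟨by linarith [hu.1], by linarith [hu.2]⟩, hγ1 _ (by linarith [hu.1])]
    push_cast; ring
  · show Ψ (-u + 1 / 2, ()) = _
    rw [hΨγ _ ⟨by linarith [hu.2], by linarith [hu.1]⟩, hγ0 _ (by linarith [hu.1])]
    push_cast; ring

end

section

open Metric

/-- `StepRel E n a b`: there is an `E`-chain of length `n` from `a` to `b`. -/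
def StepRel {α : Type*} (E : α → α → Prop) : ℕ → α → α → Prop
  | 0, a, b => a = b
  | n + 1, a, b => ∃ c, StepRel E n a c ∧ E c b

theorem StepRel.trans {α : Type*} {E : α → α → Prop} {m n : ℕ} {a b c : α}
    (h1 : StepRel E m a b) (h2 : StepRel E n b c) : StepRel E (m + n) a c := by
  induction n generalizing c with
  | zero => cases h2; exact h1
  | succ k ih =>
    obtain ⟨d, hd, he⟩ := h2
    exact ⟨d, ih hd, he⟩

theorem StepRel.single {α : Type*} {E : α → α → Prop} {a b : α} (h : E a b) : StepRel E 1 a b :=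
  ⟨a, rfl, h⟩

theorem StepRel.of_forall {α : Type*} {E : α → α → Prop} {v : ℕ → α} {N : ℕ}
    (hv : ∀ i < N, E (v i) (v (i + 1))) (i k : ℕ) (hik : i + k ≤ N) :
    StepRel E k (v i) (v (i + k)) := by
  induction k with
  | zero => rfl
  | succ k ih => exact ⟨v (i + k), ih (by omega), hv _ (by omega)⟩

theorem StepRel.exists_chain {α : Type*} {E : α → α → Prop} {n : ℕ} {a b : α}
    (h : StepRel E n a b) : ∃ v : ℕ → α, v 0 = a ∧ v n = b ∧ ∀ i < n, E (v i) (v (i + 1)) := by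
  induction n generalizing b with
  | zero => exact ⟨fun _ => a, rfl, h, fun i hi => absurd hi (by omega)⟩
  | succ k ih =>
    obtain ⟨c, hc, he⟩ := h
    obtain ⟨v, h0, hk, hv⟩ := ih hc
    refine ⟨fun i => if i ≤ k then v i else b, by simp [h0], by simp, fun i hi => ?_⟩
    rcases (Nat.lt_succ_iff.1 hi).lt_or_eq with h1 | rfl
    · simp only [h1.le, Nat.succ_le_of_lt h1, if_true]
      exact hv i h1
    · simp only [le_refl, if_true, show ¬ (i + 1 ≤ i) by omega, if_false, hk]
      exact he

theorem exists_stepRel_of_reflTransGen {α : Type*} {E : α → α → Prop} {a b : α}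
    (h : Relation.ReflTransGen E a b) : ∃ n, StepRel E n a b := by
  induction h with
  | refl => exact ⟨0, rfl⟩
  | tail _ h2 ih =>
    obtain ⟨n, hn⟩ := ih
    exact ⟨n + 1, _, hn, h2⟩

theorem mem_segment_or_of_mem_inter {a b c z : ℂ} (h1 : z ∈ segment ℝ a b)
    (h2 : z ∈ segment ℝ b c) (hz : z ≠ b) : c ∈ segment ℝ a b ∨ a ∈ segment ℝ b c := by
  rw [segment_symm] at h1 ⊢
  rw [segment_eq_image'] at h1 h2 ⊢
  rw [segment_eq_image' ℝ b c]
  obtain ⟨s, hs, rfl⟩ := h1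
  obtain ⟨t, ht, he⟩ := h2
  simp only at he hz
  have hs0 : 0 < s := hs.1.lt_of_ne fun h => hz (by rw [← h]; simp)
  have ht0 : 0 < t := ht.1.lt_of_ne fun h => hz (by rw [← he, ← h]; simp)
  have he' : t • (c - b) = s • (a - b) := add_left_cancel he
  rcases le_total s t with hst | hst
  · left
    refine ⟨s / t, ⟨by positivity, (div_le_one ht0).2 hst⟩, ?_⟩
    simp only
    rw [div_eq_inv_mul, mul_smul, ← he', smul_smul, inv_mul_cancel₀ ht0.ne', one_smul]
    ring
  · right
    refine ⟨t / s, ⟨by positivity, (div_le_one hs0).2 hst⟩, ?_⟩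
    simp only
    rw [div_eq_inv_mul, mul_smul, he', smul_smul, inv_mul_cancel₀ hs0.ne', one_smul]
    ring

/-- A chain of minimal length is a simple polygonal arc. -/
theorem exists_simple_chain {E : ℂ → ℂ → Prop} {x y : ℂ}
    (hL : ∀ u w z, E u w → w ≠ y → z ∈ segment ℝ u w → E u z)
    (hR : ∀ u w z, E u w → u ≠ x → z ∈ segment ℝ u w → E z w)
    (hc : Relation.ReflTransGen E x y) :
    ∃ (N : ℕ) (v : ℕ → ℂ), v 0 = x ∧ v N = y ∧ (∀ i < N, E (v i) (v (i + 1))) ∧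
      (∀ i < N, v i ≠ v (i + 1)) ∧
      ∀ i j z, i < j → j < N → z ∈ segment ℝ (v i) (v (i + 1)) →
        z ∈ segment ℝ (v j) (v (j + 1)) → j = i + 1 ∧ z = v j := by
  classical
  have hex := exists_stepRel_of_reflTransGen hc
  set N := Nat.find hex with hN
  have hmin : ∀ m, StepRel E m x y → N ≤ m := fun m hm => Nat.find_min' hex hm
  obtain ⟨v, h0, hNy, hv⟩ := (Nat.find_spec hex).exists_chain
  rw [← hN] at hNy hv
  have hsub : ∀ i j, i ≤ j → j ≤ N → StepRel E (j - i) (v i) (v j) := fun i j hij hj => by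
    have := StepRel.of_forall hv i (j - i) (by omega)
    rwa [Nat.add_sub_cancel' hij] at this
  have hpre : ∀ i ≤ N, StepRel E i x (v i) := fun i hi => by
    have := hsub 0 i (Nat.zero_le _) hi
    rwa [h0] at this
  have hpost : ∀ i ≤ N, StepRel E (N - i) (v i) y := fun i hi => by
    have := hsub i N hi le_rfl
    rwa [hNy] at this
  have hnx : ∀ i, 0 < i → i ≤ N → v i ≠ x := fun i hi hi' he => by
    have := hpost i hi'
    rw [he] at this
    have := hmin _ this
    omega
  have hny : ∀ i < N, v i ≠ y := fun i hi he => by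
    have := hpre i hi.le
    rw [he] at this
    have := hmin _ this
    omega
  refine ⟨N, v, h0, hNy, hv, fun i hi he => ?_, fun i j z hij hj hz1 hz2 => ?_⟩
  · have h1 := hpost (i + 1) hi
    rw [← he] at h1
    have := hmin _ ((hpre i hi.le).trans h1)
    omega
  · have e1 := hL _ _ z (hv i (by omega)) (hny _ (by omega)) hz1
    have e2 := hR _ _ z (hv j hj) (hnx j (by omega) hj.le) hz2
    have h1 := hmin _ (((hpre i (by omega)).trans (StepRel.single e1)).trans
      ((StepRel.single e2).trans (hpost (j + 1) hj)))
    obtain rfl : j = i + 1 := by omega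
    refine ⟨rfl, by_contra fun hz => ?_⟩
    have e3 : E (v i) (v (i + 1 + 1)) := by
      rcases mem_segment_or_of_mem_inter hz1 hz2 hz with h2 | h2
      · exact hL _ _ _ (hv i (by omega)) (hny _ hj) h2
      · exact hR _ _ _ (hv (i + 1) hj) (hnx _ (by omega) (by omega)) h2
    have h2 := hmin _ (((hpre i (by omega)).trans (StepRel.single e3)).trans
      (hpost (i + 1 + 1) hj))
    omega

end

section

open Metric

/-- A polygonal translation arc from `x` to `h x`. -/
theorem exists_polygonal_arc {h : ℂ ≃ₜ ℂ} (hfp : ∀ z, h z ≠ z) (hw : WindowProperty h) {x μ : ℂ}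
    (hlin : ∀ᶠ z in 𝓝 x, h z = h x + μ * (z - x)) :
    ∃ (N : ℕ) (v : ℕ → ℂ) (p q : ℂ), 2 ≤ N ∧ v 0 = x ∧ v N = h x ∧
      ‖p‖ = ‖q‖ ∧ p ≠ q ∧ (∃ s : ℝ, 0 < s ∧ v 1 = x + s * q) ∧
      (∃ s : ℝ, 0 < s ∧ v (N - 1) = h x + s * (μ * p)) ∧
      (∀ i < N, v i ≠ v (i + 1)) ∧
      (∀ i j z, i < j → j < N → z ∈ segment ℝ (v i) (v (i + 1)) →
        z ∈ segment ℝ (v j) (v (j + 1)) → j = i + 1 ∧ z = v j) ∧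
      ∀ i < N, ∀ j < N, ∀ z ∈ segment ℝ (v i) (v (i + 1)),
        h z ∈ segment ℝ (v j) (v (j + 1)) → z = x := by
  obtain ⟨Γ, p, q, hΓc, hΓ, hΓi, hpq, hpq', hq, hp⟩ := exists_translation_line hfp hw x
  have hΓ0 : Γ 0 = x := by simpa using hq 0 (by norm_num)
  have hΓ1 : Γ 1 = h x := by rw [← hΓ0, ← hΓ]; norm_num
  obtain ⟨η, hη0, hη1, hη⟩ : ∃ η : ℝ, 0 < η ∧ η < 1 / 2 ∧
      ∀ u ∈ Icc 0 η, Γ (1 - u) = h x + u * (μ * p) := by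
    have h1 : Tendsto (fun u : ℝ => x + u * p) (𝓝 0) (𝓝 x) := by
      have : Continuous (fun u : ℝ => x + u * p) := by fun_prop
      simpa using this.tendsto 0
    obtain ⟨δ, hδ, hb⟩ := Metric.eventually_nhds_iff.1 (h1.eventually hlin)
    refine ⟨min (δ / 2) (1 / 4), by positivity, by linarith [min_le_right (δ / 2) (1 / 4 : ℝ)],
      fun u hu => ?_⟩
    have h2 := hu.2.trans (min_le_left _ _)
    have h3 := hu.2.trans (min_le_right _ _)
    have h4 : dist u 0 < δ := by
      rw [Real.dist_eq, sub_zero, abs_of_nonneg hu.1]; linarith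
    have h5 := hb h4
    rw [show (1 : ℝ) - u = -u + 1 by ring, hΓ, hp u ⟨hu.1, by linarith⟩, h5]
    ring
  set Qp := segment ℝ x (x + η * q) with hQp
  set Qm := segment ℝ (h x + η * (μ * p)) (h x) with hQm
  have hQp' : ∀ z ∈ Qp, ∃ s ∈ Icc 0 η, Γ s = z ∧ z = x + s * q := by
    rintro z hz
    rw [hQp, segment_eq_image'] at hz
    obtain ⟨t, ht, rfl⟩ := hz
    have h1 : t * η ∈ Icc 0 η := ⟨mul_nonneg ht.1 hη0.le, mul_le_of_le_one_left hη0.le ht.2⟩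
    have h2 : x + t • (x + η * q - x) = x + ((t * η : ℝ) : ℂ) * q := by
      push_cast; rw [Complex.real_smul]; ring
    refine ⟨t * η, h1, ?_, h2⟩
    rw [hq _ ⟨h1.1, h1.2.trans hη1.le⟩]
    exact h2.symm
  have hQm' : ∀ z ∈ Qm, ∃ s ∈ Icc 0 η, Γ (1 - s) = z ∧ z = h x + s * (μ * p) := by
    rintro z hz
    rw [hQm, segment_symm, segment_eq_image'] at hz
    obtain ⟨t, ht, rfl⟩ := hz
    have h1 : t * η ∈ Icc 0 η := ⟨mul_nonneg ht.1 hη0.le, mul_le_of_le_one_left hη0.le ht.2⟩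
    have h2 : h x + t • (h x + η * (μ * p) - h x) = h x + ((t * η : ℝ) : ℂ) * (μ * p) := by
      push_cast; rw [Complex.real_smul]; ring
    refine ⟨t * η, h1, ?_, h2⟩
    rw [hη _ h1]
    exact h2.symm
  set Q := Qp ∪ Qm with hQ
  have hQΓ : ∀ z ∈ Q, ∃ s : ℝ, (s ∈ Icc 0 η ∨ s ∈ Icc (1 - η) 1) ∧ Γ s = z := by
    rintro z (hz | hz)
    · obtain ⟨s, hs, h1, -⟩ := hQp' z hz
      exact ⟨s, Or.inl hs, h1⟩
    · obtain ⟨s, hs, h1, -⟩ := hQm' z hz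
      exact ⟨1 - s, Or.inr ⟨by linarith [hs.2], by linarith [hs.1]⟩, h1⟩
  have hsegc : ∀ a b : ℂ, IsCompact (segment ℝ a b) := fun a b => by
    rw [segment_eq_image']
    exact isCompact_Icc.image (by fun_prop)
  have hQc : IsCompact Q := (hsegc _ _).union (hsegc _ _)
  set P := Γ '' Icc η (1 - η) with hP
  have hPc : IsCompact P := isCompact_Icc.image hΓc
  have hPd : Disjoint P (h '' P) := by
    rw [Set.disjoint_left]
    rintro _ ⟨s, hs, rfl⟩ ⟨_, ⟨t, ht, rfl⟩, he⟩
    rw [← hΓ] at he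
    have := hΓi he
    linarith [hs.1, hs.2, ht.1, ht.2]
  obtain ⟨U, V, hU, hV, hPU, hPV, hUV⟩ :=
    SeparatedNhds.of_isCompact_isCompact hPc (hPc.image h.continuous) hPd
  set Ω : Set ℂ := ((U ∩ h ⁻¹' V) ∩ (h '' Q)ᶜ) ∩ (h ⁻¹' Q)ᶜ with hΩ
  have hΩo : IsOpen Ω := ((hU.inter (hV.preimage h.continuous)).inter
    (hQc.image h.continuous).isClosed.isOpen_compl).inter
    (hQc.isClosed.preimage h.continuous).isOpen_compl
  have hPΩ : P ⊆ Ω := by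
    intro z hz
    refine ⟨⟨⟨hPU hz, hPV (mem_image_of_mem h hz)⟩, ?_⟩, ?_⟩
    · rintro ⟨w, hw, rfl⟩
      obtain ⟨s, hs, rfl⟩ := hQΓ w hw
      obtain ⟨t, ht, he⟩ := hz
      rw [← hΓ] at he
      have := hΓi he
      rcases hs with hs | hs <;> linarith [hs.1, hs.2, ht.1, ht.2]
    · intro hw
      obtain ⟨s, hs, he⟩ := hQΓ _ hw
      obtain ⟨t, ht, rfl⟩ := hz
      rw [← hΓ] at he
      have := hΓi he
      rcases hs with hs | hs <;> linarith [hs.1, hs.2, ht.1, ht.2]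
  have hxp : x ∈ Qp := left_mem_segment _ _ _
  have hym : h x ∈ Qm := right_mem_segment _ _ _
  have hxΩ : x ∉ Ω := fun hx => hx.2 (Or.inr hym)
  have hyΩ : h x ∉ Ω := fun hx => hx.1.2 (mem_image_of_mem h (Or.inl hxp))
  have hQd : ∀ z, z ∈ Qp → z ∉ Qm := by
    intro z h1 h2
    obtain ⟨s, hs, h3, -⟩ := hQp' z h1
    obtain ⟨t, ht, h4, -⟩ := hQm' z h2
    have := hΓi (h3.trans h4.symm)
    linarith [hs.1, hs.2, ht.1, ht.2]
  set E : ℂ → ℂ → Prop := fun u w => segment ℝ u w ⊆ Ω ∨ (u = x ∧ w ∈ Qp) ∨ (w = h x ∧ u ∈ Qm)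
    with hE
  have hchain : Relation.ReflTransGen E x (h x) := by
    have h1 : Relation.ReflTransGen E (Γ η) (Γ (1 - η)) := by
      refine isPreconnected_Icc.induction₂' (fun a b : ℝ => Relation.ReflTransGen E (Γ a) (Γ b))
        (fun t ht => ?_) (fun _ _ _ _ _ _ h1 h2 => h1.trans h2)
        (show η ∈ Icc η (1 - η) from ⟨le_rfl, by linarith⟩) ⟨by linarith, le_rfl⟩
      obtain ⟨δ, hδ, hb⟩ := Metric.isOpen_iff.1 hΩo _ (hPΩ (mem_image_of_mem Γ ht))
      have h2 : ∀ᶠ s in 𝓝[Icc η (1 - η)] t, Γ s ∈ ball (Γ t) δ :=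
        nhdsWithin_le_nhds ((hΓc.tendsto t).eventually (ball_mem_nhds _ hδ))
      filter_upwards [h2] with s hs
      have h3 := (convex_ball (Γ t) δ).segment_subset (mem_ball_self hδ) hs
      exact ⟨Relation.ReflTransGen.single (Or.inl (h3.trans hb)),
        Relation.ReflTransGen.single (Or.inl (by rw [segment_symm]; exact h3.trans hb))⟩
    have h2 : E x (Γ η) := by
      refine Or.inr (Or.inl ⟨rfl, ?_⟩)
      rw [hq η ⟨hη0.le, hη1.le⟩]; exact right_mem_segment _ _ _
    have h3 : E (Γ (1 - η)) (h x) := by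
      refine Or.inr (Or.inr ⟨rfl, ?_⟩)
      rw [hη η ⟨hη0.le, le_rfl⟩]; exact left_mem_segment _ _ _
    exact (Relation.ReflTransGen.head h2 h1).tail h3
  have hL : ∀ u w z, E u w → w ≠ h x → z ∈ segment ℝ u w → E u z := by
    rintro u w z (h1 | ⟨rfl, h1⟩ | ⟨rfl, h1⟩) hne hz
    · exact Or.inl (((convex_segment u w).segment_subset (left_mem_segment _ _ _) hz).trans h1)
    · exact Or.inr (Or.inl ⟨rfl, (convex_segment _ _).segment_subset hxp h1 hz⟩)
    · exact absurd rfl hne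
  have hR : ∀ u w z, E u w → u ≠ x → z ∈ segment ℝ u w → E z w := by
    rintro u w z (h1 | ⟨rfl, h1⟩ | ⟨rfl, h1⟩) hne hz
    · exact Or.inl (((convex_segment u w).segment_subset hz (right_mem_segment _ _ _)).trans h1)
    · exact absurd rfl hne
    · exact Or.inr (Or.inr ⟨rfl, (convex_segment _ _).segment_subset h1 hym hz⟩)
  obtain ⟨N, v, h0, hN, hv, hne, hsimp⟩ := exists_simple_chain hL hR hchain
  have hN0 : N ≠ 0 := by
    rintro rfl
    exact hfp x (hN.symm.trans h0)
  have hv1 : v 1 ∈ Qp := by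
    rcases hv 0 (by omega) with h1 | ⟨-, h1⟩ | ⟨-, h1⟩
    · exact absurd (h1 (left_mem_segment _ _ _)) (by rwa [h0])
    · exact h1
    · rw [h0] at h1
      exact absurd h1 (hQd x hxp)
  have hvN : v (N - 1) ∈ Qm := by
    have h2 := hv (N - 1) (by omega)
    rw [Nat.sub_add_cancel (by omega), hN] at h2
    rcases h2 with h1 | ⟨-, h1⟩ | ⟨-, h1⟩
    · exact absurd (h1 (right_mem_segment _ _ _)) hyΩ
    · exact absurd hym (hQd _ h1)
    · exact h1
  have hseg : ∀ i < N, segment ℝ (v i) (v (i + 1)) ⊆ Ω ∪ Q := by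
    intro i hi
    rcases hv i hi with h1 | ⟨h1, h2⟩ | ⟨h1, h2⟩
    · exact h1.trans subset_union_left
    · rw [h1]
      exact ((convex_segment _ _).segment_subset hxp h2).trans
        (subset_union_left.trans subset_union_right)
    · rw [h1]
      exact ((convex_segment _ _).segment_subset h2 hym).trans
        (subset_union_right.trans subset_union_right)
  refine ⟨N, v, p, q, ?_, h0, hN, hpq, hpq', ?_, ?_, hne, hsimp, ?_⟩
  · have : N ≠ 1 := by
      rintro rfl
      rw [hN] at hv1
      exact hQd _ hv1 hym
    omega
  · obtain ⟨s, hs, -, h1⟩ := hQp' _ hv1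
    refine ⟨s, hs.1.lt_of_ne fun hs0 => hne 0 (by omega) ?_, h1⟩
    rw [h0, zero_add, h1, ← hs0]; simp
  · obtain ⟨s, hs, -, h1⟩ := hQm' _ hvN
    refine ⟨s, hs.1.lt_of_ne fun hs0 => hne (N - 1) (by omega) ?_, h1⟩
    rw [Nat.sub_add_cancel (by omega), hN, h1, ← hs0]; simp
  · intro i hi j hj z hz hhz
    rcases hseg i hi hz with h1 | h1 <;> rcases hseg j hj hhz with h2 | h2
    · exact absurd h1.1.1.2 (Set.disjoint_left.1 hUV h2.1.1.1)
    · exact absurd h2 h1.2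
    · exact absurd (mem_image_of_mem h h1) h2.1.2
    · obtain ⟨s, hs, rfl⟩ := hQΓ _ h1
      obtain ⟨t, ht, he⟩ := hQΓ _ h2
      rw [← hΓ] at he
      have h3 := hΓi he
      have : s = 0 := by
        rcases hs with hs | hs <;> rcases ht with ht | ht <;> linarith [hs.1, hs.2, ht.1, ht.2]
      rw [this, hΓ0]

end

section

open Metric

/-- The oriented area spanned by two vectors of the plane. -/
def areaForm (a b : ℂ) : ℝ := a.re * b.im - a.im * b.re

theorem areaForm_mul_left (μ a b : ℂ) : areaForm (μ * a) (μ * b) = ‖μ‖ ^ 2 * areaForm a b := by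
  rw [← Complex.normSq_eq_norm_sq, Complex.normSq_apply]
  simp only [areaForm, Complex.mul_re, Complex.mul_im]
  ring

/-- Two vectors which are not opposite lie in a common open half-plane. -/
theorem exists_areaForm_pos {d d' : ℂ} (hd : d ≠ 0) (hd' : d' ≠ 0)
    (hopp : ∀ t : ℝ, 0 < t → d' ≠ -(t * d)) : ∃ w, 0 < areaForm d w ∧ 0 < areaForm d' w := by
  have h0 : 0 < ‖d‖ := norm_pos_iff.2 hd
  have h0' : 0 < ‖d'‖ := norm_pos_iff.2 hd'
  have hs : ‖d‖ ^ 2 = d.re * d.re + d.im * d.im := by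
    rw [← Complex.normSq_eq_norm_sq, Complex.normSq_apply]
  have hs' : ‖d'‖ ^ 2 = d'.re * d'.re + d'.im * d'.im := by
    rw [← Complex.normSq_eq_norm_sq, Complex.normSq_apply]
  have hin : inner ℝ d (-d') = -(d.re * d'.re + d.im * d'.im) := by
    rw [Complex.inner]; simp; ring
  have hpos : 0 < ‖d‖ * ‖d'‖ + (d.re * d'.re + d.im * d'.im) := by
    have h1 := real_inner_le_norm d (-d')
    rw [hin, norm_neg] at h1
    refine lt_of_le_of_ne (by linarith) fun he => ?_
    have h2 : inner ℝ d (-d') = ‖d‖ * ‖-d'‖ := by rw [hin, norm_neg]; linarith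
    rw [inner_eq_norm_mul_iff_real, norm_neg] at h2
    refine hopp (‖d'‖ / ‖d‖) (by positivity) ?_
    rw [Complex.real_smul, Complex.real_smul] at h2
    have h3 : (‖d‖ : ℂ) ≠ 0 := by exact_mod_cast h0.ne'
    have h4 : ((‖d'‖ / ‖d‖ : ℝ) : ℂ) * d = -d' := by
      push_cast
      rw [div_mul_eq_mul_div, h2]
      field_simp
    rw [h4, neg_neg]
  refine ⟨Complex.I * (‖d'‖ * d + ‖d‖ * d'), ?_, ?_⟩
  · have : areaForm d (Complex.I * (‖d'‖ * d + ‖d‖ * d')) =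
        ‖d‖ * (‖d‖ * ‖d'‖ + (d.re * d'.re + d.im * d'.im)) := by
      simp [areaForm]
      linear_combination (-‖d'‖) * hs
    rw [this]; positivity
  · have : areaForm d' (Complex.I * (‖d'‖ * d + ‖d‖ * d')) =
        ‖d'‖ * (‖d‖ * ‖d'‖ + (d.re * d'.re + d.im * d'.im)) := by
      simp [areaForm]
      linear_combination (-‖d‖) * hs'
    rw [this]; positivity

/-- The standard form of a bent strip near a point of its core. -/
def bentStrip (p d₁ d₂ w e₁ e₂ : ℂ) (s : ℝ × ℝ) : ℂ :=
  p + max s.1 0 * d₁ + min s.1 0 * d₂ + s.2 * (w + max s.1 0 * e₁ + min s.1 0 * e₂)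

theorem exists_injOn_bentStrip {p d₁ d₂ w e₁ e₂ : ℂ} (h1 : 0 < areaForm d₁ w)
    (h2 : 0 < areaForm d₂ w) : ∃ U ∈ 𝓝 (0 : ℝ × ℝ), InjOn (bentStrip p d₁ d₂ w e₁ e₂) U := by
  set W : ℝ → ℂ := fun u => w + max u 0 * e₁ + min u 0 * e₂ with hW
  have hc : ∀ d e : ℂ, 0 < areaForm d w →
      ∀ᶠ s : ℝ × ℝ in 𝓝 0, 0 < areaForm (d + s.2 * e) (W s.1) := fun d e hd => by
    have hcont : Continuous fun s : ℝ × ℝ => areaForm (d + s.2 * e) (W s.1) := by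
      simp only [areaForm, hW]
      fun_prop
    refine (hcont.tendsto 0).eventually (lt_mem_nhds ?_)
    simpa [hW] using hd
  obtain ⟨δ, hδ, hb⟩ := Metric.eventually_nhds_iff.1 ((hc d₁ e₁ h1).and (hc d₂ e₂ h2))
  have hb' : ∀ u c : ℝ, |u| < δ → |c| < δ → 0 < areaForm (d₁ + c * e₁) (W u) ∧
      0 < areaForm (d₂ + c * e₂) (W u) := fun u c hu hc => by
    have : dist ((u, c) : ℝ × ℝ) 0 < δ := by
      rw [Prod.dist_eq]; simpa [Real.dist_eq] using ⟨hu, hc⟩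
    exact hb this
  have key : ∀ u₁ c₁ u₂ c₂ : ℝ, |u₁| < δ → |c₂| < δ → u₁ ≤ u₂ →
      bentStrip p d₁ d₂ w e₁ e₂ (u₁, c₁) = bentStrip p d₁ d₂ w e₁ e₂ (u₂, c₂) →
      u₁ = u₂ ∧ c₁ = c₂ := by
    intro u₁ c₁ u₂ c₂ hu hc hle he
    obtain ⟨hp1, hp2⟩ := hb' u₁ c₂ hu hc
    set A := max u₂ 0 - max u₁ 0 with hA
    set B := min u₂ 0 - min u₁ 0 with hB
    have hA0 : 0 ≤ A := sub_nonneg.2 (max_le_max_right _ hle)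
    have hB0 : 0 ≤ B := sub_nonneg.2 (min_le_min_right _ hle)
    have hAB : A + B = u₂ - u₁ := by
      have e1 := max_add_min u₁ (0 : ℝ)
      have e2 := max_add_min u₂ (0 : ℝ)
      rw [hA, hB]; linarith
    have hz : A * (d₁ + c₂ * e₁) + B * (d₂ + c₂ * e₂) + ((c₂ - c₁ : ℝ) : ℂ) * W u₁ = 0 := by
      simp only [bentStrip] at he
      simp only [hA, hB, hW]
      push_cast
      linear_combination -he
    have hlin : areaForm (A * (d₁ + c₂ * e₁) + B * (d₂ + c₂ * e₂) + ((c₂ - c₁ : ℝ) : ℂ) * W u₁)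
        (W u₁) = A * areaForm (d₁ + c₂ * e₁) (W u₁) + B * areaForm (d₂ + c₂ * e₂) (W u₁) := by
      simp only [areaForm, Complex.add_re, Complex.add_im, Complex.re_ofReal_mul,
        Complex.im_ofReal_mul]
      ring
    rw [hz] at hlin
    have h0 : areaForm 0 (W u₁) = 0 := by simp [areaForm]
    rw [h0] at hlin
    have ha := mul_nonneg hA0 hp1.le
    have hbb := mul_nonneg hB0 hp2.le
    have hA1 : A = 0 := (mul_eq_zero.1 (show A * areaForm (d₁ + c₂ * e₁) (W u₁) = 0 by
      linarith)).resolve_right hp1.ne'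
    have hB1 : B = 0 := (mul_eq_zero.1 (show B * areaForm (d₂ + c₂ * e₂) (W u₁) = 0 by
      linarith)).resolve_right hp2.ne'
    have hW0 : W u₁ ≠ 0 := fun h => by
      rw [h] at hp1; simp [areaForm] at hp1
    rw [hA1, hB1] at hz
    simp only [Complex.ofReal_zero, zero_mul, zero_add, mul_eq_zero, hW0, or_false,
      Complex.ofReal_eq_zero] at hz
    exact ⟨by linarith, by linarith⟩
  refine ⟨ball 0 δ, ball_mem_nhds _ hδ, ?_⟩
  rintro ⟨u₁, c₁⟩ hs ⟨u₂, c₂⟩ ht he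
  rw [mem_ball, Prod.dist_eq, max_lt_iff] at hs ht
  simp only [Real.dist_eq, Prod.fst_zero, Prod.snd_zero, sub_zero] at hs ht
  rcases le_total u₁ u₂ with hle | hle
  · obtain ⟨rfl, rfl⟩ := key _ _ _ _ hs.1 ht.2 hle he
    rfl
  · obtain ⟨rfl, rfl⟩ := key _ _ _ _ ht.1 hs.2 hle he.symm
    rfl

/-- The piecewise affine path with vertices `a 0, …, a N` at integer times. -/
noncomputable def piecewiseAffine (a : ℕ → ℂ) (N : ℕ) (u : ℝ) : ℂ :=
  a 0 + ∑ i ∈ Finset.range N, (max 0 (min 1 (u - i)) : ℝ) * (a (i + 1) - a i)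

theorem continuous_piecewiseAffine (a : ℕ → ℂ) (N : ℕ) : Continuous (piecewiseAffine a N) := by
  unfold piecewiseAffine
  fun_prop

theorem piecewiseAffine_eq (a : ℕ → ℂ) {N k : ℕ} (hk : k < N) {u : ℝ}
    (hu : u ∈ Icc (k : ℝ) (k + 1)) :
    piecewiseAffine a N u = a k + ((u - k : ℝ) : ℂ) * (a (k + 1) - a k) := by
  have h1 : ∀ i ∈ Finset.range k, ((max 0 (min 1 (u - i)) : ℝ) : ℂ) * (a (i + 1) - a i) =
      a (i + 1) - a i := fun i hi => by
    have h2 : (i : ℝ) + 1 ≤ k := by exact_mod_cast Finset.mem_range.1 hi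
    rw [min_eq_left (by linarith [hu.1]), max_eq_right zero_le_one]; simp
  have h2 : ∀ i ∈ Finset.range (N - (k + 1)), ((max 0 (min 1 (u - (k + 1 + i : ℕ))) : ℝ) : ℂ) *
      (a (k + 1 + i + 1) - a (k + 1 + i)) = 0 := fun i _ => by
    rw [max_eq_left]
    · simp
    · refine (min_le_right _ _).trans ?_
      push_cast
      have : (0 : ℝ) ≤ i := Nat.cast_nonneg _
      linarith [hu.2]
  have h3 : N = (k + 1) + (N - (k + 1)) := by omega
  rw [piecewiseAffine, h3, Finset.sum_range_add, Finset.sum_eq_zero h2, add_zero,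
    Finset.sum_range_succ, Finset.sum_congr rfl h1, Finset.sum_range_sub,
    min_eq_right (by linarith [hu.2]), max_eq_right (by linarith [hu.1])]
  ring

end

section

open Metric

theorem equivariant_zpow {T : Type*} {h : ℂ ≃ₜ ℂ} {Ψ : ℝ × T → ℂ}
    (hΨ : ∀ u v, Ψ (u + 1, v) = h (Ψ (u, v))) (n : ℤ) (u : ℝ) (v : T) :
    Ψ (u + n, v) = (h ^ n) (Ψ (u, v)) := by
  induction n using Int.induction_on with
  | zero => simp
  | succ k ih =>
    rw [add_comm (k : ℤ), zpow_one_add, Homeomorph.mul_apply, ← ih, ← hΨ]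
    push_cast; ring_nf
  | pred k ih =>
    apply h.injective
    rw [← hΨ, ← Homeomorph.mul_apply, ← zpow_one_add, add_sub_cancel, ← ih]
    push_cast; ring_nf

/-- An equivariant bent strip along a polygonal arc, locally injective along its core. -/
theorem exists_local_strip {h : ℂ ≃ₜ ℂ} {x μ : ℂ} (hμ : μ ≠ 0)
    (hlin : ∀ᶠ z in 𝓝 x, h z = h x + μ * (z - x)) {N : ℕ} (hN : N ≠ 0) {v w : ℕ → ℂ}
    (hv0 : v 0 = x) (hvN : v N = h x) (hwN : w N = μ * w 0)
    (hdet : ∀ k < N, 0 < areaForm (v (k + 1) - v k) (w k) ∧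
      0 < areaForm (v (k + 1) - v k) (w (k + 1))) :
    ∃ Ψ : ℝ × ℝ → ℂ, Continuous Ψ ∧ (∀ u c, Ψ (u + 1, c) = h (Ψ (u, c))) ∧
      (∀ u ∈ Icc (0 : ℝ) 1, Ψ (u, 0) = piecewiseAffine v N (N * u)) ∧
      ∀ u₀ : ℝ, ∃ U ∈ 𝓝 ((u₀, 0) : ℝ × ℝ), InjOn Ψ U := by
  obtain ⟨ρ, hρ, hb⟩ := Metric.eventually_nhds_iff.1 hlin
  set κ := ρ / (2 * (‖w 0‖ + 1)) with hκ
  have hκ0 : 0 < κ := by positivity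
  set cl : ℝ → ℝ := fun c => max (-κ) (min κ c) with hcl
  have hcl0 : cl 0 = 0 := by
    simp only [hcl]; rw [min_eq_right hκ0.le, max_eq_right (by linarith)]
  have hclk : ∀ c, |cl c| ≤ κ := fun c =>
    abs_le.2 ⟨le_max_left _ _, max_le (by linarith) (min_le_left _ _)⟩
  have hcle : ∀ c, |c| < κ → cl c = c := fun c hc => by
    have := abs_lt.1 hc
    simp only [hcl]; rw [min_eq_right this.2.le, max_eq_right this.1.le]
  have hN0 : (0 : ℝ) < N := by exact_mod_cast Nat.pos_of_ne_zero hN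
  have hNN : ((N - 1 : ℕ) : ℝ) + 1 = N := by
    rw [Nat.cast_sub (Nat.one_le_iff_ne_zero.2 hN)]; simp
  have hNN' : N - 1 + 1 = N := by omega
  have hpN : ∀ a, piecewiseAffine a N N = a N := fun a => by
    rw [piecewiseAffine_eq a (k := N - 1) (by omega) ⟨by linarith, hNN.ge⟩, hNN',
      show ((N : ℝ) - ((N - 1 : ℕ) : ℝ)) = 1 by linarith]
    simp
  have hp0 : ∀ a, piecewiseAffine a N 0 = a 0 := fun a => by
    rw [piecewiseAffine_eq a (k := 0) (by omega) (by simp)]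
    simp
  set γ : ℝ × ℝ → ℂ := fun t =>
    piecewiseAffine v N (N * t.1) + cl t.2 * piecewiseAffine w N (N * t.1) with hγ
  have hγc : Continuous γ := by
    have h1 := continuous_piecewiseAffine v N
    have h2 := continuous_piecewiseAffine w N
    fun_prop
  have hγ1 : ∀ c, γ (1, c) = h (γ (0, c)) := fun c => by
    simp only [hγ, mul_one, mul_zero, hpN, hp0, hv0, hvN, hwN]
    rw [hb (y := x + cl c * w 0)]
    · ring
    · rw [dist_eq_norm, add_sub_cancel_left, norm_mul, Complex.norm_real, Real.norm_eq_abs]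
      calc |cl c| * ‖w 0‖ ≤ κ * (‖w 0‖ + 1) :=
            mul_le_mul (hclk c) (by linarith) (norm_nonneg _) hκ0.le
        _ = ρ / 2 := by rw [hκ]; field_simp
        _ < ρ := by linarith
  obtain ⟨Ψ, hΨc, hΨ, hΨγ⟩ := exists_equivariant_extension h hγc hγ1
  refine ⟨Ψ, hΨc, hΨ, fun u hu => ?_, ?_⟩
  · rw [hΨγ u hu]; simp [hγ, hcl0]
  have hR : ∀ k < N, ∀ u c : ℝ, N * u ∈ Icc (k : ℝ) (k + 1) → |c| < κ →
      Ψ (u, c) = v k + ((N * u - k : ℝ) : ℂ) * (v (k + 1) - v k) +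
        c * (w k + ((N * u - k : ℝ) : ℂ) * (w (k + 1) - w k)) := fun k hk u c hu hc => by
    have hkN : (k : ℝ) + 1 ≤ N := by exact_mod_cast hk
    have hk0 : (0 : ℝ) ≤ k := Nat.cast_nonneg _
    rw [hΨγ u ⟨by
      by_contra hneg
      push Not at hneg
      have := mul_neg_of_pos_of_neg hN0 hneg
      linarith [hu.1], by
      by_contra hneg
      push Not at hneg
      have := mul_lt_mul_of_pos_left hneg hN0
      linarith [hu.2]⟩]
    simp only [hγ]
    rw [hcle c hc, piecewiseAffine_eq v hk hu, piecewiseAffine_eq w hk hu]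
  have hL : ∀ k < N, ∀ u c : ℝ, N * u ∈ Icc (k : ℝ) (k + 1) → |c| < κ →
      Ψ (u, c) = v (k + 1) + ((N * u - (k + 1) : ℝ) : ℂ) * (v (k + 1) - v k) +
        c * (w (k + 1) + ((N * u - (k + 1) : ℝ) : ℂ) * (w (k + 1) - w k)) :=
    fun k hk u c hu hc => by
    rw [hR k hk u c hu hc]
    push_cast; ring
  have hcrit : ∀ (u₀ : ℝ) (p d₁ d₂ w e₁ e₂ : ℂ), 0 < areaForm d₁ w → 0 < areaForm d₂ w →
      (∀ᶠ t : ℝ × ℝ in 𝓝 (u₀, 0), Ψ t = bentStrip p d₁ d₂ w e₁ e₂ (N * (t.1 - u₀), t.2)) →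
      ∃ U ∈ 𝓝 ((u₀, 0) : ℝ × ℝ), InjOn Ψ U := by
    intro u₀ p d₁ d₂ w e₁ e₂ h1 h2 h3
    obtain ⟨U, hU, hUi⟩ := exists_injOn_bentStrip (p := p) (e₁ := e₁) (e₂ := e₂) h1 h2
    have hcont : Tendsto (fun t : ℝ × ℝ => ((N * (t.1 - u₀), t.2) : ℝ × ℝ)) (𝓝 (u₀, 0))
        (𝓝 0) := by
      have : Continuous (fun t : ℝ × ℝ => ((N * (t.1 - u₀), t.2) : ℝ × ℝ)) := by fun_prop
      have h4 := this.tendsto (u₀, 0)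
      simp only [sub_self, mul_zero] at h4
      exact h4
    refine ⟨_, inter_mem (hcont hU) h3, ?_⟩
    rintro ⟨u, c⟩ ⟨hs1, hs2⟩ ⟨u', c'⟩ ⟨ht1, ht2⟩ he
    have hs3 : Ψ (u, c) = _ := hs2
    have ht3 : Ψ (u', c') = _ := ht2
    rw [hs3, ht3] at he
    have h5 := hUi hs1 ht1 he
    simp only [Prod.mk.injEq, mul_eq_mul_left_iff, hN0.ne', or_false, sub_left_inj] at h5
    rw [h5.1, h5.2]
  have hnc : ∀ u₀ : ℝ, ∀ᶠ t : ℝ × ℝ in 𝓝 (u₀, 0), |t.2| < κ := fun u₀ => by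
    have : Continuous fun t : ℝ × ℝ => |t.2| := by fun_prop
    exact (this.tendsto (u₀, 0)).eventually (gt_mem_nhds (by simpa using hκ0))
  have hnu : ∀ u₀ a b : ℝ, a < N * u₀ → N * u₀ < b →
      ∀ᶠ t : ℝ × ℝ in 𝓝 (u₀, 0), N * t.1 ∈ Ioo a b := fun u₀ a b ha hb => by
    have : Continuous fun t : ℝ × ℝ => N * t.1 := by fun_prop
    exact (this.tendsto (u₀, 0)).eventually (Ioo_mem_nhds ha hb)
  have hfund : ∀ u₀ ∈ Ico (0 : ℝ) 1, ∃ U ∈ 𝓝 ((u₀, 0) : ℝ × ℝ), InjOn Ψ U := by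
    intro u₀ hu₀
    set k := ⌊N * u₀⌋₊ with hk
    have hk1 : (k : ℝ) ≤ N * u₀ := Nat.floor_le (mul_nonneg hN0.le hu₀.1)
    have hk2 : N * u₀ < k + 1 := Nat.lt_floor_add_one _
    have hkN : k < N := by
      have : (k : ℝ) < N := hk1.trans_lt (by nlinarith [hu₀.2])
      exact_mod_cast this
    rcases hk1.lt_or_eq with hlt | heq
    · set r : ℝ := N * u₀ - k with hr
      have hdw : 0 < areaForm (v (k + 1) - v k) (w k + r * (w (k + 1) - w k)) := by
        have h1 : areaForm (v (k + 1) - v k) (w k + r * (w (k + 1) - w k)) =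
            (1 - r) * areaForm (v (k + 1) - v k) (w k) +
              r * areaForm (v (k + 1) - v k) (w (k + 1)) := by
          simp only [areaForm, Complex.add_re, Complex.add_im, Complex.re_ofReal_mul,
            Complex.im_ofReal_mul, Complex.sub_re, Complex.sub_im]
          ring
        rw [h1]
        have h2 := hdet k hkN
        have h3 : 0 < r := sub_pos.2 hlt
        have h4 : 0 < 1 - r := by rw [hr]; linarith
        exact add_pos (mul_pos h4 h2.1) (mul_pos h3 h2.2)
      refine hcrit u₀ (v k + r * (v (k + 1) - v k)) _ _ _ (w (k + 1) - w k) (w (k + 1) - w k)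
        hdw hdw ?_
      filter_upwards [hnc u₀, hnu u₀ k (k + 1) hlt hk2] with t ht1 ht2
      rw [hR k hkN t.1 t.2 ⟨ht2.1.le, ht2.2.le⟩ ht1, bentStrip]
      have h1 : ((max (N * (t.1 - u₀)) 0 : ℝ) : ℂ) + ((min (N * (t.1 - u₀)) 0 : ℝ) : ℂ) =
          ((N * t.1 - k : ℝ) : ℂ) - r := by
        rw [← Complex.ofReal_add, max_add_min, ← Complex.ofReal_sub]
        congr 1
        rw [hr]; ring
      linear_combination (-(v (k + 1) - v k) - t.2 * (w (k + 1) - w k)) * h1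
    · have hright : ∀ t : ℝ × ℝ, |t.2| < κ → N * t.1 ∈ Icc (k : ℝ) (k + 1) → ∀ d e,
          Ψ t = bentStrip (v k) (v (k + 1) - v k) d (w k) (w (k + 1) - w k) e
            (N * (t.1 - u₀), t.2) := by
        intro t ht1 ht2 d e
        have h1 : N * (t.1 - u₀) = N * t.1 - k := by rw [heq]; ring
        rw [hR k hkN t.1 t.2 ht2 ht1, bentStrip, h1]
        simp only
        rw [max_eq_left (by linarith [ht2.1]), min_eq_right (by linarith [ht2.1])]
        simp
      rcases Nat.eq_zero_or_pos k with hk0 | hk0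
      · have hu0 : u₀ = 0 := by
          rw [hk0, Nat.cast_zero] at heq
          exact (mul_eq_zero.1 heq.symm).resolve_left hN0.ne'
        have hd := hdet (N - 1) (by omega)
        rw [hNN', hvN, hwN] at hd
        have hd' : 0 < areaForm (μ⁻¹ * (h x - v (N - 1))) (w 0) := by
          have h1 := areaForm_mul_left μ (μ⁻¹ * (h x - v (N - 1))) (w 0)
          rw [mul_inv_cancel_left₀ hμ] at h1
          have h2 := hd.2
          rw [h1] at h2
          exact pos_of_mul_pos_right h2 (by positivity)
        set e := μ⁻¹ * (w N - w (N - 1)) with he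
        have hd0 := (hdet k hkN).1
        rw [hk0] at hd0 hright
        refine hcrit u₀ (v 0) (v (0 + 1) - v 0) (μ⁻¹ * (h x - v (N - 1))) (w 0)
          (w (0 + 1) - w 0) e hd0 hd' ?_
        have hBc : Continuous fun t : ℝ × ℝ => bentStrip (v 0) (v (0 + 1) - v 0)
            (μ⁻¹ * (h x - v (N - 1))) (w 0) (w (0 + 1) - w 0) e (N * (t.1 - u₀), t.2) := by
          unfold bentStrip
          fun_prop
        have hB0 := hBc.tendsto (u₀, 0)
        simp only [sub_self, mul_zero] at hB0
        have hB1 : bentStrip (v 0) (v (0 + 1) - v 0)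
            (μ⁻¹ * (h x - v (N - 1))) (w 0) (w (0 + 1) - w 0) e (0, 0) = x := by
          simp [bentStrip, hv0]
        rw [hB1] at hB0
        filter_upwards [hnc u₀, hnu u₀ (-1) 1 (by rw [hu0]; simp) (by rw [hu0]; simp),
          hB0.eventually hlin] with t ht1 ht2 ht3
        rcases le_total 0 (N * t.1) with hle | hle
        · exact hright t ht1 (by simpa using ⟨hle, ht2.2.le⟩) _ _
        · apply h.injective
          rw [ht3]
          have h1 : N * (t.1 + 1) ∈ Icc ((N - 1 : ℕ) : ℝ) ((N - 1 : ℕ) + 1) := by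
            constructor <;> nlinarith [ht2.1]
          rw [show t = (t.1, t.2) from rfl, ← hΨ, hL (N - 1) (by omega) (t.1 + 1) t.2 h1 ht1,
            bentStrip, hu0]
          simp only [sub_zero]
          rw [max_eq_right hle, min_eq_left hle, hNN', hv0, hvN, hNN, he, hwN]
          rw [show (N : ℝ) * (t.1 + 1) - N = N * t.1 by ring]
          field_simp
          push_cast
          ring
      · obtain ⟨j, hj⟩ : ∃ j, k = j + 1 := ⟨k - 1, by omega⟩
        have hjk : (k : ℝ) = j + 1 := by rw [hj]; push_cast; ring
        have hd := (hdet j (by omega)).2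
        rw [← hj] at hd
        refine hcrit u₀ (v k) _ _ _ (w (k + 1) - w k) (w k - w j) (hdet k hkN).1 hd ?_
        filter_upwards [hnc u₀, hnu u₀ j (k + 1) (by linarith) hk2] with t ht1 ht2
        rcases le_total (k : ℝ) (N * t.1) with hle | hle
        · exact hright t ht1 ⟨hle, ht2.2.le⟩ _ _
        · have h1 : N * (t.1 - u₀) = N * t.1 - k := by rw [heq]; ring
          rw [show Ψ t = Ψ (t.1, t.2) from rfl,
            hL j (by omega) t.1 t.2 ⟨ht2.1.le, by linarith⟩ ht1, bentStrip, h1]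
          simp only
          rw [max_eq_right (by linarith), min_eq_left (by linarith), ← hj, hjk]
          simp
  intro u₀
  obtain ⟨U, hU, hUi⟩ := hfund (Int.fract u₀) ⟨Int.fract_nonneg _, Int.fract_lt_one _⟩
  set n : ℤ := ⌊u₀⌋ with hn
  have hcont : Tendsto (fun t : ℝ × ℝ => ((t.1 - n, t.2) : ℝ × ℝ)) (𝓝 (u₀, 0))
      (𝓝 (Int.fract u₀, 0)) := by
    have : Continuous (fun t : ℝ × ℝ => ((t.1 - n, t.2) : ℝ × ℝ)) := by fun_prop
    exact this.tendsto (u₀, 0)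
  refine ⟨_, hcont hU, ?_⟩
  rintro ⟨u, c⟩ hs ⟨u', c'⟩ ht he
  have h1 := equivariant_zpow hΨ n (u - n) c
  have h2 := equivariant_zpow hΨ n (u' - n) c'
  rw [sub_add_cancel] at h1 h2
  rw [h1, h2] at he
  have h3 := hUi hs ht ((h ^ n).injective he)
  simp only [Prod.mk.injEq, sub_left_inj] at h3
  rw [h3.1, h3.2]

end

section

open Metric

/-- An equivariant strip embedded on a long enough piece is embedded. -/
theorem injOn_equivariant_strip {h : ℂ ≃ₜ ℂ} (hw : WindowProperty h) {Ψ : ℝ × ℝ → ℂ}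
    (hΨc : Continuous Ψ) (hΨ : ∀ u c, Ψ (u + 1, c) = h (Ψ (u, c))) {ε : ℝ} (hε : ε ≤ 1 / 4)
    (hinj : InjOn Ψ (Icc (-5 : ℝ) 6 ×ˢ Ioo (-ε) ε)) : InjOn Ψ (univ ×ˢ Ioo (-ε) ε) := by
  have hcurve : ∀ (f : ℝ → ℝ) (κ : ℝ), Continuous f → (∀ u, f (u + 1) = f u) →
      (∀ u, f u ∈ Ioo (-ε) ε) → κ ∈ Icc (0 : ℝ) 1 →
      Function.Injective fun u => Ψ (u - κ * f u, f u) := by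
    intro f κ hfc hf hfε hκ
    refine hw _ (by fun_prop) (fun u => ?_) ?_
    · simp only [hf]
      rw [← hΨ]; ring_nf
    · have hmem : ∀ u ∈ Ico (0 : ℝ) 2,
          (u - κ * f u, f u) ∈ Icc (-5 : ℝ) 6 ×ˢ Ioo (-ε) ε := fun u hu => by
        have h1 := hfε u
        have h2 : |κ * f u| ≤ 1 / 4 := by
          rw [abs_mul, abs_of_nonneg hκ.1]
          have := (abs_lt.2 h1).le.trans hε
          nlinarith [hκ.1, hκ.2, abs_nonneg (f u)]
        have h3 := abs_le.1 h2
        exact ⟨⟨by linarith [hu.1], by linarith [hu.2]⟩, h1⟩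
      intro u hu u' hu' he
      have h1 := hinj (hmem u hu) (hmem u' hu') he
      simp only [Prod.mk.injEq] at h1
      rw [h1.2] at h1
      linarith [h1.1]
  have hlt : ∀ s t v v' : ℝ, s ≤ t → v ∈ Ioo (-ε) ε → v' ∈ Ioo (-ε) ε →
      Ψ (s, v) = Ψ (t, v') → s = t ∧ v = v' := by
    intro s t v v' hst hv hv' he
    rcases le_or_gt (t - s) 4 with h4 | h4
    · have e1 := equivariant_zpow hΨ (-⌊s⌋) s v
      have e2 := equivariant_zpow hΨ (-⌊s⌋) t v'
      rw [he, ← e2] at e1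
      push_cast at e1
      have h1 := Int.floor_le s
      have h2 := Int.lt_floor_add_one s
      have h3 := hinj (x₁ := (s + -⌊s⌋, v))
        ⟨⟨by simp only; linarith, by simp only; linarith⟩, hv⟩
        ⟨⟨by simp only; linarith, by simp only; linarith⟩, hv'⟩ e1
      simp only [Prod.mk.injEq, add_left_inj] at h3
      exact h3
    · exfalso
      by_cases hvv : v = v'
      · subst hvv
        have h1 := hcurve (fun _ => v) 0 continuous_const (fun _ => rfl) (fun _ => hv)
          ⟨le_rfl, zero_le_one⟩
        have h2 : s = t := h1 (by simpa using he)
        linarith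
      · obtain ⟨κ, hκ, hnint⟩ : ∃ κ ∈ Icc (0 : ℝ) 1,
            Real.sin (Real.pi * (t + κ * v' - (s + κ * v))) ≠ 0 := by
          by_contra hcon
          push Not at hcon
          have h0 := hcon 0 ⟨le_rfl, zero_le_one⟩
          have h1 := hcon 1 ⟨zero_le_one, le_rfl⟩
          obtain ⟨m, hm⟩ := Real.sin_eq_zero_iff.1 h0
          obtain ⟨n, hn⟩ := Real.sin_eq_zero_iff.1 h1
          rw [mul_comm] at hm hn
          have hm' := mul_left_cancel₀ Real.pi_ne_zero hm
          have hn' := mul_left_cancel₀ Real.pi_ne_zero hn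
          have h2 : v' - v = ((n - m : ℤ) : ℝ) := by push_cast; linarith
          have h3 : |v' - v| < 1 := by
            rw [abs_lt]; constructor <;> linarith [hv.1, hv.2, hv'.1, hv'.2]
          rw [h2] at h3
          have h4 : |n - m| < 1 := by exact_mod_cast h3
          have h5 : n - m = 0 := Int.abs_lt_one_iff.1 h4
          rw [h5] at h2
          exact hvv (by push_cast at h2; linarith)
        set S := Real.sin (Real.pi * (t + κ * v' - (s + κ * v))) ^ 2 with hS
        have hS0 : 0 < S := by positivity
        set χ : ℝ → ℝ := fun u => min 1 (Real.sin (Real.pi * (u - (s + κ * v))) ^ 2 / S) with hχ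
        have hχ0 : ∀ u, 0 ≤ χ u := fun u => le_min zero_le_one (by positivity)
        have hχ1 : ∀ u, χ u ≤ 1 := fun u => min_le_left _ _
        set f : ℝ → ℝ := fun u => v + (v' - v) * χ u with hf
        have hfs : f (s + κ * v) = v := by simp [hf, hχ]
        have hft : f (t + κ * v') = v' := by
          simp only [hf, hχ]
          rw [← hS, div_self hS0.ne', min_self]; ring
        have h1 := hcurve f κ (by fun_prop) (fun u => ?_) (fun u => ?_) hκ
        · have h2 : s + κ * v = t + κ * v' := h1 (by
            simp only [hfs, hft, add_sub_cancel_right]; exact he)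
          have h3 : κ * v - κ * v' ≤ 1 := by nlinarith [hκ.1, hκ.2, hv.1, hv.2, hv'.1, hv'.2]
          linarith
        · have : Real.sin (Real.pi * (u + 1 - (s + κ * v))) ^ 2 =
              Real.sin (Real.pi * (u - (s + κ * v))) ^ 2 := by
            rw [show Real.pi * (u + 1 - (s + κ * v)) = Real.pi * (u - (s + κ * v)) + Real.pi by ring,
              Real.sin_add_pi, neg_sq]
          simp only [hf, hχ, this]
        · have h2 := hχ0 u
          have h3 := hχ1 u
          have h4 : f u = (1 - χ u) * v + χ u * v' := by simp only [hf]; ring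
          rw [h4]
          have h5 := (convex_Ioo (-ε) ε) hv hv' (sub_nonneg.2 h3) h2 (by ring)
          simpa using h5
  rintro ⟨s, v⟩ hs ⟨t, v'⟩ ht he
  rcases le_total s t with hle | hle
  · obtain ⟨rfl, rfl⟩ := hlt s t v v' hle hs.2 ht.2 he
    rfl
  · obtain ⟨rfl, rfl⟩ := hlt t s v' v hle ht.2 hs.2 he.symm
    rfl

/-- An equivariant strip which is locally injective along an embedded core is embedded. -/
theorem exists_injOn_strip {h : ℂ ≃ₜ ℂ} (hw : WindowProperty h) {Ψ : ℝ × ℝ → ℂ}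
    (hΨc : Continuous Ψ) (hΨ : ∀ u c, Ψ (u + 1, c) = h (Ψ (u, c)))
    (hloc : ∀ u₀ : ℝ, ∃ U ∈ 𝓝 ((u₀, 0) : ℝ × ℝ), InjOn Ψ U)
    (hcore : Function.Injective fun u => Ψ (u, 0)) :
    ∃ ε : ℝ, 0 < ε ∧ InjOn Ψ (univ ×ˢ Ioo (-ε) ε) := by
  have h1 : InjOn Ψ (Icc (-5 : ℝ) 6 ×ˢ {(0 : ℝ)}) := by
    rintro ⟨u, c⟩ ⟨-, hc⟩ ⟨u', c'⟩ ⟨-, hc'⟩ he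
    simp only [mem_singleton_iff] at hc hc'
    subst hc hc'
    rw [hcore he]
  obtain ⟨t, ht, hti⟩ := h1.exists_mem_nhdsSet (isCompact_Icc.prod isCompact_singleton)
    (fun p _ => hΨc.continuousAt) (by
      rintro ⟨u, c⟩ ⟨-, hc⟩
      simp only [mem_singleton_iff] at hc
      subst hc
      exact hloc u)
  obtain ⟨t', ht'o, ht's, ht't⟩ := mem_nhdsSet_iff_exists.1 ht |>.imp fun _ h => h
  obtain ⟨U, V, -, hV, hU', hV', hUV⟩ := generalized_tube_lemma
    (isCompact_Icc (a := (-5 : ℝ)) (b := 6)) (isCompact_singleton (x := (0 : ℝ))) ht'o ht's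
  obtain ⟨δ, hδ, hb⟩ := Metric.isOpen_iff.1 hV 0 (hV' rfl)
  refine ⟨min δ (1 / 4), by positivity, injOn_equivariant_strip hw hΨc hΨ (min_le_right _ _)
    (hti.mono ((prod_mono hU' fun c hc => ?_).trans (hUV.trans ht't)))⟩
  apply hb
  rw [mem_ball, Real.dist_eq, sub_zero]
  exact (abs_lt.2 hc).trans_le (min_le_left _ _)

/-- A simple polygonal arc meeting its image only at its endpoint generates an embedded line. -/
theorem injective_of_polygonal_arc {h : ℂ ≃ₜ ℂ} (hw : WindowProperty h) {x : ℂ} {N : ℕ}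
    (hN : N ≠ 0) {v : ℕ → ℂ} (hv0 : v 0 = x) (hvN : v N = h x)
    (hne : ∀ i < N, v i ≠ v (i + 1))
    (hsimp : ∀ i j z, i < j → j < N → z ∈ segment ℝ (v i) (v (i + 1)) →
      z ∈ segment ℝ (v j) (v (j + 1)) → j = i + 1 ∧ z = v j)
    (himg : ∀ i < N, ∀ j < N, ∀ z ∈ segment ℝ (v i) (v (i + 1)),
      h z ∈ segment ℝ (v j) (v (j + 1)) → z = x)
    {Γ : ℝ → ℂ} (hΓc : Continuous Γ) (hΓ : ∀ u, Γ (u + 1) = h (Γ u))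
    (hΓv : ∀ u ∈ Icc (0 : ℝ) 1, Γ u = piecewiseAffine v N (N * u)) : Function.Injective Γ := by
  have hN0 : (0 : ℝ) < N := by exact_mod_cast Nat.pos_of_ne_zero hN
  have hpos : ∀ u ∈ Ico (0 : ℝ) 1, ∃ k < N, ∃ r ∈ Ico (0 : ℝ) 1, N * u = k + r ∧
      Γ u = v k + r * (v (k + 1) - v k) := by
    intro u hu
    have hk1 := Nat.floor_le (mul_nonneg hN0.le hu.1)
    have hk2 := Nat.lt_floor_add_one (N * u)
    have hkN : ⌊N * u⌋₊ < N := by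
      have : ((⌊N * u⌋₊ : ℕ) : ℝ) < N := hk1.trans_lt (by nlinarith [hu.2])
      exact_mod_cast this
    refine ⟨_, hkN, N * u - ⌊N * u⌋₊, ⟨by linarith, by linarith⟩, by ring, ?_⟩
    rw [hΓv u ⟨hu.1, hu.2.le⟩, piecewiseAffine_eq v hkN ⟨hk1, hk2.le⟩]
  have hseg : ∀ (k : ℕ) (r : ℝ), r ∈ Ico (0 : ℝ) 1 →
      v k + r * (v (k + 1) - v k) ∈ segment ℝ (v k) (v (k + 1)) := fun k r hr => by
    rw [segment_eq_image']
    exact ⟨r, ⟨hr.1, hr.2.le⟩, by simp⟩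
  have hend : ∀ k < N, ∀ r : ℝ, r ∈ Ico (0 : ℝ) 1 →
      v k + r * (v (k + 1) - v k) ≠ v (k + 1) := fun k hk r hr he => by
    have h1 : (1 - (r : ℂ)) * (v (k + 1) - v k) = 0 := by linear_combination -he
    rcases mul_eq_zero.1 h1 with h2 | h2
    · have h3 : (r : ℂ) = 1 := (sub_eq_zero.1 h2).symm
      have h4 : r = 1 := by exact_mod_cast h3
      linarith [hr.2]
    · exact hne k hk (sub_eq_zero.1 h2).symm
  have hinj1 : ∀ s ∈ Ico (0 : ℝ) 1, ∀ t ∈ Ico (0 : ℝ) 1, Γ s = Γ t → s = t := by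
    have hlt : ∀ i j : ℕ, i < j → j < N → ∀ r ∈ Ico (0 : ℝ) 1, ∀ r' ∈ Ico (0 : ℝ) 1,
        v i + r * (v (i + 1) - v i) ≠ v j + r' * (v (j + 1) - v j) := by
      intro i j hij hj r hr r' hr' he
      have h1 := hseg i r hr
      have h2 := hseg j r' hr'
      rw [← he] at h2
      obtain ⟨rfl, h3⟩ := hsimp i j _ hij hj h1 h2
      exact hend i (by omega) r hr h3
    intro s hs t ht he
    obtain ⟨i, hi, r, hr, hsr, hΓs⟩ := hpos s hs
    obtain ⟨j, hj, r', hr', htr, hΓt⟩ := hpos t ht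
    rw [hΓs, hΓt] at he
    rcases lt_trichotomy i j with hij | rfl | hij
    · exact absurd he (hlt i j hij hj r hr r' hr')
    · have h1 := mul_right_cancel₀ (sub_ne_zero.2 (hne i hi).symm) (add_left_cancel he)
      have h2 : r = r' := by exact_mod_cast h1
      have h3 : N * s = N * t := by rw [hsr, htr, h2]
      exact mul_left_cancel₀ hN0.ne' h3
    · exact absurd he.symm (hlt j i hij hi r' hr' r hr)
  have hΓ0 : Γ 0 = x := by
    obtain ⟨k, hk, r, hr, h1, h2⟩ := hpos 0 ⟨le_rfl, zero_lt_one⟩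
    rw [mul_zero] at h1
    have hk0 : (0 : ℝ) ≤ k := Nat.cast_nonneg _
    have hr0 : r = 0 := by linarith [hr.1]
    have hk1 : (k : ℝ) = 0 := by linarith [hr.1]
    have hk2 : k = 0 := by exact_mod_cast hk1
    rw [h2, hr0, hk2, hv0]; simp
  have hcross : ∀ s ∈ Ico (0 : ℝ) 1, ∀ t ∈ Ico (0 : ℝ) 1, Γ s ≠ h (Γ t) := by
    intro s hs t ht he
    obtain ⟨j, hj, r', hr', -, hΓs⟩ := hpos s hs
    obtain ⟨i, hi, r, hr, -, hΓt⟩ := hpos t ht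
    have h1 := hseg i r hr
    rw [← hΓt] at h1
    have h2 := hseg j r' hr'
    have h3 := h2
    rw [← hΓs, he] at h3
    have h4 := himg i hi j hj _ h1 h3
    rw [hΓs, h4, ← hvN] at he
    rcases (Nat.le_sub_one_of_lt hj).lt_or_eq with h5 | h5
    · have hNN : N - 1 + 1 = N := by omega
      rw [he] at h2
      obtain ⟨-, h6⟩ := hsimp j (N - 1) _ h5 (by omega) h2
        (by rw [hNN]; exact right_mem_segment _ _ _)
      exact hne (N - 1) (by omega) (by rw [hNN, h6])
    · have hNN : j + 1 = N := by omega
      refine hend j hj r' hr' ?_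
      rw [he, hNN]
  refine hw Γ hΓc hΓ ?_
  have hsh : ∀ t : ℝ, Γ t = h (Γ (t - 1)) := fun t => by rw [← hΓ, sub_add_cancel]
  intro s hs t ht he
  rcases lt_or_ge s 1 with h1 | h1 <;> rcases lt_or_ge t 1 with h2 | h2
  · exact hinj1 s ⟨hs.1, h1⟩ t ⟨ht.1, h2⟩ he
  · rw [hsh t] at he
    exact absurd he (hcross s ⟨hs.1, h1⟩ _ ⟨by linarith, by linarith [ht.2]⟩)
  · rw [hsh s] at he
    exact absurd he.symm (hcross t ⟨ht.1, h2⟩ _ ⟨by linarith, by linarith [hs.2]⟩)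
  · rw [hsh s, hsh t] at he
    have := hinj1 (s - 1) ⟨by linarith, by linarith [hs.2]⟩ (t - 1)
      ⟨by linarith, by linarith [ht.2]⟩ (h.injective he)
    linarith

end

section

open Metric

theorem exists_strip_of_linear {h : ℂ ≃ₜ ℂ} (hfp : ∀ z, h z ≠ z) (hw : WindowProperty h) {x μ : ℂ}
    (hμ : μ ≠ 0) (hlin : ∀ᶠ z in 𝓝 x, h z = h x + μ * (z - x)) :
    ∃ (Ψ : ℝ × ℝ → ℂ) (ε : ℝ), 0 < ε ∧ Continuous Ψ ∧ (∀ u c, Ψ (u + 1, c) = h (Ψ (u, c))) ∧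
      Ψ (0, 0) = x ∧ InjOn Ψ (univ ×ˢ Ioo (-ε) ε) := by
  obtain ⟨N, v, p, q, hN, hv0, hvN, hpq, hpq', ⟨s, hs, hs1⟩, ⟨s', hs', hs1'⟩, hne, hsimp, himg⟩ :=
    exists_polygonal_arc hfp hw hlin
  have hNN : N - 1 + 1 = N := by omega
  have hd : ∀ i < N, v (i + 1) - v i ≠ 0 := fun i hi => sub_ne_zero.2 (hne i hi).symm
  have hex : ∀ k, ∃ w, (k = 0 → 0 < areaForm (μ⁻¹ * (v N - v (N - 1))) w ∧
      0 < areaForm (v 1 - v 0) w) ∧ (0 < k → k < N → 0 < areaForm (v k - v (k - 1)) w ∧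
      0 < areaForm (v (k + 1) - v k) w) := by
    intro k
    rcases Nat.eq_zero_or_pos k with rfl | hk
    · have h1 : μ⁻¹ * (v N - v (N - 1)) ≠ 0 := by
        have := hd (N - 1) (by omega)
        rw [hNN] at this
        exact mul_ne_zero (inv_ne_zero hμ) this
      obtain ⟨w, hw⟩ := exists_areaForm_pos h1 (hd 0 (by omega)) (by
        intro t ht he
        rw [zero_add, hs1, hv0, hvN, hs1'] at he
        have h2 : (s : ℂ) * q = ((t * s' : ℝ) : ℂ) * p := by
          push_cast
          linear_combination he + t * s' * p * inv_mul_cancel₀ hμ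
        have h3 := congrArg norm h2
        rw [norm_mul, norm_mul, Complex.norm_real, Complex.norm_real, Real.norm_eq_abs,
          Real.norm_eq_abs, abs_of_pos hs, abs_of_pos (by positivity), hpq] at h3
        rcases eq_or_ne q 0 with hq | hq
        · rw [hq, norm_zero, norm_eq_zero] at hpq
          exact hpq' (hpq.trans hq.symm)
        · have h4 := mul_right_cancel₀ (norm_ne_zero_iff.2 hq) h3
          rw [← h4] at h2
          exact hpq' (mul_left_cancel₀ (by exact_mod_cast hs.ne') h2).symm)
      exact ⟨w, fun _ => hw, fun h => absurd h (lt_irrefl _)⟩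
    · by_cases hkN : k < N
      · have h1 := hd (k - 1) (by omega)
        have hkk : k - 1 + 1 = k := by omega
        rw [hkk] at h1
        obtain ⟨w, hw⟩ := exists_areaForm_pos h1 (hd k hkN) (by
          intro t ht he
          set r := min 1 t with hr
          have hr0 : 0 < r := lt_min one_pos ht
          have hr1 : r ≤ 1 := min_le_left _ _
          have hrt : r ≤ t := min_le_right _ _
          have htc : (t : ℂ) ≠ 0 := by exact_mod_cast ht.ne'
          obtain ⟨-, h2⟩ := hsimp (k - 1) k (v k - r * (v k - v (k - 1))) (by omega) hkN
            (by
              rw [hkk, segment_symm, segment_eq_image']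
              refine ⟨r, ⟨hr0.le, hr1⟩, ?_⟩
              simp only [Complex.real_smul]; ring)
            (by
              rw [segment_eq_image']
              refine ⟨r / t, ⟨by positivity, (div_le_one ht).2 hrt⟩, ?_⟩
              simp only [Complex.real_smul]
              rw [he]; push_cast; field_simp; ring)
          have h3 : (r : ℂ) * (v k - v (k - 1)) = 0 := by linear_combination -h2
          rcases mul_eq_zero.1 h3 with h4 | h4
          · exact hr0.ne' (by exact_mod_cast h4)
          · exact h1 h4)
        exact ⟨w, fun h => absurd h hk.ne', fun _ _ => hw⟩
      · exact ⟨0, fun h => absurd h hk.ne', fun _ h => absurd h hkN⟩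
  choose w hw0 hw1 using hex
  set w' : ℕ → ℂ := fun k => if k = N then μ * w 0 else w k with hw'
  have hw'N : w' N = μ * w' 0 := by
    simp [hw', show (0 : ℕ) ≠ N by omega]
  have hw'k : ∀ k, k < N → w' k = w k := fun k hk => by simp [hw', hk.ne]
  obtain ⟨Ψ, hΨc, hΨ, hΨv, hloc⟩ := exists_local_strip hμ hlin (by omega) hv0 hvN hw'N (by
    intro k hk
    constructor
    · rw [hw'k k hk]
      rcases Nat.eq_zero_or_pos k with rfl | hk0
      · exact (hw0 0 rfl).2
      · exact (hw1 k hk0 hk).2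
    · rcases (Nat.succ_le_of_lt hk).lt_or_eq with h1 | h1
      · rw [hw'k _ h1]
        exact (hw1 (k + 1) (Nat.succ_pos _) h1).1
      · have h2 : k + 1 = N := h1
        have h3 : k = N - 1 := by omega
        rw [h2, hw'N, hw'k 0 (by omega), h3]
        have h4 := areaForm_mul_left μ (μ⁻¹ * (v N - v (N - 1))) (w 0)
        rw [mul_inv_cancel_left₀ hμ] at h4
        rw [h4]
        exact mul_pos (by have := norm_pos_iff.2 hμ; positivity) (hw0 0 rfl).1)
  have hcore : Function.Injective fun u => Ψ (u, 0) :=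
    injective_of_polygonal_arc hw (by omega) hv0 hvN hne hsimp himg (by fun_prop)
      (fun u => hΨ u 0) hΨv
  obtain ⟨ε, hε, hinj⟩ := exists_injOn_strip hw hΨc hΨ hloc hcore
  refine ⟨Ψ, ε, hε, hΨc, hΨ, ?_, hinj⟩
  rw [hΨv 0 ⟨le_rfl, zero_le_one⟩, mul_zero,
    piecewiseAffine_eq v (k := 0) (by omega) (by simp)]
  simp [hv0]

/-- Brouwer's plane translation theorem: every point lies in an embedded equivariant strip. -/
theorem SlopeLog.exists_strip {h : ℂ ≃ₜ ℂ} (S : SlopeLog h) (hfp : ∀ z, h z ≠ z) (x : ℂ) :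
    ∃ (Ψ : ℝ × ℝ → ℂ) (ε : ℝ), 0 < ε ∧ Continuous Ψ ∧ (∀ u c, Ψ (u + 1, c) = h (Ψ (u, c))) ∧
      Ψ (0, 0) = x ∧ InjOn Ψ (univ ×ˢ Ioo (-ε) ε) := by
  have hw : WindowProperty h := fun Γ hc hΓ hi => S.injective_of_window h.injective hc hΓ hi
  have hx : 0 < ‖x - h x‖ := norm_pos_iff.2 (sub_ne_zero.2 (hfp x).symm)
  obtain ⟨g, μ, hμ, hg, hlin⟩ := S.exists_linearization x (half_pos hx)
  have hnear : ∀ᶠ z in 𝓝 x, g z = z := by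
    have hc : Continuous fun z => ‖z - h x‖ := by fun_prop
    filter_upwards [(hc.tendsto x).eventually (lt_mem_nhds (half_lt_self hx))] with z hz
    exact hg z hz.le
  have hgx : g x = x := hnear.self_of_nhds
  have hghx : g (h x) = h x := by simpa using hlin.self_of_nhds
  set h₁ : ℂ ≃ₜ ℂ := (g.symm.trans h).trans g with hh₁
  have hh₁a : ∀ z, h₁ z = g (h (g.symm z)) := fun z => rfl
  have hfp₁ : ∀ z, h₁ z ≠ z := fun z hz => by
    rw [hh₁a] at hz
    apply hfp (g.symm z)
    rw [← g.symm_apply_apply (h (g.symm z)), hz]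
  have hw₁ : WindowProperty h₁ := by
    intro Γ hc hΓ hi
    have h1 := hw (fun u => g.symm (Γ u)) (g.symm.continuous.comp hc) (fun u => by
      simp only [hΓ, hh₁a, Homeomorph.symm_apply_apply]) (fun s hs t ht he =>
        hi hs ht (g.symm.injective he))
    exact fun s t he => h1 (congrArg g.symm he)
  have hsx : g.symm x = x := by rw [Homeomorph.symm_apply_eq, hgx]
  have hlin₁ : ∀ᶠ z in 𝓝 x, h₁ z = h₁ x + μ * (z - x) := by
    filter_upwards [hnear, hlin] with z hz1 hz2
    have h1 : g.symm z = z := by rw [Homeomorph.symm_apply_eq, hz1]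
    rw [hh₁a, hh₁a, h1, hsx, hz2, hghx]
  obtain ⟨Ψ, ε, hε, hΨc, hΨ, hΨ0, hinj⟩ := exists_strip_of_linear hfp₁ hw₁ hμ hlin₁
  refine ⟨fun s => g.symm (Ψ s), ε, hε, g.symm.continuous.comp hΨc, fun u c => ?_, ?_,
    fun s hs t ht he => hinj hs ht (g.symm.injective he)⟩
  · simp only [hΨ, hh₁a, Homeomorph.symm_apply_apply]
  · simp only [hΨ0, hsx]

end

section

open Metric

/-- An injective continuous equivariant map of the plane parametrizes a translation domain. -/
theorem isTranslationDomain_range (h : BrouwerHomeo) {F : Plane → Plane} (hF : Continuous F)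
    (hi : Function.Injective F)
    (he : ∀ u c, F (u + 1, c) = h.toHomeomorph (F (u, c))) :
    IsTranslationDomain h (range F) := by
  set e : ℂ ≃ₜ Plane := Complex.equivRealProdCLM.toHomeomorph with hedef
  have hopen : IsOpenMap F := by
    intro U hU
    have h1 := isOpen_image_of_injOn (f := fun z => e.symm (F (e z))) (hU.preimage e.continuous)
      (by fun_prop) (fun s _ t _ hst => e.injective (hi (e.symm.injective hst)))
    have h2 : F '' U = e '' ((fun z => e.symm (F (e z))) '' (e ⁻¹' U)) := by
      ext z
      constructor
      · rintro ⟨p, hp, rfl⟩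
        exact ⟨e.symm (F p), ⟨e.symm p, by simpa using hp, by simp⟩, by simp⟩
      · rintro ⟨_, ⟨w, hw, rfl⟩, rfl⟩
        exact ⟨e w, hw, by simp⟩
    rw [h2]
    exact e.isOpenMap _ h1
  have hemb : IsOpenEmbedding F := .of_continuous_injective_isOpenMap hF hi hopen
  set Φ : Plane ≃ₜ range F := hemb.isEmbedding.toHomeomorph with hΦ
  have hΦa : ∀ p, (Φ p : Plane) = F p := fun p => rfl
  refine ⟨hemb.isOpen_range, isConnected_range hF, ?_, ?_, Φ.symm, fun x hx hx' => ?_⟩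
  · have : ContractibleSpace (range F) := Φ.symm.contractibleSpace
    infer_instance
  · ext z
    constructor
    · rintro ⟨_, ⟨⟨u, c⟩, rfl⟩, rfl⟩
      exact ⟨_, he u c⟩
    · rintro ⟨⟨u, c⟩, rfl⟩
      exact ⟨_, ⟨(u - 1, c), rfl⟩, by rw [← he, sub_add_cancel]⟩
  · apply Φ.injective
    rw [Homeomorph.apply_symm_apply]
    apply Subtype.ext
    rw [hΦa, he, Prod.mk.eta, ← hΦa, Homeomorph.apply_symm_apply]

/-- Brouwer's plane translation theorem. -/
theorem exists_isTranslationDomain (h : BrouwerHomeo) (x : Plane) :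
    ∃ O, IsTranslationDomain h O ∧ x ∈ O := by
  set e : ℂ ≃ₜ Plane := Complex.equivRealProdCLM.toHomeomorph with hedef
  obtain ⟨H, hHc, hH0, hH1⟩ := h.orientationPreserving
  set K : ℝ → ℂ ≃ₜ ℂ := fun t => (e.trans (H t)).trans e.symm with hK
  have hK1 : ∀ z, K 1 z = e.symm (h.toHomeomorph (e z)) := fun z => by rw [hK, ← hH1]; rfl
  have hfp : ∀ z, K 1 z ≠ z := fun z hz => by
    rw [hK1, Homeomorph.symm_apply_eq] at hz
    exact h.fixedPointFree _ hz
  have hKc : Continuous fun p : ℝ × ℂ => K p.1 p.2 := by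
    have : Continuous fun p : ℝ × ℂ => e.symm (H p.1 (e p.2)) :=
      e.symm.continuous.comp (hHc.comp (continuous_fst.prodMk (e.continuous.comp continuous_snd)))
    exact this
  have hK0 : K 0 = Homeomorph.refl ℂ := by
    ext z
    simp [hK, hH0]
  obtain ⟨S⟩ := nonempty_slopeLog hKc hK0 hfp
  obtain ⟨Ψ, ε, hε, hΨc, hΨ, hΨ0, hinj⟩ := S.exists_strip hfp (e.symm x)
  have hmem : ∀ c : ℝ, 2 * ε / Real.pi * Real.arctan c ∈ Ioo (-ε) ε := fun c => by
    have h1 := Real.neg_pi_div_two_lt_arctan c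
    have h2 := Real.arctan_lt_pi_div_two c
    have h3 : 0 < 2 * ε / Real.pi := by positivity
    have h4 : 2 * ε / Real.pi * (Real.pi / 2) = ε := by field_simp
    constructor <;> nlinarith
  have hc : Continuous fun p : Plane =>
      e (Ψ (p.1, 2 * ε / Real.pi * Real.arctan p.2)) := by
    fun_prop
  refine ⟨_, isTranslationDomain_range h hc ?_ fun u c => ?_, (0, 0), ?_⟩
  · rintro ⟨u, c⟩ ⟨u', c'⟩ he
    have h1 := hinj (mk_mem_prod (mem_univ _) (hmem c)) (mk_mem_prod (mem_univ _) (hmem c'))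
      (e.injective he)
    simp only [Prod.mk.injEq] at h1
    have h2 := mul_left_cancel₀ (show 2 * ε / Real.pi ≠ 0 by positivity) h1.2
    rw [h1.1, Real.arctan_injective h2]
  · simp only [hΨ, hK1, Homeomorph.apply_symm_apply]
  · simp [hΨ0]

theorem BrouwerHomeo.iter_succ (h : BrouwerHomeo) (n : ℕ) (z : Plane) :
    h.iter (n + 1 : ℕ) z = h.toHomeomorph (h.iter n z) := by
  rw [BrouwerHomeo.iter, BrouwerHomeo.iter, Nat.cast_succ, add_comm, zpow_one_add]
  rfl

theorem BrouwerHomeo.iter_zero (h : BrouwerHomeo) (z : Plane) : h.iter 0 z = z := by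
  simp [BrouwerHomeo.iter]

theorem IsTranslationDomain.iter_mem {h : BrouwerHomeo} {O : Set Plane}
    (hO : IsTranslationDomain h O) {z : Plane} (hz : z ∈ O) (n : ℕ) : h.iter n z ∈ O := by
  induction n with
  | zero => simpa [h.iter_zero] using hz
  | succ k ih =>
    rw [h.iter_succ, ← hO.2.2.2.1]
    exact mem_image_of_mem _ ih

/-- A translation has no singular pairs. -/
theorem SingularPair.notMem_of_isTranslationDomain {h : BrouwerHomeo} {x y : Plane}
    (hs : SingularPair h x y) {O : Set Plane} (hO : IsTranslationDomain h O) (hx : x ∈ O) :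
    y ∉ O := by
  intro hy
  obtain ⟨Φ, hΦ⟩ := hO.2.2.2.2
  have hiter : ∀ (n : ℕ) (z : Plane) (hz : z ∈ O),
      (Φ ⟨h.iter n z, hO.iter_mem hz n⟩).1 = (Φ ⟨z, hz⟩).1 + n := by
    intro n z hz
    induction n with
    | zero => simp [h.iter_zero]
    | succ k ih =>
      have h1 : h.toHomeomorph (h.iter k z) ∈ O := by
        rw [← h.iter_succ]; exact hO.iter_mem hz _
      have h2 := hΦ _ (hO.iter_mem hz k) h1
      simp only [h.iter_succ, h2, ih]
      push_cast; ring
  have hnhds : ∀ (z : Plane) (hz : z ∈ O) (s : Set ℝ), s ∈ 𝓝 (Φ ⟨z, hz⟩).1 →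
      Subtype.val '' {w : O | (Φ w).1 ∈ s} ∈ 𝓝 z := fun z hz s hs => by
    have h1 : Continuous fun w : O => (Φ w).1 := by fun_prop
    exact (hO.1.isOpenEmbedding_subtypeVal.isOpenMap).image_mem_nhds
      (x := ⟨z, hz⟩) ((h1.tendsto ⟨z, hz⟩) hs)
  set a := (Φ ⟨x, hx⟩).1
  set b := (Φ ⟨y, hy⟩).1
  obtain ⟨n, hn, _, ⟨_, ⟨w, hw, rfl⟩, rfl⟩, ⟨w', hw', he⟩⟩ := hs.2 _
    (hnhds x hx (Ioi (a - 1)) (Ioi_mem_nhds (by linarith))) _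
    (hnhds y hy (Iio (b + 1)) (Iio_mem_nhds (by linarith))) ⌈b - a + 2⌉₊
  have h1 := hiter n w w.2
  have h2 : w' = ⟨h.iter n w, hO.iter_mem w.2 n⟩ := Subtype.ext he
  rw [← h2] at h1
  have h3 : (Φ w').1 < b + 1 := hw'
  have h4 : a - 1 < (Φ w).1 := hw
  have h5 : b - a + 2 ≤ n := (Nat.le_ceil _).trans (by exact_mod_cast hn)
  linarith

end

/-- For a singular pair `(x, y)`, one has `d_h(x, y) = 2` and `y` lies
on the frontier of the `h`-ball `B₁(x)`. -/
theorem singular_pair_dist_two (h : BrouwerHomeo) (x y : Plane)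
    (hsing : SingularPair h x y) :
    transDist h x y = 2 ∧ y ∈ frontier (ballOne h x) := by
  obtain ⟨Ox, hOx, hxO⟩ := exists_isTranslationDomain h x
  obtain ⟨Oy, hOy, hyO⟩ := exists_isTranslationDomain h y
  have hxy : x ≠ y := fun he => hsing.1 ⟨0, by rw [h.iter_zero, he]⟩
  have hmeet : ∀ V ∈ 𝓝 y, (Ox ∩ V).Nonempty := fun V hV => by
    obtain ⟨n, -, z, ⟨w, hw, rfl⟩, hz⟩ := hsing.2 Ox (hOx.1.mem_nhds hxO) V hV 0
    exact ⟨_, hOx.iter_mem hw n, hz⟩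
  constructor
  · rw [transDist, if_neg hxy]
    have h2 : ConnectsBy h x y 2 := by
      have hU : ⋃ i, ![Ox, Oy] i = Ox ∪ Oy := by
        ext z; simp [Fin.exists_fin_two]
      refine ⟨![Ox, Oy], fun i => ?_, ?_, ?_, ?_⟩
      · fin_cases i
        · exact hOx
        · exact hOy
      · rw [hU]
        exact IsConnected.union (hmeet Oy (hOy.1.mem_nhds hyO)) hOx.2.1 hOy.2.1
      · rw [hU]; exact Or.inl hxO
      · rw [hU]; exact Or.inr hyO
    refine le_antisymm (Nat.sInf_le h2) (le_csInf ⟨2, h2⟩ ?_)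
    rintro k ⟨O, hO, -, hx, hy⟩
    obtain ⟨i, hi⟩ := mem_iUnion.1 hx
    obtain ⟨j, hj⟩ := mem_iUnion.1 hy
    by_contra hk
    have hij : i = j := Fin.ext (by omega)
    rw [← hij] at hj
    exact hsing.notMem_of_isTranslationDomain (hO i) hi hj
  · refine ⟨mem_closure_iff_nhds.2 fun V hV => ?_, fun hy => ?_⟩
    · obtain ⟨z, hz1, hz2⟩ := hmeet V hV
      exact ⟨z, hz2, Ox, ⟨hOx, hxO⟩, hz1⟩
    · obtain ⟨O, ⟨hO, hxO'⟩, hyO'⟩ := interior_subset hy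
      exact hsing.notMem_of_isTranslationDomain hO hxO' hyO'
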